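/- Let ξ be a ℂ-point of M_q such that the centralizer of ξ in M(N,K) has dimension N, where K is the subfield of ℂ generated by the entries of ξ, and assume q ∈ ℂ* is transcendental over K. Then the kernel of β^ξ coincides with the right ideal of O(M_q) generated by τ_i − τ_i(ξ), i = 1, …, N. If in addition ξ is diagonal, then the image of β^ξ is O(D\GL_q). -/

import Mathlib

open TensorProduct

set_option maxHeartbeats 1000000
set_option synthInstance.maxHeartbeats 400000

noncomputable section

/-- Number of inversions (the length) of a permutation of `Fin t`. -/
def invCount {t : ℕ} (σ : Equiv.Perm (Fin t)) : ℕ :=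
  (Finset.univ.filter fun p : Fin t × Fin t => p.1 < p.2 ∧ σ p.2 < σ p.1).card

/-- The principal quantum minor `[I|I]` of the matrix of generators `x`. -/
def qMinor {A : Type} [CommRing A] {M : Type} [Ring M] [Algebra A M] {N : ℕ}
    (q : A) (x : Fin N → Fin N → M) (I : Finset (Fin N)) : M :=
  ∑ σ : Equiv.Perm (Fin I.card),
    ((-q) ^ invCount σ) •
      ((List.finRange I.card).map fun k =>
        x ((I.orderIsoOfFin rfl) k).1 ((I.orderIsoOfFin rfl) (σ k)).1).prod

/-- The quantum determinant. -/
def qdet {A : Type} [CommRing A] {M : Type} [Ring M] [Algebra A M] {N : ℕ}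
    (q : A) (x : Fin N → Fin N → M) : M :=
  qMinor q x Finset.univ

/-- `w(I)`: the sum of the elements of `I` (with `{1, …, N}` indexing). -/
def wtSet {N : ℕ} (I : Finset (Fin N)) : ℕ := ∑ j ∈ I, (j.1 + 1)

/-- The weighted sum `τ_i` of principal quantum minors of size `i`. -/
def tauCoinv {A : Type} [CommRing A] {M : Type} [Ring M] [Algebra A M] {N : ℕ}
    (q qinv : A) (x : Fin N → Fin N → M) (i : ℕ) : M :=
  ∑ I ∈ Finset.univ.filter (fun I : Finset (Fin N) => I.card = i),
    qinv ^ (2 * wtSet I) • qMinor q x I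

/-- The sum `σ_i` of all principal quantum minors of size `i`. -/
def sigmaCoinv {A : Type} [CommRing A] {M : Type} [Ring M] [Algebra A M] {N : ℕ}
    (q : A) (x : Fin N → Fin N → M) (i : ℕ) : M :=
  ∑ I ∈ Finset.univ.filter (fun I : Finset (Fin N) => I.card = i), qMinor q x I

/-- The right adjoint coaction `β(h) = Σ h₂ ⊗ S(h₁)h₃`. -/
def adjBeta {A : Type} [CommRing A] {M G : Type} [Ring M] [Algebra A M] [Ring G] [Algebra A G]
    (ΔM : M →ₐ[A] M ⊗[A] M) (ι : M →ₐ[A] G) (St : G →ₗ[A] G) : M →ₗ[A] M ⊗[A] G :=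
  TensorProduct.map LinearMap.id (LinearMap.mul' A G) ∘ₗ
  (TensorProduct.assoc A M G G).toLinearMap ∘ₗ
  TensorProduct.map
    ((TensorProduct.comm A G M).toLinearMap ∘ₗ
      TensorProduct.map (St ∘ₗ ι.toLinearMap) LinearMap.id)
    ι.toLinearMap ∘ₗ
  TensorProduct.map ΔM.toLinearMap LinearMap.id ∘ₗ ΔM.toLinearMap

/-- The right coaction `α(h) = Σ h₂ ⊗ h₃S(h₁)`. -/
def adjAlpha {A : Type} [CommRing A] {M G : Type} [Ring M] [Algebra A M] [Ring G] [Algebra A G]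
    (ΔM : M →ₐ[A] M ⊗[A] M) (ι : M →ₐ[A] G) (St : G →ₗ[A] G) : M →ₗ[A] M ⊗[A] G :=
  TensorProduct.map LinearMap.id (LinearMap.mul' A G) ∘ₗ
  TensorProduct.map LinearMap.id (TensorProduct.comm A G G).toLinearMap ∘ₗ
  (TensorProduct.assoc A M G G).toLinearMap ∘ₗ
  TensorProduct.map
    ((TensorProduct.comm A G M).toLinearMap ∘ₗ
      TensorProduct.map (St ∘ₗ ι.toLinearMap) LinearMap.id)
    ι.toLinearMap ∘ₗ
  TensorProduct.map ΔM.toLinearMap LinearMap.id ∘ₗ ΔM.toLinearMap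

/-- The co-orbit map associated to a point `e = ev_ξ` and a coaction `b`. -/
def coorbit {A : Type} [CommRing A] {M G : Type} [Ring M] [Algebra A M] [Ring G] [Algebra A G]
    (e : M →ₐ[A] A) (b : M →ₗ[A] M ⊗[A] G) : M →ₗ[A] G :=
  (TensorProduct.lid A G).toLinearMap ∘ₗ TensorProduct.map e.toLinearMap LinearMap.id ∘ₗ b

/-- The left coaction `λ_D = (π_D ⊗ id) ∘ Δ` of a quotient Hopf algebra. -/
def leftCoact {A : Type} [CommRing A] {G D : Type} [Ring G] [Algebra A G]
    [CommRing D] [Algebra A D]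
    (πD : G →ₐ[A] D) (ΔG : G →ₐ[A] G ⊗[A] G) : G →ₗ[A] D ⊗[A] G :=
  TensorProduct.map πD.toLinearMap LinearMap.id ∘ₗ ΔG.toLinearMap

/-- Coinvariants of the left coaction `λ_D`. -/
def dCoinv {A : Type} [CommRing A] {G D : Type} [Ring G] [Algebra A G]
    [CommRing D] [Algebra A D]
    (πD : G →ₐ[A] D) (ΔG : G →ₐ[A] G ⊗[A] G) : Set G :=
  {f : G | leftCoact πD ΔG f = (1 : D) ⊗ₜ[A] f}

/-- The right coaction `ρ_D = (id ⊗ π_D) ∘ Δ`. -/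
def rightCoact {A : Type} [CommRing A] {G D : Type} [Ring G] [Algebra A G]
    [CommRing D] [Algebra A D]
    (πD : G →ₐ[A] D) (ΔG : G →ₐ[A] G ⊗[A] G) : G →ₗ[A] G ⊗[A] D :=
  TensorProduct.map LinearMap.id πD.toLinearMap ∘ₗ ΔG.toLinearMap

/-- The weight space of weight `ta : D` for the grading induced by `ρ_D`. -/
def weightSpace' {A : Type} [CommRing A] {G D : Type} [Ring G] [Algebra A G]
    [CommRing D] [Algebra A D]
    (πD : G →ₐ[A] D) (ΔG : G →ₐ[A] G ⊗[A] G) (ta : D) : Submodule A G :=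
  LinearMap.ker (rightCoact πD ΔG - (TensorProduct.mk A G D).flip ta)

/-- The subcomodule generated by a subset `s` of the comodule `(M, b)`. -/
def comodGen {A : Type} [CommRing A] {M G : Type} [Ring M] [Algebra A M] [Ring G] [Algebra A G]
    (b : M →ₗ[A] M ⊗[A] G) (s : Set M) : Submodule A M :=
  sInf {W : Submodule A M | s ⊆ W ∧
    ∀ w ∈ W, b w ∈ LinearMap.range (TensorProduct.map W.subtype (LinearMap.id : G →ₗ[A] G))}

/-- The subfield of `ℂ` generated by the entries of `ξ`. -/
def entriesSubfield {N : ℕ} (ξ : Matrix (Fin N) (Fin N) ℂ) : Subfield ℂ :=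
  Subfield.closure (Set.range fun p : Fin N × Fin N => ξ p.1 p.2)

/-- `ξ` viewed as a matrix over the subfield generated by its entries. -/
def liftEntries {N : ℕ} (ξ : Matrix (Fin N) (Fin N) ℂ) :
    Matrix (Fin N) (Fin N) ↥(entriesSubfield ξ) :=
  Matrix.of fun i j => ⟨ξ i j, Subfield.subset_closure (Set.mem_range_self (i, j))⟩

/-! ### Inversions and alternating vectors -/

/-- Number of inversions of a finite sequence. -/
def seqInv {n N : ℕ} (j : Fin n → Fin N) : ℕ :=
  (Finset.univ.filter fun p : Fin n × Fin n => p.1 < p.2 ∧ j p.2 < j p.1).card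

lemma seqInv_strictMono_comp {n N : ℕ} {J : Fin n → Fin N} (hJ : StrictMono J)
    (σ : Equiv.Perm (Fin n)) : seqInv (J ∘ σ) = invCount σ := by
  unfold seqInv invCount
  simp [hJ.lt_iff_lt]

lemma swap_lt_swap {n : ℕ} {a b : Fin n} (hab : a.1 + 1 = b.1) {c d : Fin n} (hcd : c < d)
    (hne : ¬ (c = a ∧ d = b)) : Equiv.swap a b c < Equiv.swap a b d := by
  rw [Fin.lt_def] at hcd ⊢
  simp only [Equiv.swap_apply_def]
  simp only [Fin.ext_iff] at hne ⊢
  split_ifs <;> omega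

lemma seqInv_comp_swap {n N : ℕ} {a b : Fin n} (hab : a.1 + 1 = b.1) {j : Fin n → Fin N}
    (hj : j a < j b) : seqInv (j ∘ Equiv.swap a b) = seqInv j + 1 := by
  classical
  have hlt : a < b := by rw [Fin.lt_def]; omega
  unfold seqInv
  have : (Finset.univ.filter fun p : Fin n × Fin n => p.1 < p.2 ∧
        (j ∘ Equiv.swap a b) p.2 < (j ∘ Equiv.swap a b) p.1)
      = insert (a, b) ((Finset.univ.filter fun p : Fin n × Fin n => p.1 < p.2 ∧ j p.2 < j p.1).map
        ((Equiv.prodCongr (Equiv.swap a b) (Equiv.swap a b)).toEmbedding)) := by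
    ext ⟨c, d⟩
    simp only [Finset.mem_filter, Finset.mem_univ, true_and, Finset.mem_insert, Finset.mem_map_equiv,
      Function.comp, Prod.mk.injEq, Equiv.prodCongr_symm, Equiv.symm_swap, Equiv.prodCongr_apply,
      Prod.map]
    constructor
    · rintro ⟨h1, h2⟩
      by_cases hc : c = a ∧ d = b
      · exact Or.inl hc
      · exact Or.inr ⟨swap_lt_swap hab h1 hc, h2⟩
    · rintro (⟨rfl, rfl⟩ | ⟨h1, h2⟩)
      · simp [hlt, hj]
      · refine ⟨?_, h2⟩
        have := swap_lt_swap hab h1 (by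
          rintro ⟨h3, h4⟩
          rw [h3, h4] at h2
          exact absurd h2 hj.not_gt)
        simpa using this
  rw [this, Finset.card_insert_of_notMem, Finset.card_map]
  simp [Finset.mem_map_equiv, hlt.not_gt]

/-- The alternating vector attached to an increasing sequence. -/
def altVec {n N : ℕ} (q : ℂ) (J : Fin n ↪o Fin N) (j : Fin n → Fin N) : ℂ :=
  open Classical in if ∃ σ : Equiv.Perm (Fin n), j = J ∘ σ then (-q) ^ seqInv j else 0

/-- Diagonal coefficient of the braiding on words. -/
def braidC {n N : ℕ} (q : ℂ) (a b : Fin n) (j : Fin n → Fin N) : ℂ := if j a = j b then q else 1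

/-- Off-diagonal coefficient of the braiding on words. -/
def braidH {n N : ℕ} (q : ℂ) (a b : Fin n) (j : Fin n → Fin N) : ℂ :=
  if j a < j b then q - q⁻¹ else 0

/-- `f` is an eigenvector of all the braidings, with eigenvalue `-q⁻¹`. -/
def IsAlt {n N : ℕ} (q : ℂ) {V : Type*} [AddCommGroup V] [Module ℂ V]
    (f : (Fin n → Fin N) → V) : Prop :=
  ∀ (a b : Fin n), a.1 + 1 = b.1 → ∀ j,
    braidC q a b j • f (j ∘ Equiv.swap a b) + braidH q a b j • f j = (-q⁻¹) • f j

/-- The quantum factorial, as a sum over permutations. -/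
def qFact (q : ℂ) (n : ℕ) : ℂ := ∑ σ : Equiv.Perm (Fin n), (-q) ^ invCount σ * (-q) ^ invCount σ

lemma comp_swap_eq_self {n N : ℕ} {a b : Fin n} {j : Fin n → Fin N} (h : j a = j b) :
    j ∘ Equiv.swap a b = j := by
  funext c
  simp only [Function.comp, Equiv.swap_apply_def]
  split_ifs with h1 h2 <;> simp_all

lemma IsAlt.of_lt {n N : ℕ} {q : ℂ} {V : Type*} [AddCommGroup V] [Module ℂ V]
    {f : (Fin n → Fin N) → V} (hf : IsAlt q f) {a b : Fin n} (hab : a.1 + 1 = b.1)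
    {j : Fin n → Fin N} (hj : j a < j b) : f (j ∘ Equiv.swap a b) = (-q) • f j := by
  have := hf a b hab j
  rw [braidC, braidH, if_neg hj.ne, if_pos hj, one_smul, ← eq_sub_iff_add_eq, ← sub_smul] at this
  rw [this]; congr 1; ring

lemma IsAlt.of_eq {n N : ℕ} {q : ℂ} (hq : q + q⁻¹ ≠ 0) {V : Type*} [AddCommGroup V] [Module ℂ V]
    {f : (Fin n → Fin N) → V} (hf : IsAlt q f) {a b : Fin n} (hab : a.1 + 1 = b.1)
    {j : Fin n → Fin N} (hj : j a = j b) : f j = 0 := by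
  have := hf a b hab j
  rw [braidC, braidH, if_pos hj, if_neg hj.not_lt, zero_smul, add_zero, comp_swap_eq_self hj,
    ← sub_eq_zero, ← sub_smul, sub_neg_eq_add] at this
  exact (smul_eq_zero.1 this).resolve_left hq

lemma exists_descent_or_strictMono {n N : ℕ} (j : Fin n → Fin N) :
    (∃ a b : Fin n, a.1 + 1 = b.1 ∧ j a = j b) ∨ (∃ a b : Fin n, a.1 + 1 = b.1 ∧ j b < j a) ∨
      StrictMono j := by
  by_contra! h
  obtain ⟨h1, h2, h3⟩ := h
  apply h3
  cases n with
  | zero => intro a; exact a.elim0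
  | succ n =>
    rw [Fin.strictMono_iff_lt_succ]
    intro i
    exact lt_of_le_of_ne (h2 i.castSucc i.succ (by simp)) (h1 i.castSucc i.succ (by simp))

lemma IsAlt.eq_zero {n N : ℕ} {q : ℂ} (hq : q + q⁻¹ ≠ 0) {V : Type*} [AddCommGroup V] [Module ℂ V]
    {f : (Fin n → Fin N) → V} (hf : IsAlt q f) {j : Fin n → Fin N} (hj : ¬ Function.Injective j) :
    f j = 0 := by
  induction h : seqInv j using Nat.strong_induction_on generalizing j with
  | _ m ih =>
    rcases exists_descent_or_strictMono j with ⟨a, b, hab, h1⟩ | ⟨a, b, hab, h1⟩ | h1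
    · exact hf.of_eq hq hab h1
    · have h2 : (j ∘ Equiv.swap a b) a < (j ∘ Equiv.swap a b) b := by simpa using h1
      have h3 := hf.of_lt hab h2
      have h4 := seqInv_comp_swap hab h2
      have h5 : (j ∘ Equiv.swap a b) ∘ Equiv.swap a b = j := by
        funext c; simp
      rw [h5] at h3 h4
      rw [h3, ih _ (by omega) (j := j ∘ Equiv.swap a b) _ rfl, smul_zero]
      intro h6
      apply hj
      rw [← h5]
      exact h6.comp (Equiv.injective _)
    · exact absurd h1.injective hj

lemma strictMono_perm_eq {n N : ℕ} {J : Fin n → Fin N} (hJ : StrictMono J)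
    {σ : Equiv.Perm (Fin n)} (h : StrictMono (J ∘ σ)) : J ∘ σ = J := by
  have h1 : Set.range (J ∘ σ) = Set.range J := by
    rw [Set.range_comp, σ.surjective.range_eq, Set.image_univ]
  exact (h.range_inj hJ).1 h1

lemma IsAlt.comp_perm {n N : ℕ} {q : ℂ} {V : Type*} [AddCommGroup V] [Module ℂ V]
    {f : (Fin n → Fin N) → V} (hf : IsAlt q f) {J : Fin n → Fin N} (hJ : StrictMono J)
    (σ : Equiv.Perm (Fin n)) :
    f (J ∘ σ) = (-q) ^ seqInv (J ∘ σ) • f J := by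
  induction h : seqInv (J ∘ σ) using Nat.strong_induction_on generalizing σ with
  | _ m ih =>
    rcases exists_descent_or_strictMono (J ∘ σ) with ⟨a, b, hab, h1⟩ | ⟨a, b, hab, h1⟩ | h1
    · have := (hJ.injective.comp σ.injective) h1
      rw [this] at hab; omega
    · have h5 : ((J ∘ σ) ∘ Equiv.swap a b) ∘ Equiv.swap a b = J ∘ σ := by
        funext c; simp
      have h2 : ((J ∘ σ) ∘ Equiv.swap a b) a < ((J ∘ σ) ∘ Equiv.swap a b) b := by simpa using h1
      have h3 := hf.of_lt hab h2
      have h4 := seqInv_comp_swap hab h2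
      have h6 : (J ∘ σ) ∘ Equiv.swap a b = J ∘ ⇑(σ * Equiv.swap a b) := by
        funext c; simp
      rw [h5] at h3 h4
      rw [h6] at h3 h4
      rw [h3, ih _ (by omega) (σ * Equiv.swap a b) rfl, smul_smul, ← h, h4]
      congr 1; ring
    · have h2 := strictMono_perm_eq hJ h1
      have h3 : seqInv J = 0 := by
        unfold seqInv
        rw [Finset.card_eq_zero, Finset.filter_eq_empty_iff]
        rintro ⟨c, d⟩ -
        simp only [not_and, not_lt]
        intro hcd; exact (hJ hcd).le
      rw [← h, h2, h3]; simp

lemma orderEmb_eq_of_comp {n N : ℕ} {J J' : Fin n ↪o Fin N} {σ σ' : Equiv.Perm (Fin n)}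
    (h : J ∘ σ = J' ∘ σ') : J = J' := by
  have h1 : Set.range (J ∘ σ) = Set.range J := by
    rw [Set.range_comp, σ.surjective.range_eq, Set.image_univ]
  have h2 : Set.range (J' ∘ σ') = Set.range J' := by
    rw [Set.range_comp, σ'.surjective.range_eq, Set.image_univ]
  apply DFunLike.coe_injective
  rw [← J.strictMono.range_inj J'.strictMono, ← h1, ← h2, h]

lemma exists_orderEmb_of_injective {n N : ℕ} {j : Fin n → Fin N} (hj : Function.Injective j) :
    ∃ (J : Fin n ↪o Fin N) (σ : Equiv.Perm (Fin n)), j = J ∘ σ := by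
  have hm : StrictMono (j ∘ Tuple.sort j) :=
    (Tuple.monotone_sort j).strictMono_of_injective (hj.comp (Equiv.injective _))
  refine ⟨OrderEmbedding.ofStrictMono _ hm, (Tuple.sort j)⁻¹, ?_⟩
  funext c
  simp

lemma IsAlt.eq_sum {n N : ℕ} {q : ℂ} (hq : q + q⁻¹ ≠ 0) {V : Type*} [AddCommGroup V] [Module ℂ V]
    {f : (Fin n → Fin N) → V} (hf : IsAlt q f) (j : Fin n → Fin N) :
    f j = ∑ J : Fin n ↪o Fin N, altVec q J j • f J := by
  by_cases hj : Function.Injective j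
  · obtain ⟨J, σ, rfl⟩ := exists_orderEmb_of_injective hj
    rw [Finset.sum_eq_single J]
    · rw [altVec, if_pos ⟨σ, rfl⟩]
      exact hf.comp_perm J.strictMono σ
    · intro J' _ hne
      rw [altVec, if_neg, zero_smul]
      rintro ⟨σ', h⟩
      exact hne (orderEmb_eq_of_comp h).symm
    · simp
  · rw [hf.eq_zero hq hj, Finset.sum_eq_zero]
    intro J _
    rw [altVec, if_neg, zero_smul]
    rintro ⟨σ', rfl⟩
    exact hj (J.injective.comp σ'.injective)

lemma altVec_comp_swap {n N : ℕ} {q : ℂ} (J : Fin n ↪o Fin N) {a b : Fin n} (hab : a.1 + 1 = b.1)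
    {j : Fin n → Fin N} (hj : j a < j b) :
    altVec q J (j ∘ Equiv.swap a b) = (-q) * altVec q J j := by
  unfold altVec
  have : (∃ σ : Equiv.Perm (Fin n), j ∘ Equiv.swap a b = J ∘ σ) ↔
      ∃ σ : Equiv.Perm (Fin n), j = J ∘ σ := by
    constructor
    · rintro ⟨σ, h⟩
      refine ⟨σ * Equiv.swap a b, ?_⟩
      funext c
      have := congrFun h (Equiv.swap a b c)
      simpa using this
    · rintro ⟨σ, h⟩
      refine ⟨σ * Equiv.swap a b, ?_⟩
      funext c
      simp [h]
  simp only [this, seqInv_comp_swap hab hj]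
  split_ifs
  · ring
  · simp

lemma altVec_isAlt {n N : ℕ} {q : ℂ} (hq : q ≠ 0) (J : Fin n ↪o Fin N) : IsAlt q (altVec q J) := by
  intro a b hab j
  rcases lt_trichotomy (j a) (j b) with h | h | h
  · rw [altVec_comp_swap J hab h, braidC, braidH, if_neg h.ne, if_pos h]
    simp only [smul_eq_mul]; ring
  · have : altVec q J j = 0 := by
      rw [altVec, if_neg]
      rintro ⟨σ, rfl⟩
      have := J.injective.comp σ.injective h
      rw [this] at hab; omega
    rw [comp_swap_eq_self h, this]; simp
  · have h2 : (j ∘ Equiv.swap a b) a < (j ∘ Equiv.swap a b) b := by simpa using h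
    have h5 : (j ∘ Equiv.swap a b) ∘ Equiv.swap a b = j := by
        funext c; simp
    have h3 := altVec_comp_swap (q := q) J hab h2
    rw [h5] at h3
    rw [h3, braidC, braidH, if_neg h.ne', if_neg h.not_gt]
    simp only [smul_eq_mul]
    field_simp
    ring

lemma sum_altVec_smul {n N : ℕ} (q : ℂ) {V : Type*} [AddCommGroup V] [Module ℂ V]
    (J : Fin n ↪o Fin N) (g : (Fin n → Fin N) → V) :
    ∑ j, altVec q J j • g j = ∑ σ : Equiv.Perm (Fin n), (-q) ^ invCount σ • g (J ∘ σ) := by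
  classical
  have hinj : Function.Injective fun σ : Equiv.Perm (Fin n) => (J ∘ σ : Fin n → Fin N) := by
    intro σ τ h
    ext c
    have := congrFun h c
    simp at this
    rw [this]
  symm
  refine Finset.sum_of_injOn (fun σ => J ∘ σ) (hinj.injOn) (by simp) ?_ ?_
  · intro j _ hj
    rw [altVec, if_neg, zero_smul]
    rintro ⟨σ, rfl⟩
    exact hj ⟨σ, by simp, rfl⟩
  · intro σ _
    rw [altVec, if_pos ⟨σ, rfl⟩, seqInv_strictMono_comp J.strictMono]

lemma altVec_comp_perm {n N : ℕ} (q : ℂ) (J : Fin n ↪o Fin N) (σ : Equiv.Perm (Fin n)) :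
    altVec q J (J ∘ σ) = (-q) ^ invCount σ := by
  rw [altVec, if_pos ⟨σ, rfl⟩, seqInv_strictMono_comp J.strictMono]

lemma sum_altVec_mul_altVec {n N : ℕ} (q : ℂ) (J J' : Fin n ↪o Fin N)
    (g : (Fin n → Fin N) → ℂ) (hg : ∀ j (σ : Equiv.Perm (Fin n)), g (j ∘ σ) = g j) :
    ∑ j, altVec q J j * (altVec q J' j * g j) = if J = J' then qFact q n * g J else 0 := by
  have := sum_altVec_smul q J (fun j => altVec q J' j * g j)
  simp only [smul_eq_mul] at this
  rw [this]
  split_ifs with h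
  · subst h
    rw [qFact, Finset.sum_mul]
    refine Finset.sum_congr rfl fun σ _ => ?_
    rw [altVec_comp_perm, hg, mul_assoc]
  · refine Finset.sum_eq_zero fun σ _ => ?_
    rw [altVec, if_neg, zero_mul, mul_zero]
    rintro ⟨σ', h'⟩
    exact h (orderEmb_eq_of_comp h')

/-! ### Quantum matrices and words -/

/-- The defining relations of quantum matrices. -/
structure IsQMat {M : Type*} [Ring M] [Algebra ℂ M] {N : ℕ} (q : ℂ)
    (x : Fin N → Fin N → M) : Prop where
  row : ∀ i j l : Fin N, j < l → x i j * x i l = q • (x i l * x i j)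
  col : ∀ i k j : Fin N, i < k → x i j * x k j = q • (x k j * x i j)
  anti : ∀ i k j l : Fin N, i < k → j < l → x i l * x k j = x k j * x i l
  diag : ∀ i k j l : Fin N, i < k → j < l →
      x i j * x k l - x k l * x i j = (q - q⁻¹) • (x i l * x k j)

/-- The two-site exchange relation. -/
lemma IsQMat.exchange {M : Type*} [Ring M] [Algebra ℂ M] {N : ℕ} {q : ℂ} (hq : q ≠ 0)
    {x : Fin N → Fin N → M} (hx : IsQMat q x) (a b e f : Fin N) :
    (if a = b then q else 1) • (x b e * x a f) + (if a < b then q - q⁻¹ else 0) • (x a e * x b f)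
      = (if e = f then q else 1) • (x a f * x b e)
        + (if e < f then q - q⁻¹ else 0) • (x a e * x b f) := by
  have key : ∀ u v : M, u = q • v → q • u = v + (q - q⁻¹) • u := by
    rintro u v rfl
    rw [sub_smul, smul_smul q⁻¹, inv_mul_cancel₀ hq, one_smul]; abel
  rcases lt_trichotomy a b with hab | rfl | hab <;> rcases lt_trichotomy e f with hef | rfl | hef
  · simp only [hab.ne, hef.ne, hab, hef, if_true, if_false, one_smul]
    rw [hx.anti a b e f hab hef]
  · simp only [hab.ne, hab, lt_irrefl, if_true, if_false, one_smul, zero_smul, add_zero]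
    exact (key _ _ (hx.col a b e hab)).symm
  · simp only [hab.ne, hef.ne', hab, hef.not_gt, if_true, if_false, one_smul, zero_smul, add_zero]
    rw [← hx.diag a b f e hab hef]; abel
  · simp only [hef.ne, hef, lt_irrefl, if_true, if_false, one_smul, zero_smul, add_zero]
    exact (key _ _ (hx.row a e f hef))
  · simp
  · simp only [hef.ne', hef.not_gt, lt_irrefl, if_true, if_false, one_smul, zero_smul, add_zero]
    exact (hx.row a f e hef).symm
  · simp only [hab.ne', hef.ne, hab.not_gt, hef, if_true, if_false, one_smul, zero_smul, add_zero]
    rw [← hx.anti b a e f hab hef, ← hx.diag b a e f hab hef]; abel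
  · simp only [hab.ne', hab.not_gt, lt_irrefl, if_true, if_false, one_smul, zero_smul, add_zero]
    exact hx.col b a e hab
  · simp only [hab.ne', hef.ne', hab.not_gt, hef.not_gt, if_false, one_smul, zero_smul,
      add_zero]
    exact (hx.anti b a f e hab hef)

/-- The product of the generators along a pair of words. -/
def wordProd {M : Type*} [Monoid M] {N n : ℕ} (x : Fin N → Fin N → M) (i j : Fin n → Fin N) : M :=
  (List.ofFn fun k => x (i k) (j k)).prod

section wordProd

variable {M : Type*} [Monoid M] {N n : ℕ} (x : Fin N → Fin N → M)

lemma wordProd_zero (i j : Fin 0 → Fin N) : wordProd x i j = 1 := by simp [wordProd]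

lemma wordProd_succ (i j : Fin (n + 1) → Fin N) :
    wordProd x i j = x (i 0) (j 0) * wordProd x (Fin.tail i) (Fin.tail j) := by
  simp [wordProd, List.ofFn_succ, Fin.tail]

lemma wordProd_cons (a b : Fin N) (i j : Fin n → Fin N) :
    wordProd x (Fin.cons a i) (Fin.cons b j) = x a b * wordProd x i j := by
  rw [wordProd_succ]; simp

lemma wordProd_snoc (a b : Fin N) (i j : Fin n → Fin N) :
    wordProd x (Fin.snoc i a) (Fin.snoc j b) = wordProd x i j * x a b := by
  rw [wordProd, List.ofFn_succ']; simp [wordProd]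

lemma map_wordProd {M' F : Type*} [Monoid M'] [FunLike F M M'] [MonoidHomClass F M M'] (φ : F)
    (i j : Fin n → Fin N) : φ (wordProd x i j) = wordProd (fun a b => φ (x a b)) i j := by
  simp [wordProd, map_list_prod, List.map_ofFn, Function.comp_def]

lemma wordProd_one (x : Fin N → Fin N → M) (i j : Fin 1 → Fin N) :
    wordProd x i j = x (i 0) (j 0) := by
  simp [wordProd_succ, wordProd_zero]

end wordProd

lemma tail_comp_swap {N n : ℕ} (j : Fin (n + 1) → Fin N) (a b : Fin n) :
    Fin.tail (j ∘ Equiv.swap a.succ b.succ) = Fin.tail j ∘ Equiv.swap a b := by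
  funext c
  simp only [Fin.tail, Function.comp]
  congr 1
  simp only [Equiv.swap_apply_def, Fin.succ_inj]
  split_ifs <;> rfl

lemma IsQMat.word_exchange {M : Type*} [Ring M] [Algebra ℂ M] {N n : ℕ} {q : ℂ} (hq : q ≠ 0)
    {x : Fin N → Fin N → M} (hx : IsQMat q x) (a b : Fin n) (hab : a.1 + 1 = b.1)
    (l j : Fin n → Fin N) :
    braidC q a b l • wordProd x (l ∘ Equiv.swap a b) j + braidH q a b l • wordProd x l j
      = braidC q a b j • wordProd x l (j ∘ Equiv.swap a b) + braidH q a b j • wordProd x l j := by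
  induction n with
  | zero => exact a.elim0
  | succ n ih =>
    induction a using Fin.cases with
    | zero =>
      cases n with
      | zero => have := b.2; simp at hab
      | succ n =>
        have hb : b = Fin.succ 0 := by ext; simp at hab ⊢; omega
        subst hb
        have ht : ∀ j : Fin (n + 1 + 1) → Fin N,
            Fin.tail (Fin.tail (j ∘ Equiv.swap 0 (Fin.succ 0))) = Fin.tail (Fin.tail j) := by
          intro j
          funext c
          simp only [Fin.tail, Function.comp]
          rw [Equiv.swap_apply_of_ne_of_ne (by exact Fin.succ_ne_zero _)]
          intro h
          exact Fin.succ_ne_zero _ (Fin.succ_injective _ h)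
        have h0 : ∀ j : Fin (n + 1 + 1) → Fin N, (j ∘ Equiv.swap 0 (Fin.succ 0)) 0 = j 1 := by
          intro j; simp
        have h1 : ∀ j : Fin (n + 1 + 1) → Fin N,
            Fin.tail (j ∘ Equiv.swap 0 (Fin.succ 0)) 0 = j 0 := by
          intro j; simp [Fin.tail]
        have h2 : ∀ j : Fin (n + 1 + 1) → Fin N, Fin.tail j 0 = j 1 := by
          intro j; simp [Fin.tail]
        simp only [wordProd_succ, ht, h0, h1, h2, ← mul_assoc]
        have := congrArg (· * wordProd x (Fin.tail (Fin.tail l)) (Fin.tail (Fin.tail j)))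
          (hx.exchange hq (l 0) (l 1) (j 0) (j 1))
        simp only [add_mul, smul_mul_assoc] at this
        exact this
    | succ a =>
      induction b using Fin.cases with
      | zero => simp at hab
      | succ b =>
        have := ih a b (by simpa using hab) (Fin.tail l) (Fin.tail j)
        have h0 : ∀ j : Fin (n + 1) → Fin N, (j ∘ Equiv.swap a.succ b.succ) 0 = j 0 := by
          intro j
          simp only [Function.comp]
          rw [Equiv.swap_apply_of_ne_of_ne (Fin.succ_ne_zero _).symm (Fin.succ_ne_zero _).symm]
        simp only [wordProd_succ, tail_comp_swap, h0]
        have := congrArg (x (l 0) (j 0) * ·) this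
        simp only [mul_add, mul_smul_comm] at this
        exact this

/-- The braiding as a matrix. -/
def braidMat {N n : ℕ} (q : ℂ) (a b : Fin n) : Matrix (Fin n → Fin N) (Fin n → Fin N) ℂ :=
  Matrix.of fun l m => (if m = l ∘ Equiv.swap a b then braidC q a b l else 0)
    + (if m = l then braidH q a b l else 0)

lemma comp_swap_swap {N n : ℕ} (a b : Fin n) (j : Fin n → Fin N) :
    (j ∘ Equiv.swap a b) ∘ Equiv.swap a b = j := by
  funext c; simp

lemma eq_comp_swap_iff {N n : ℕ} (a b : Fin n) (m j : Fin n → Fin N) :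
    m = j ∘ Equiv.swap a b ↔ j = m ∘ Equiv.swap a b := by
  constructor <;> rintro rfl <;> rw [comp_swap_swap]

lemma braidC_comp_swap {N n : ℕ} (q : ℂ) (a b : Fin n) (j : Fin n → Fin N) :
    braidC q a b (j ∘ Equiv.swap a b) = braidC q a b j := by
  simp [braidC, eq_comm]

lemma braidMat_symm {N n : ℕ} (q : ℂ) (a b : Fin n) (l m : Fin n → Fin N) :
    braidMat q a b l m = braidMat q a b m l := by
  simp only [braidMat, Matrix.of_apply]
  congr 1
  · simp only [eq_comp_swap_iff a b m l]
    split_ifs with h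
    · rw [h, braidC_comp_swap]
    · rfl
  · simp only [eq_comm (a := m)]
    split_ifs with h
    · rw [h]
    · rfl

lemma sum_braidMat_smul {N n : ℕ} (q : ℂ) {V : Type*} [AddCommGroup V] [Module ℂ V]
    (a b : Fin n) (l : Fin n → Fin N) (f : (Fin n → Fin N) → V) :
    ∑ m, braidMat q a b l m • f m
      = braidC q a b l • f (l ∘ Equiv.swap a b) + braidH q a b l • f l := by
  simp [braidMat, add_smul, Finset.sum_add_distrib, ite_smul]

/-- A matrix with entries in an algebra which commutes with all the braidings. -/
def CommBraid {N n : ℕ} {B : Type*} [Ring B] [Algebra ℂ B] (q : ℂ)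
    (X : Matrix (Fin n → Fin N) (Fin n → Fin N) B) : Prop :=
  ∀ a b : Fin n, a.1 + 1 = b.1 → Commute ((braidMat q a b).map (algebraMap ℂ B)) X

lemma commBraid_iff {N n : ℕ} {B : Type*} [Ring B] [Algebra ℂ B] {q : ℂ}
    {X : Matrix (Fin n → Fin N) (Fin n → Fin N) B} :
    CommBraid q X ↔ ∀ a b : Fin n, a.1 + 1 = b.1 → ∀ l j,
      braidC q a b l • X (l ∘ Equiv.swap a b) j + braidH q a b l • X l j
        = braidC q a b j • X l (j ∘ Equiv.swap a b) + braidH q a b j • X l j := by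
  have h1 : ∀ (a b : Fin n) (l j : Fin n → Fin N), ((braidMat q a b).map (algebraMap ℂ B) * X : Matrix (Fin n → Fin N) (Fin n → Fin N) B) l j
      = braidC q a b l • X (l ∘ Equiv.swap a b) j + braidH q a b l • X l j := by
    intro a b l j
    rw [Matrix.mul_apply, ← sum_braidMat_smul q a b l (fun m => X m j)]
    simp [Algebra.smul_def]
  have h2 : ∀ (a b : Fin n) (l j : Fin n → Fin N), (X * (braidMat q a b).map (algebraMap ℂ B) : Matrix (Fin n → Fin N) (Fin n → Fin N) B) l j
      = braidC q a b j • X l (j ∘ Equiv.swap a b) + braidH q a b j • X l j := by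
    intro a b l j
    rw [Matrix.mul_apply, ← sum_braidMat_smul q a b j (fun m => X l m)]
    simp [Algebra.smul_def, braidMat_symm q a b _ j, Algebra.commutes]
  constructor
  · intro h a b hab l j
    rw [← h1, ← h2, (h a b hab).eq]
  · intro h a b hab
    ext l j
    rw [h1, h2, h a b hab]

lemma IsQMat.commBraid {M : Type*} [Ring M] [Algebra ℂ M] {N : ℕ} {q : ℂ} (hq : q ≠ 0)
    {x : Fin N → Fin N → M} (hx : IsQMat q x) (n : ℕ) :
    CommBraid q (Matrix.of (wordProd (n := n) x)) :=
  commBraid_iff.2 fun a b hab l j => hx.word_exchange hq a b hab l j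

lemma CommBraid.inverse {N n : ℕ} {B : Type*} [Ring B] [Algebra ℂ B] {q : ℂ}
    {X Y : Matrix (Fin n → Fin N) (Fin n → Fin N) B} (hX : CommBraid q X)
    (h1 : X * Y = 1) (h2 : Y * X = 1) : CommBraid q Y := by
  intro a b hab
  have := hX a b hab
  let u : (Matrix (Fin n → Fin N) (Fin n → Fin N) B)ˣ := ⟨X, Y, h1, h2⟩
  exact Commute.units_inv_right (u := u) this

/-- The antisymmetrizer. -/
def altMat {N : ℕ} (q : ℂ) (n : ℕ) : Matrix (Fin n → Fin N) (Fin n → Fin N) ℂ :=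
  Matrix.of fun i j => ∑ J : Fin n ↪o Fin N, altVec q J i * altVec q J j

/-- The quantum minor with increasing rows `I` and columns `J`. -/
def genMinor {N n : ℕ} {B : Type*} [Ring B] [Algebra ℂ B] (q : ℂ)
    (X : Matrix (Fin n → Fin N) (Fin n → Fin N) B) (I J : Fin n ↪o Fin N) : B :=
  ∑ j, altVec q J j • X I j

lemma CommBraid.isAlt_right {N n : ℕ} {B : Type*} [Ring B] [Algebra ℂ B] {q : ℂ} (hq : q ≠ 0)
    {X : Matrix (Fin n → Fin N) (Fin n → Fin N) B} (hX : CommBraid q X) (J : Fin n ↪o Fin N) :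
    IsAlt q fun i => ∑ j, altVec q J j • X i j := by
  intro a b hab l
  rw [commBraid_iff] at hX
  have h1 := hX a b hab l
  simp only [Finset.smul_sum, ← Finset.sum_add_distrib, smul_comm _ (altVec q J _), ← smul_add, h1]
  have h2 := altVec_isAlt hq J a b hab
  calc _ = ∑ j, ∑ m, (altVec q J j * braidMat q a b j m) • X l m := by
        refine Finset.sum_congr rfl fun j _ => ?_
        rw [← sum_braidMat_smul q a b j (fun m => X l m), Finset.smul_sum]
        simp [smul_smul]
    _ = ∑ m, ∑ j, (braidMat q a b m j * altVec q J j) • X l m := by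
        rw [Finset.sum_comm]
        simp [mul_comm, braidMat_symm q a b]
    _ = _ := by
        refine Finset.sum_congr rfl fun m _ => ?_
        rw [← Finset.sum_smul]
        have := sum_braidMat_smul q a b m (altVec q J)
        simp only [smul_eq_mul] at this h2
        rw [this, h2, smul_smul, mul_comm]

lemma CommBraid.isAlt_left {N n : ℕ} {B : Type*} [Ring B] [Algebra ℂ B] {q : ℂ} (hq : q ≠ 0)
    {X : Matrix (Fin n → Fin N) (Fin n → Fin N) B} (hX : CommBraid q X) (J : Fin n ↪o Fin N) :
    IsAlt q fun j => ∑ i, altVec q J i • X i j := by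
  intro a b hab l
  rw [commBraid_iff] at hX
  have h1 := fun i => hX a b hab i l
  simp only [Finset.smul_sum, ← Finset.sum_add_distrib, smul_comm _ (altVec q J _), ← smul_add,
    ← h1]
  have h2 := altVec_isAlt hq J a b hab
  calc _ = ∑ j, ∑ m, (altVec q J j * braidMat q a b j m) • X m l := by
        refine Finset.sum_congr rfl fun j _ => ?_
        rw [← sum_braidMat_smul q a b j (fun m => X m l), Finset.smul_sum]
        simp [smul_smul]
    _ = ∑ m, ∑ j, (braidMat q a b m j * altVec q J j) • X m l := by
        rw [Finset.sum_comm]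
        simp [mul_comm, braidMat_symm q a b]
    _ = _ := by
        refine Finset.sum_congr rfl fun m _ => ?_
        rw [← Finset.sum_smul]
        have := sum_braidMat_smul q a b m (altVec q J)
        simp only [smul_eq_mul] at this h2
        rw [this, h2, smul_smul, mul_comm]


section minors

variable {N n : ℕ} {B : Type*} [Ring B] [Algebra ℂ B] {q : ℂ}
  {X : Matrix (Fin n → Fin N) (Fin n → Fin N) B}

lemma CommBraid.sum_altVec_right (hq : q ≠ 0) (hq' : q + q⁻¹ ≠ 0) (hX : CommBraid q X)
    (J : Fin n ↪o Fin N) (i : Fin n → Fin N) :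
    ∑ j, altVec q J j • X i j = ∑ I : Fin n ↪o Fin N, altVec q I i • genMinor q X I J :=
  (hX.isAlt_right hq J).eq_sum hq' i

lemma CommBraid.sum_altVec_left (hq : q ≠ 0) (hq' : q + q⁻¹ ≠ 0) (hn : qFact q n ≠ 0)
    (hX : CommBraid q X) (I : Fin n ↪o Fin N) (j : Fin n → Fin N) :
    ∑ i, altVec q I i • X i j = ∑ J : Fin n ↪o Fin N, altVec q J j • genMinor q X I J := by
  rw [(hX.isAlt_left hq I).eq_sum hq' j]
  refine Finset.sum_congr rfl fun J _ => ?_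
  congr 1
  refine smul_right_injective B hn ?_
  dsimp only
  have orth : ∀ (K K' : Fin n ↪o Fin N), ∑ j, altVec q K j * altVec q K' j
      = if K = K' then qFact q n else 0 := by
    intro K K'
    simpa using sum_altVec_mul_altVec q K K' (fun _ => 1) (by simp)
  have e1 : ∑ i, altVec q I i • ∑ j, altVec q J j • X i j
      = qFact q n • genMinor q X I J := by
    have := fun i => hX.sum_altVec_right hq hq' J i
    simp only [this]
    simp only [Finset.smul_sum, smul_smul]
    rw [Finset.sum_comm]
    simp only [← Finset.sum_smul, orth]
    simp
  have e2 : ∑ j, altVec q J j • ∑ i, altVec q I i • X i j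
      = qFact q n • ∑ i, altVec q I i • X i J := by
    have := fun j => (hX.isAlt_left hq I).eq_sum hq' j
    rw [Finset.sum_congr rfl fun j _ => congrArg (altVec q J j • ·) (this j)]
    simp only [Finset.smul_sum (r := altVec q J _)]
    rw [Finset.sum_comm]
    simp only [smul_smul, ← Finset.sum_smul, orth]
    simp
  rw [← e1, ← e2]
  simp only [Finset.smul_sum]
  rw [Finset.sum_comm]
  simp only [smul_comm (altVec q J _) (altVec q I _)]

lemma CommBraid.commute_altMat (hq : q ≠ 0) (hq' : q + q⁻¹ ≠ 0) (hn : qFact q n ≠ 0)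
    (hX : CommBraid q X) : Commute ((altMat q n).map (algebraMap ℂ B)) X := by
  ext l m
  rw [Matrix.mul_apply, Matrix.mul_apply]
  have h1 := fun I => hX.sum_altVec_left hq hq' hn I m
  have h2 := fun I => hX.sum_altVec_right hq hq' I l
  calc _ = ∑ I : Fin n ↪o Fin N, altVec q I l • ∑ i, altVec q I i • X i m := by
        simp only [altMat, Matrix.map_apply, Matrix.of_apply, ← Algebra.smul_def, Finset.sum_smul,
          Finset.smul_sum, mul_smul]
        rw [Finset.sum_comm]
    _ = ∑ I : Fin n ↪o Fin N, altVec q I m • ∑ i, altVec q I i • X l i := by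
        simp only [h1, h2]
        simp only [Finset.smul_sum]
        rw [Finset.sum_comm]
        simp only [smul_smul, mul_comm]
    _ = _ := by
        simp only [altMat, Matrix.map_apply, Matrix.of_apply, ← Algebra.commutes,
          ← Algebra.smul_def, Finset.sum_smul, Finset.smul_sum]
        rw [Finset.sum_comm]
        simp only [smul_smul, mul_comm]

end minors

/-! ### The Hopf algebra structure on words -/

/-- The data of the quantum general linear group, with generic parameter. -/
structure IsQGL {M G : Type} [Ring M] [Algebra ℂ M] [Ring G] [Algebra ℂ G] {N : ℕ} (q : ℂ)
    (x : Fin N → Fin N → M) (ι : M →ₐ[ℂ] G) (dInv : G) (ΔM : M →ₐ[ℂ] M ⊗[ℂ] M)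
    (ΔG : G →ₐ[ℂ] G ⊗[ℂ] G) (εG : G →ₐ[ℂ] ℂ) (St : G →ₗ[ℂ] G) : Prop where
  q_ne : q ≠ 0
  q_add : q + q⁻¹ ≠ 0
  qFact_ne : ∀ n, qFact q n ≠ 0
  rel : IsQMat q x
  gen : Algebra.adjoin ℂ (Set.range fun p : Fin N × Fin N => x p.1 p.2) = ⊤
  det_mul : ι (qdet q x) * dInv = 1
  mul_det : dInv * ι (qdet q x) = 1
  genG : Algebra.adjoin ℂ
      (Set.range (fun p : Fin N × Fin N => ι (x p.1 p.2)) ∪ {dInv}) = ⊤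
  comulM : ∀ i j, ΔM (x i j) = ∑ k, x i k ⊗ₜ[ℂ] x k j
  comulG : ∀ m, ΔG (ι m) = Algebra.TensorProduct.map ι ι (ΔM m)
  counit : ∀ i j, εG (ι (x i j)) = if i = j then 1 else 0
  antipode_left : LinearMap.mul' ℂ G ∘ₗ TensorProduct.map St LinearMap.id ∘ₗ ΔG.toLinearMap
      = Algebra.linearMap ℂ G ∘ₗ εG.toLinearMap
  antipode_right : LinearMap.mul' ℂ G ∘ₗ TensorProduct.map LinearMap.id St ∘ₗ ΔG.toLinearMap
      = Algebra.linearMap ℂ G ∘ₗ εG.toLinearMap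

lemma sum_fin_cons {N n : ℕ} {V : Type*} [AddCommMonoid V] (f : (Fin (n + 1) → Fin N) → V) :
    ∑ k, f k = ∑ a, ∑ k, f (Fin.cons a k) := by
  rw [← (Fin.consEquiv fun _ => Fin N).sum_comp, Fintype.sum_prod_type]
  rfl

lemma sum_fin_snoc {N n : ℕ} {V : Type*} [AddCommMonoid V] (f : (Fin (n + 1) → Fin N) → V) :
    ∑ k, f k = ∑ a, ∑ k, f (Fin.snoc k a) := by
  rw [← (Fin.snocEquiv fun _ => Fin N).sum_comp, Fintype.sum_prod_type]
  rfl

lemma fin_cons_inj_iff {N n : ℕ} {a b : Fin N} {i j : Fin n → Fin N} :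
    (Fin.cons a i : Fin (n + 1) → Fin N) = Fin.cons b j ↔ a = b ∧ i = j :=
  Fin.cons_inj

namespace IsQGL

variable {M G : Type} [Ring M] [Algebra ℂ M] [Ring G] [Algebra ℂ G] {N : ℕ} {q : ℂ}
    {x : Fin N → Fin N → M} {ι : M →ₐ[ℂ] G} {dInv : G} {ΔM : M →ₐ[ℂ] M ⊗[ℂ] M}
    {ΔG : G →ₐ[ℂ] G ⊗[ℂ] G} {εG : G →ₐ[ℂ] ℂ} {St : G →ₗ[ℂ] G}

lemma comulM_word (H : IsQGL q x ι dInv ΔM ΔG εG St) {n : ℕ} (i j : Fin n → Fin N) :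
    ΔM (wordProd x i j) = ∑ k, wordProd x i k ⊗ₜ[ℂ] wordProd x k j := by
  induction n with
  | zero => simp [wordProd_zero, Algebra.TensorProduct.one_def]
  | succ n ih =>
    rw [wordProd_succ, map_mul, ih, H.comulM, sum_fin_cons, Finset.sum_mul_sum]
    refine Finset.sum_congr rfl fun a _ => Finset.sum_congr rfl fun k _ => ?_
    simp [wordProd_succ]

lemma comulG_word (H : IsQGL q x ι dInv ΔM ΔG εG St) {n : ℕ} (i j : Fin n → Fin N) :
    ΔG (ι (wordProd x i j)) = ∑ k, ι (wordProd x i k) ⊗ₜ[ℂ] ι (wordProd x k j) := by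
  rw [H.comulG, H.comulM_word]
  simp

lemma counit_word (H : IsQGL q x ι dInv ΔM ΔG εG St) {n : ℕ} (i j : Fin n → Fin N) :
    εG (ι (wordProd x i j)) = if i = j then 1 else 0 := by
  induction n with
  | zero => simp [wordProd_zero, Subsingleton.elim i j]
  | succ n ih =>
    rw [wordProd_succ, map_mul, map_mul, ih, H.counit]
    conv_rhs => rw [← Fin.cons_self_tail i, ← Fin.cons_self_tail j]
    simp only [fin_cons_inj_iff]
    split_ifs <;> simp_all

/-- The matrix of words in the quantum group. -/
def tMat (x : Fin N → Fin N → M) (ι : M →ₐ[ℂ] G) (n : ℕ) :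
    Matrix (Fin n → Fin N) (Fin n → Fin N) G :=
  Matrix.of fun i j => ι (wordProd x i j)

/-- The matrix of antipodes of words. -/
def sMat (x : Fin N → Fin N → M) (ι : M →ₐ[ℂ] G) (St : G →ₗ[ℂ] G) (n : ℕ) :
    Matrix (Fin n → Fin N) (Fin n → Fin N) G :=
  Matrix.of fun i j => St (ι (wordProd x i j))

lemma sMat_mul_tMat (H : IsQGL q x ι dInv ΔM ΔG εG St) (n : ℕ) :
    sMat x ι St n * tMat x ι n = 1 := by
  ext i j
  have := LinearMap.congr_fun H.antipode_left (ι (wordProd x i j))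
  simp only [LinearMap.comp_apply, AlgHom.toLinearMap_apply, H.comulG_word, map_sum,
    TensorProduct.map_tmul, LinearMap.mul'_apply, H.counit_word, LinearMap.id_apply] at this
  rw [Matrix.mul_apply]
  simp only [sMat, tMat, Matrix.of_apply, this, Matrix.one_apply]
  split_ifs <;> simp

lemma tMat_mul_sMat (H : IsQGL q x ι dInv ΔM ΔG εG St) (n : ℕ) :
    tMat x ι n * sMat x ι St n = 1 := by
  ext i j
  have := LinearMap.congr_fun H.antipode_right (ι (wordProd x i j))
  simp only [LinearMap.comp_apply, AlgHom.toLinearMap_apply, H.comulG_word, map_sum,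
    TensorProduct.map_tmul, LinearMap.mul'_apply, H.counit_word, LinearMap.id_apply] at this
  rw [Matrix.mul_apply]
  simp only [sMat, tMat, Matrix.of_apply, this, Matrix.one_apply]
  split_ifs <;> simp

lemma sum_s_t (H : IsQGL q x ι dInv ΔM ΔG εG St) {n : ℕ} (i j : Fin n → Fin N) :
    ∑ k, St (ι (wordProd x i k)) * ι (wordProd x k j) = if i = j then 1 else 0 := by
  have := congrFun (congrFun (H.sMat_mul_tMat n) i) j
  simpa [Matrix.mul_apply, sMat, tMat, Matrix.one_apply] using this

lemma sum_t_s (H : IsQGL q x ι dInv ΔM ΔG εG St) {n : ℕ} (i j : Fin n → Fin N) :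
    ∑ k, ι (wordProd x i k) * St (ι (wordProd x k j)) = if i = j then 1 else 0 := by
  have := congrFun (congrFun (H.tMat_mul_sMat n) i) j
  simpa [Matrix.mul_apply, sMat, tMat, Matrix.one_apply] using this

lemma wordProd_const {M : Type} [Ring M] {N : ℕ} {x : Fin N → Fin N → M} (a b : Fin N) :
    wordProd x (fun _ : Fin 1 => a) (fun _ => b) = x a b := by
  simp [wordProd_one]

lemma sum_s_t_one (H : IsQGL q x ι dInv ΔM ΔG εG St) (i j : Fin N) :
    ∑ k, St (ι (x i k)) * ι (x k j) = if i = j then 1 else 0 := by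
  have := H.sum_s_t (fun _ : Fin 1 => i) (fun _ => j)
  rw [← (Equiv.funUnique (Fin 1) (Fin N)).symm.sum_comp] at this
  simpa [wordProd_one, funext_iff] using this

lemma sum_t_s_one (H : IsQGL q x ι dInv ΔM ΔG εG St) (i j : Fin N) :
    ∑ k, ι (x i k) * St (ι (x k j)) = if i = j then 1 else 0 := by
  have := H.sum_t_s (fun _ : Fin 1 => i) (fun _ => j)
  rw [← (Equiv.funUnique (Fin 1) (Fin N)).symm.sum_comp] at this
  simpa [wordProd_one, funext_iff] using this

lemma st_one (H : IsQGL q x ι dInv ΔM ΔG εG St) : St 1 = 1 := by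
  have := H.sum_s_t (n := 0) default default
  simpa [wordProd_zero] using this

lemma eq_sMat_of_mul_tMat (H : IsQGL q x ι dInv ΔM ΔG εG St) {n : ℕ}
    {Y : Matrix (Fin n → Fin N) (Fin n → Fin N) G} (hY : Y * tMat x ι n = 1) :
    Y = sMat x ι St n :=
  left_inv_eq_right_inv hY (H.tMat_mul_sMat n)

lemma st_cons (H : IsQGL q x ι dInv ΔM ΔG εG St) {n : ℕ} (a b : Fin N) (i j : Fin n → Fin N) :
    St (ι (wordProd x (Fin.cons a i) (Fin.cons b j)))
      = St (ι (wordProd x i j)) * St (ι (x a b)) := by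
  have : (Matrix.of fun i j : Fin (n + 1) → Fin N =>
      St (ι (wordProd x (Fin.tail i) (Fin.tail j))) * St (ι (x (i 0) (j 0)))) * tMat x ι (n + 1)
      = 1 := by
    ext i j
    rw [Matrix.mul_apply, sum_fin_cons]
    simp only [Matrix.of_apply, tMat, wordProd_succ, Fin.tail_cons, Fin.cons_zero, map_mul]
    calc _ = ∑ k, St (ι (wordProd x (Fin.tail i) k)) *
            ((∑ a, St (ι (x (i 0) a)) * ι (x a (j 0))) * ι (wordProd x k (Fin.tail j))) := by
          rw [Finset.sum_comm]
          simp only [Finset.sum_mul, Finset.mul_sum, mul_assoc]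
      _ = _ := by
          rw [H.sum_s_t_one, Matrix.one_apply]
          conv_rhs => rw [← Fin.cons_self_tail i, ← Fin.cons_self_tail j]
          simp only [fin_cons_inj_iff]
          by_cases h : i 0 = j 0
          · simp [h, H.sum_s_t]
          · simp [h]
  have h2 := congrFun (congrFun (H.eq_sMat_of_mul_tMat this) (Fin.cons a i)) (Fin.cons b j)
  simpa [sMat] using h2.symm

lemma st_append (H : IsQGL q x ι dInv ΔM ΔG εG St) {m n : ℕ} (i j : Fin m → Fin N)
    (k l : Fin n → Fin N) :
    St (ι (wordProd x i j * wordProd x k l))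
      = St (ι (wordProd x k l)) * St (ι (wordProd x i j)) := by
  induction m with
  | zero => simp [wordProd_zero, H.st_one]
  | succ m ih =>
    have hs : ∀ (m : ℕ) (i j : Fin m → Fin N), ∃ i' j' : Fin (m + n) → Fin N,
        wordProd x i' j' = wordProd x i j * wordProd x k l := fun m i j =>
      ⟨Fin.append i k, Fin.append j l, by
        rw [wordProd, wordProd, wordProd, ← List.prod_append, ← List.ofFn_fin_append]
        congr 2
        funext c
        refine Fin.addCases (fun c => ?_) (fun c => ?_) c <;> simp⟩
    obtain ⟨i', j', h'⟩ := hs m (Fin.tail i) (Fin.tail j)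
    have h1 := ih (Fin.tail i) (Fin.tail j)
    rw [← h'] at h1
    rw [wordProd_succ x i j, mul_assoc, ← h', ← wordProd_cons, H.st_cons, h1, mul_assoc,
      ← H.st_cons, ← wordProd_cons]
    
lemma st_snoc (H : IsQGL q x ι dInv ΔM ΔG εG St) {n : ℕ} (a b : Fin N) (i j : Fin n → Fin N) :
    St (ι (wordProd x (Fin.snoc i a) (Fin.snoc j b)))
      = St (ι (x a b)) * St (ι (wordProd x i j)) := by
  rw [wordProd_snoc, ← wordProd_const (x := x) a b, H.st_append]

end IsQGL

/-! ### Quantum traces and coinvariance -/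

/-- The weight `q^{-2i}` of an index. -/
def dW {N : ℕ} (q : ℂ) (i : Fin N) : ℂ := q⁻¹ ^ (2 * (i.1 + 1))

/-- The weight of a word. -/
def dWord {N n : ℕ} (q : ℂ) (i : Fin n → Fin N) : ℂ := ∏ k, dW q (i k)

lemma dWord_comp_perm {N n : ℕ} (q : ℂ) (i : Fin n → Fin N) (σ : Equiv.Perm (Fin n)) :
    dWord q (i ∘ σ) = dWord q i :=
  Equiv.prod_comp σ fun k => dW q (i k)

lemma dW_ne_zero {N : ℕ} {q : ℂ} (hq : q ≠ 0) (i : Fin N) : dW q i ≠ 0 := by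
  unfold dW; positivity

lemma sum_dW_lt {N : ℕ} {q : ℂ} (hq : q ≠ 0) (d : Fin N) :
    q * dW q d + (q - q⁻¹) * ∑ g ∈ Finset.univ.filter (· < d), dW q g = q⁻¹ := by
  obtain ⟨d, hd⟩ := d
  induction d with
  | zero =>
    have : (Finset.univ.filter (· < (⟨0, hd⟩ : Fin N))) = ∅ := by
      ext a; simp [Fin.lt_def]
    rw [this]; simp only [dW, Finset.sum_empty]; field_simp; simp
    field_simp
  | succ d ih =>
    have h1 := ih (by omega)
    have : (Finset.univ.filter (· < (⟨d + 1, hd⟩ : Fin N)))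
        = insert ⟨d, by omega⟩ (Finset.univ.filter (· < (⟨d, by omega⟩ : Fin N))) := by
      ext a; simp [Fin.lt_def, Fin.ext_iff]; omega
    rw [this, Finset.sum_insert (by simp)]
    simp only [dW] at h1 ⊢
    have : q * q⁻¹ = 1 := mul_inv_cancel₀ hq
    have e : q⁻¹ ^ (2 * (d + 1 + 1)) = q⁻¹ ^ (2 * (d + 1)) * q⁻¹ ^ 2 := by ring
    rw [e]
    linear_combination h1 + (q⁻¹ ^ (2 * (d + 1)) * q⁻¹) * this

namespace IsQGL

variable {M G : Type} [Ring M] [Algebra ℂ M] [Ring G] [Algebra ℂ G] {N : ℕ} {q : ℂ}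
    {x : Fin N → Fin N → M} {ι : M →ₐ[ℂ] G} {dInv : G} {ΔM : M →ₐ[ℂ] M ⊗[ℂ] M}
    {ΔG : G →ₐ[ℂ] G ⊗[ℂ] G} {εG : G →ₐ[ℂ] ℂ} {St : G →ₗ[ℂ] G}

/-- The exchange relation between generators and antipodes of generators. -/
lemma cross_exchange (H : IsQGL q x ι dInv ΔM ΔG εG St) (g h b e : Fin N) :
    (if h = b then q else 1) • (St (ι (x g h)) * ι (x b e))
      + (if h = b then ∑ a, (if a < b then q - q⁻¹ else 0) • (St (ι (x g a)) * ι (x a e)) else 0)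
    = (if e = g then q else 1) • (ι (x b e) * St (ι (x g h)))
      + (if g = e then ∑ d, (if e < d then q - q⁻¹ else 0) • (ι (x b d) * St (ι (x d h)))
          else 0) := by
  have key := fun a f => congrArg (fun m => St (ι (x g a)) * ι m * St (ι (x f h)))
    (H.rel.exchange H.q_ne a b e f)
  have key2 : ∑ a, ∑ f, _ = ∑ a, ∑ f, _ :=
    Finset.sum_congr rfl fun a _ => Finset.sum_congr rfl fun f _ => key a f
  simp only [map_add, map_smul, map_mul, mul_add, add_mul, Finset.sum_add_distrib,
    mul_smul_comm, smul_mul_assoc] at key2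
  have e1 : ∀ a, ∑ f, (if a = b then q else 1) •
      (St (ι (x g a)) * (ι (x b e) * ι (x a f)) * St (ι (x f h)))
      = (if a = b then q else 1) • (if a = h then St (ι (x g a)) * ι (x b e) else 0) := by
    intro a
    rw [← Finset.smul_sum]
    simp only [mul_assoc, ← Finset.mul_sum, H.sum_t_s_one]
    split_ifs <;> simp
  have e2 : ∀ a, ∑ f, (if a < b then q - q⁻¹ else 0) •
      (St (ι (x g a)) * (ι (x a e) * ι (x b f)) * St (ι (x f h)))
      = (if h = b then (if a < b then q - q⁻¹ else 0) • (St (ι (x g a)) * ι (x a e)) else 0) := by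
    intro a
    rw [← Finset.smul_sum]
    simp only [mul_assoc, ← Finset.mul_sum, H.sum_t_s_one]
    simp only [eq_comm (a := b)]
    split_ifs <;> simp
  have e3 : ∀ f, ∑ a, (if e = f then q else 1) •
      (St (ι (x g a)) * (ι (x a f) * ι (x b e)) * St (ι (x f h)))
      = (if e = f then q else 1) • (if g = f then ι (x b e) * St (ι (x f h)) else 0) := by
    intro f
    rw [← Finset.smul_sum]
    simp only [← mul_assoc, ← Finset.sum_mul, H.sum_s_t_one]
    split_ifs <;> simp
  have e4 : ∀ f, ∑ a, (if e < f then q - q⁻¹ else 0) •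
      (St (ι (x g a)) * (ι (x a e) * ι (x b f)) * St (ι (x f h)))
      = (if g = e then (if e < f then q - q⁻¹ else 0) • (ι (x b f) * St (ι (x f h))) else 0) := by
    intro f
    rw [← Finset.smul_sum]
    simp only [← mul_assoc, ← Finset.sum_mul, H.sum_s_t_one]
    split_ifs <;> simp
  simp only [e1, e2] at key2
  rw [Finset.sum_comm (f := fun a f => (if e = f then q else 1) • _),
    Finset.sum_comm (f := fun a f => (if e < f then q - q⁻¹ else 0) • _)] at key2
  simp only [e3, e4] at key2
  simp only [smul_ite, smul_zero, Finset.sum_ite_eq', Finset.sum_ite_eq, Finset.mem_univ,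
    if_true] at key2
  have e5 : ∀ (p : Prop) [Decidable p] (f : Fin N → G),
      ∑ a, (if p then f a else 0) = if p then ∑ a, f a else 0 := by
    intro p _ f; split_ifs <;> simp
  rw [e5, e5] at key2
  exact key2

/-- The quantum trace identity. -/
lemma sum_dW (H : IsQGL q x ι dInv ΔM ΔG εG St) (k l : Fin N) :
    ∑ i, dW q i • (St (ι (x i k)) * ι (x l i)) = if k = l then algebraMap ℂ G (dW q k) else 0 := by
  have hR : ∀ h b : Fin N, ∑ g, dW q g • (q • (ι (x b g) * St (ι (x g h)))
      + ∑ d, (if g < d then q - q⁻¹ else 0) • (ι (x b d) * St (ι (x d h))))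
      = if b = h then algebraMap ℂ G q⁻¹ else 0 := by
    intro h b
    calc _ = ∑ d, (q * dW q d + (q - q⁻¹) * ∑ g ∈ Finset.univ.filter (· < d), dW q g) •
          (ι (x b d) * St (ι (x d h))) := by
          simp only [smul_add, Finset.sum_add_distrib, add_smul, Finset.smul_sum]
          congr 1
          · simp only [smul_smul, mul_comm]
          · rw [Finset.sum_comm]
            refine Finset.sum_congr rfl fun d _ => ?_
            simp only [smul_smul, ← Finset.sum_smul]
            congr 1
            rw [Finset.mul_sum, Finset.sum_filter]
            refine Finset.sum_congr rfl fun g _ => ?_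
            split_ifs <;> ring
      _ = _ := by
          simp only [sum_dW_lt H.q_ne, ← Finset.smul_sum, H.sum_t_s_one]
          split_ifs
          · rw [Algebra.smul_def, mul_one]
          · simp
  by_cases hkl : k = l
  · subst hkl
    rw [if_pos rfl]
    induction hk : k.1 using Nat.strong_induction_on generalizing k with
    | _ m ih =>
      have h1 := hR k k
      have h2 : ∑ g, dW q g • (q • (St (ι (x g k)) * ι (x k g))
          + ∑ a, (if a < k then q - q⁻¹ else 0) • (St (ι (x g a)) * ι (x a g)))
          = algebraMap ℂ G q⁻¹ := by
        rw [if_pos rfl] at h1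
        rw [← h1]
        refine Finset.sum_congr rfl fun g _ => ?_
        have := H.cross_exchange g k k g
        simp only [if_true] at this
        rw [this]
      simp only [smul_add, Finset.sum_add_distrib, Finset.smul_sum] at h2
      rw [Finset.sum_comm (f := fun g a => dW q g • (if a < k then q - q⁻¹ else 0) • _)] at h2
      have h3 : ∀ a, ∑ g, dW q g • (if a < k then q - q⁻¹ else 0) • (St (ι (x g a)) * ι (x a g))
          = algebraMap ℂ G (if a < k then (q - q⁻¹) * dW q a else 0) := by
        intro a
        simp only [smul_comm (dW q _)]
        rw [← Finset.smul_sum]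
        split_ifs with hak
        · rw [ih a.1 (by rw [← hk]; exact hak) a rfl, Algebra.smul_def, ← map_mul]
        · simp
      simp only [h3] at h2
      rw [← map_sum] at h2
      have h4 := sum_dW_lt H.q_ne k
      have h5 : ∑ a, (if a < k then (q - q⁻¹) * dW q a else 0)
          = (q - q⁻¹) * ∑ g ∈ Finset.univ.filter (· < k), dW q g := by
        rw [Finset.mul_sum, Finset.sum_filter]
      rw [h5, ← eq_sub_iff_add_eq, ← map_sub, ← eq_sub_of_add_eq h4] at h2
      simp only [smul_comm (dW q _) q] at h2
      rw [← Finset.smul_sum, map_mul, ← Algebra.smul_def] at h2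
      exact smul_right_injective G H.q_ne h2
  · rw [if_neg hkl]
    have h1 := hR k l
    rw [if_neg (Ne.symm hkl)] at h1
    rw [← h1]
    refine Finset.sum_congr rfl fun g _ => ?_
    have := H.cross_exchange g k l g
    simp only [if_true, if_neg hkl, one_smul, add_zero] at this
    rw [this]

/-- The quantum trace identity on words. -/
lemma sum_dWord (H : IsQGL q x ι dInv ΔM ΔG εG St) {n : ℕ} (k l : Fin n → Fin N) :
    ∑ i, dWord q i • (St (ι (wordProd x i k)) * ι (wordProd x l i))
      = if k = l then algebraMap ℂ G (dWord q k) else 0 := by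
  induction n with
  | zero => simp [wordProd_zero, Subsingleton.elim k l, H.st_one, dWord]
  | succ n ih =>
    rw [sum_fin_cons]
    obtain ⟨a, k, rfl⟩ : ∃ a k', k = Fin.cons a k' := ⟨k 0, Fin.tail k, by simp⟩
    obtain ⟨b, l, rfl⟩ : ∃ a k', l = Fin.cons a k' := ⟨l 0, Fin.tail l, by simp⟩
    have hd : ∀ (n : ℕ) (c : Fin N) (i : Fin n → Fin N),
        dWord q (Fin.cons c i : Fin (n + 1) → Fin N) = dW q c * dWord q i := by
      intro n c i; simp [dWord, Fin.prod_univ_succ]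
    rw [Finset.sum_comm]
    have h1 : ∀ (i : Fin n → Fin N) c, dWord q (Fin.cons c i : Fin (n + 1) → Fin N) •
        (St (ι (wordProd x (Fin.cons c i : Fin (n + 1) → Fin N) (Fin.cons a k))) *
          ι (wordProd x (Fin.cons b l : Fin (n + 1) → Fin N) (Fin.cons c i)))
        = dWord q i • (St (ι (wordProd x i k)) * (dW q c • (St (ι (x c a)) * ι (x b c)))
            * ι (wordProd x l i)) := by
      intro i c
      rw [hd, H.st_cons, wordProd_cons, map_mul]
      simp only [mul_smul_comm, smul_mul_assoc, smul_smul, mul_assoc, mul_comm]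
    simp only [h1, ← Finset.smul_sum, ← Finset.sum_mul, ← Finset.mul_sum, H.sum_dW]
    by_cases hab : a = b
    · subst hab
      rw [if_pos rfl]
      simp only [fin_cons_inj_iff, true_and, ← Algebra.commutes]
      simp only [← Algebra.smul_def, smul_mul_assoc, smul_comm _ (dW q a)]
      rw [← Finset.smul_sum, ih]
      split_ifs
      · rw [hd, map_mul, Algebra.smul_def]
      · simp
    · simp [hab]

end IsQGL

lemma qMinor_eq_genMinor {M : Type} [Ring M] [Algebra ℂ M] {N r : ℕ} (q : ℂ)
    (x : Fin N → Fin N → M) (I : Finset (Fin N)) (hI : I.card = r) :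
    qMinor q x I = genMinor q (Matrix.of (wordProd x)) (I.orderEmbOfFin hI)
      (I.orderEmbOfFin hI) := by
  subst hI
  rw [genMinor, sum_altVec_smul, qMinor]
  simp [wordProd, List.ofFn_eq_map]

lemma dWord_orderEmbOfFin {N r : ℕ} (q : ℂ) (I : Finset (Fin N)) (hI : I.card = r) :
    dWord q (I.orderEmbOfFin hI) = q⁻¹ ^ (2 * wtSet I) := by
  rw [dWord, wtSet, Finset.mul_sum, ← Finset.prod_pow_eq_pow_sum]
  conv_rhs => rw [← Finset.map_orderEmbOfFin_univ I hI, Finset.prod_map]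
  rfl

lemma tauCoinv_eq_sum {M : Type} [Ring M] [Algebra ℂ M] {N : ℕ} (q : ℂ)
    (x : Fin N → Fin N → M) (r : ℕ) :
    tauCoinv q q⁻¹ x r = ∑ J : Fin r ↪o Fin N,
      dWord q J • genMinor q (Matrix.of (wordProd x)) J J := by
  unfold tauCoinv
  refine Finset.sum_bij' (fun I hI => I.orderEmbOfFin (by simpa using hI))
    (fun J _ => Finset.univ.map J.toEmbedding) (by simp) (by simp) ?_ ?_ ?_
  · intro I hI; simp
  · intro J _
    exact (Finset.orderEmbOfFin_unique' _ (by simp)).symm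
  · intro I hI
    rw [← dWord_orderEmbOfFin q I (by simpa using hI),
      ← qMinor_eq_genMinor q x I (by simpa using hI)]

/-- `τ_r` as a quantum trace. -/
lemma IsQMat.qFact_smul_tauCoinv {M : Type} [Ring M] [Algebra ℂ M] {N : ℕ} {q : ℂ} (hq : q ≠ 0)
    (hq' : q + q⁻¹ ≠ 0) {x : Fin N → Fin N → M} (hx : IsQMat q x) (r : ℕ) :
    qFact q r • tauCoinv q q⁻¹ x r
      = ∑ i, ∑ j, (dWord q i * altMat q r i j) • wordProd x j i := by
  have hX := hx.commBraid hq r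
  rw [tauCoinv_eq_sum, Finset.smul_sum]
  have h1 : ∀ J : Fin r ↪o Fin N, qFact q r • dWord q J • genMinor q (Matrix.of (wordProd x)) J J
      = ∑ i, altVec q J i • dWord q i • ∑ j, altVec q J j • wordProd x j i := by
    intro J
    rw [sum_altVec_smul]
    have h2 := hX.sum_altVec_right hq hq' J
    simp only [dWord_comp_perm]
    calc _ = dWord q J • ∑ j, altVec q J j •
          ∑ I : Fin r ↪o Fin N, altVec q I j • genMinor q (Matrix.of (wordProd x)) I J := by
          simp only [Finset.smul_sum (r := altVec q J _), smul_smul (altVec q J _)]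
          rw [Finset.sum_comm]
          simp only [← Finset.sum_smul]
          have orth : ∀ (K K' : Fin r ↪o Fin N), ∑ j, altVec q K j * altVec q K' j
              = if K = K' then qFact q r else 0 := by
            intro K K'
            simpa using sum_altVec_mul_altVec q K K' (fun _ => 1) (by simp)
          simp [orth, smul_comm (qFact q r)]
      _ = _ := by
          simp only [← h2, smul_comm _ (dWord q J), ← Finset.smul_sum (r := dWord q J)]
          congr 1
          rw [← sum_altVec_smul q J
            (fun i => ∑ j, altVec q J j • wordProd x j i)]
          simp only [Finset.smul_sum]
          rw [Finset.sum_comm]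
          refine Finset.sum_congr rfl fun i _ => Finset.sum_congr rfl fun j _ => ?_
          rw [smul_comm, Matrix.of_apply]
  simp only [h1, altMat, Matrix.of_apply, Finset.mul_sum, Finset.sum_smul, Finset.smul_sum]
  rw [Finset.sum_comm]
  refine Finset.sum_congr rfl fun i _ => ?_
  rw [Finset.sum_comm]
  refine Finset.sum_congr rfl fun j _ => Finset.sum_congr rfl fun J _ => ?_
  rw [smul_smul, smul_smul]
  congr 1; ring

namespace IsQGL

variable {M G : Type} [Ring M] [Algebra ℂ M] [Ring G] [Algebra ℂ G] {N : ℕ} {q : ℂ}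
    {x : Fin N → Fin N → M} {ι : M →ₐ[ℂ] G} {dInv : G} {ΔM : M →ₐ[ℂ] M ⊗[ℂ] M}
    {ΔG : G →ₐ[ℂ] G ⊗[ℂ] G} {εG : G →ₐ[ℂ] ℂ} {St : G →ₗ[ℂ] G}

/-- Every element is a combination of words. -/
lemma span_word (H : IsQGL q x ι dInv ΔM ΔG εG St) :
    Submodule.span ℂ {m : M | ∃ (n : ℕ) (i j : Fin n → Fin N), m = wordProd x i j} = ⊤ := by
  rw [eq_top_iff]
  intro m _
  have hm : m ∈ Algebra.adjoin ℂ (Set.range fun p : Fin N × Fin N => x p.1 p.2) := by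
    rw [H.gen]; trivial
  rw [← Subalgebra.mem_toSubmodule, Algebra.adjoin_eq_span] at hm
  refine Submodule.span_mono ?_ hm
  intro m hm
  refine Submonoid.closure_induction ?_ ⟨0, default, default, (wordProd_zero _ _ _).symm⟩ ?_ hm
  · rintro _ ⟨p, rfl⟩
    exact ⟨1, fun _ => p.1, fun _ => p.2, (wordProd_const _ _).symm⟩
  · rintro _ _ _ _ ⟨m, i, j, rfl⟩ ⟨n, k, l, rfl⟩
    refine ⟨m + n, Fin.append i k, Fin.append j l, ?_⟩
    rw [wordProd, wordProd, wordProd, ← List.prod_append, ← List.ofFn_fin_append]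
    congr 2
    funext c
    refine Fin.addCases (fun c => ?_) (fun c => ?_) c
    · simp
    · simp

variable {e : M →ₐ[ℂ] ℂ} {ξ : Fin N → Fin N → ℂ}

/-- The co-orbit map on words. -/
lemma coorbit_word (H : IsQGL q x ι dInv ΔM ΔG εG St) (he : ∀ i j, e (x i j) = ξ i j) {n : ℕ}
    (i j : Fin n → Fin N) :
    coorbit e (adjBeta ΔM ι St) (wordProd x i j)
      = ∑ k, ∑ l, wordProd ξ k l • (St (ι (wordProd x i k)) * ι (wordProd x l j)) := by
  have h : ∀ k l : Fin n → Fin N, e (wordProd x k l) = wordProd ξ k l := by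
    intro k l; rw [map_wordProd]; simp only [he]
  simp only [coorbit, adjBeta, LinearMap.comp_apply, AlgHom.toLinearMap_apply, H.comulM_word,
    map_sum, TensorProduct.map_tmul, LinearMap.id_apply, TensorProduct.sum_tmul,
    LinearEquiv.coe_coe, TensorProduct.comm_tmul, TensorProduct.assoc_tmul, LinearMap.mul'_apply,
    TensorProduct.lid_tmul, h]
  rw [Finset.sum_comm]

lemma coorbit_one (H : IsQGL q x ι dInv ΔM ΔG εG St) (he : ∀ i j, e (x i j) = ξ i j) :
    coorbit e (adjBeta ΔM ι St) 1 = 1 := by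
  have := H.coorbit_word he (n := 0) default default
  simpa [wordProd_zero, H.st_one] using this

/-- The co-orbit map on a product with a generator on the right. -/
lemma coorbit_mul_gen (H : IsQGL q x ι dInv ΔM ΔG εG St) (he : ∀ i j, e (x i j) = ξ i j)
    (f : M) (i j : Fin N) :
    coorbit e (adjBeta ΔM ι St) (f * x i j)
      = ∑ k, ∑ l, ξ k l • (St (ι (x i k)) * coorbit e (adjBeta ΔM ι St) f * ι (x l j)) := by
  have hf : f ∈ Submodule.span ℂ {m : M | ∃ (n : ℕ) (i j : Fin n → Fin N), m = wordProd x i j} := by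
    rw [H.span_word]; trivial
  induction hf using Submodule.span_induction with
  | mem f hf =>
    obtain ⟨n, a, b, rfl⟩ := hf
    rw [← wordProd_snoc, H.coorbit_word he, H.coorbit_word he, sum_fin_snoc]
    refine Finset.sum_congr rfl fun k _ => ?_
    simp only [sum_fin_snoc, Finset.mul_sum, Finset.sum_mul, Finset.smul_sum]
    rw [Finset.sum_comm]
    refine Finset.sum_congr rfl fun l _ => ?_
    refine Finset.sum_congr rfl fun c _ => Finset.sum_congr rfl fun d _ => ?_
    rw [H.st_snoc, wordProd_snoc, wordProd_snoc]
    simp only [map_mul, mul_smul_comm, smul_mul_assoc, smul_smul, mul_assoc, mul_comm (wordProd _ c d)]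
  | zero => simp
  | add f g _ _ hf hg =>
    simp only [add_mul, map_add, hf, hg, mul_add, smul_add, Finset.sum_add_distrib]
  | smul c f _ hf =>
    simp only [smul_mul_assoc, map_smul, hf, mul_smul_comm, Finset.smul_sum, smul_comm _ c]

lemma e_tauCoinv (e : M →ₐ[ℂ] ℂ) (r : ℕ) (he : ∀ i j, e (x i j) = ξ i j) :
    e (tauCoinv q q⁻¹ x r) = tauCoinv q q⁻¹ (fun i j => ξ i j) r := by
  simp only [tauCoinv, qMinor, map_sum, map_smul, map_list_prod, List.map_map, Function.comp_def,
    he]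

/-- The elements `τ_r` are coinvariant. -/
lemma coorbit_tauCoinv (H : IsQGL q x ι dInv ΔM ΔG εG St) (he : ∀ i j, e (x i j) = ξ i j)
    (r : ℕ) :
    coorbit e (adjBeta ΔM ι St) (tauCoinv q q⁻¹ x r)
      = algebraMap ℂ G (e (tauCoinv q q⁻¹ x r)) := by
  refine smul_right_injective G (H.qFact_ne r) ?_
  dsimp only
  have hξ : IsQMat q (fun i j => ξ i j) := by
    have : (fun i j => ξ i j) = fun i j => e (x i j) := by simp [he]
    rw [this]
    have h := H.rel
    exact ⟨fun i j l hl => by rw [← map_mul, h.row i j l hl, map_smul, map_mul],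
      fun i k j hl => by rw [← map_mul, h.col i k j hl, map_smul, map_mul],
      fun i k j l h1 h2 => by rw [← map_mul, h.anti i k j l h1 h2, map_mul],
      fun i k j l h1 h2 => by rw [← map_mul, ← map_mul, ← map_sub, h.diag i k j l h1 h2,
        map_smul, map_mul]⟩
  have hS : CommBraid q (sMat x ι St r) := by
    have : CommBraid q (tMat x ι r) := by
      rw [commBraid_iff]
      intro a b hab l j
      have := congrArg ι (H.rel.word_exchange H.q_ne a b hab l j)
      simpa only [map_add, map_smul, tMat, Matrix.of_apply] using this
    exact this.inverse (H.tMat_mul_sMat r) (H.sMat_mul_tMat r)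
  have hA := (hS.commute_altMat H.q_ne H.q_add (H.qFact_ne r)).eq
  have hA' : ∀ i k, ∑ j, altMat q r i j • St (ι (wordProd x j k))
      = ∑ j, altMat q r j k • St (ι (wordProd x i j)) := by
    intro i k
    have := congrFun (congrFun hA i) k
    simpa [Matrix.mul_apply, sMat, ← Algebra.smul_def, ← Algebra.commutes] using this
  rw [e_tauCoinv e r he, ← map_smul, H.rel.qFact_smul_tauCoinv H.q_ne H.q_add,
    Algebra.algebraMap_eq_smul_one, smul_smul, ← smul_eq_mul (a := qFact q r),
    hξ.qFact_smul_tauCoinv H.q_ne H.q_add]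
  simp only [map_sum, map_smul, H.coorbit_word he]
  calc _ = ∑ i, ∑ k, ∑ l, (dWord q i * wordProd ξ k l) •
        ((∑ j, altMat q r i j • St (ι (wordProd x j k))) * ι (wordProd x l i)) := by
        refine Finset.sum_congr rfl fun i _ => ?_
        simp only [Finset.smul_sum, Finset.sum_mul]
        rw [Finset.sum_comm]
        refine Finset.sum_congr rfl fun k _ => ?_
        rw [Finset.sum_comm]
        refine Finset.sum_congr rfl fun l _ => Finset.sum_congr rfl fun j _ => ?_
        rw [smul_mul_assoc, smul_smul, smul_smul]
        congr 1; ring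
    _ = ∑ k, ∑ l, ∑ j, (wordProd ξ k l * altMat q r j k) •
          ∑ i, dWord q i • (St (ι (wordProd x i j)) * ι (wordProd x l i)) := by
        simp only [hA', Finset.smul_sum, Finset.sum_mul]
        rw [Finset.sum_comm]
        refine Finset.sum_congr rfl fun k _ => ?_
        rw [Finset.sum_comm]
        refine Finset.sum_congr rfl fun l _ => ?_
        rw [Finset.sum_comm]
        refine Finset.sum_congr rfl fun j _ => Finset.sum_congr rfl fun i _ => ?_
        rw [smul_mul_assoc, smul_smul, smul_smul]
        congr 1; ring
    _ = _ := by
        simp only [H.sum_dWord, smul_ite, smul_zero, Finset.sum_ite_eq', Finset.mem_univ, if_true]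
        rw [Finset.sum_smul, Finset.sum_comm]
        refine Finset.sum_congr rfl fun l _ => ?_
        rw [Finset.sum_smul]
        refine Finset.sum_congr rfl fun k _ => ?_
        rw [Algebra.algebraMap_eq_smul_one, smul_smul]
        congr 1
        simp only [smul_eq_mul]
        change _ = _ * wordProd ξ k l
        ring

lemma coorbit_tauCoinv_mul (H : IsQGL q x ι dInv ΔM ΔG εG St) (he : ∀ i j, e (x i j) = ξ i j)
    (r : ℕ) (f : M) :
    coorbit e (adjBeta ΔM ι St) (tauCoinv q q⁻¹ x r * f)
      = e (tauCoinv q q⁻¹ x r) • coorbit e (adjBeta ΔM ι St) f := by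
  have hf : f ∈ Submodule.span ℂ {m : M | ∃ (n : ℕ) (i j : Fin n → Fin N), m = wordProd x i j} := by
    rw [H.span_word]; trivial
  induction hf using Submodule.span_induction with
  | mem f hf =>
    obtain ⟨n, a, b, rfl⟩ := hf
    induction n with
    | zero =>
      rw [wordProd_zero, mul_one, H.coorbit_tauCoinv he, H.coorbit_one he,
        Algebra.algebraMap_eq_smul_one]
    | succ n ih =>
      rw [← Fin.snoc_init_self a, ← Fin.snoc_init_self b, wordProd_snoc, ← mul_assoc,
        H.coorbit_mul_gen he, H.coorbit_mul_gen he, ih]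
      simp only [mul_smul_comm, smul_mul_assoc, Finset.smul_sum, smul_comm (ξ _ _)]
  | zero => simp
  | add f g _ _ hf hg => rw [mul_add, map_add, hf, hg, map_add, smul_add]
  | smul c f _ hf => rw [mul_smul_comm, map_smul, hf, map_smul, smul_comm]

/-- The right ideal is contained in the kernel. -/
lemma span_le_ker (H : IsQGL q x ι dInv ΔM ΔG εG St) (he : ∀ i j, e (x i j) = ξ i j) :
    Submodule.span ℂ {y : M | ∃ (i : Fin N) (h : M),
          y = (tauCoinv q q⁻¹ x (i.1 + 1) - algebraMap ℂ M (e (tauCoinv q q⁻¹ x (i.1 + 1)))) * h}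
      ≤ LinearMap.ker (coorbit e (adjBeta ΔM ι St)) := by
  rw [Submodule.span_le]
  rintro _ ⟨i, h, rfl⟩
  rw [SetLike.mem_coe, LinearMap.mem_ker, sub_mul, map_sub, H.coorbit_tauCoinv_mul he,
    ← Algebra.smul_def, map_smul, sub_self]

end IsQGL

section

/-- Over a base containing the coefficients of `∏ (T - x i)`, the polynomials in the `x i` are
spanned by staircase monomials. -/
lemma adjoin_le_span_staircase {k Q : Type} [Field k] [CommRing Q] [Algebra k Q] {N : ℕ}
    (x : Fin N → Q)
    (hx : ∀ n, (∏ i, (Polynomial.X - Polynomial.C (x i))).coeff n ∈ (⊥ : Subalgebra k Q)) :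
    Subalgebra.toSubmodule (Algebra.adjoin k (Set.range x))
      ≤ Submodule.span k {y | ∃ a : Fin N → ℕ, (∀ i, a i ≤ i) ∧ y = ∏ i, x i ^ a i} := by
  classical
  -- partial products and the subalgebras generated by the last variables
  let B : ℕ → Subalgebra k Q := fun m => Algebra.adjoin k {y | ∃ i : Fin N, m ≤ i.1 ∧ y = x i}
  let p : ℕ → Polynomial Q := fun m =>
    ∏ i ∈ Finset.univ.filter (fun i : Fin N => i.1 < m), (Polynomial.X - Polynomial.C (x i))
  let V : ℕ → Submodule k Q := fun m =>
    Submodule.span k {y | ∃ a : Fin N → ℕ, (∀ i, a i ≤ i) ∧ (∀ i : Fin N, i.1 < m → a i = 0) ∧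
      y = ∏ i, x i ^ a i}
  have hmonic : ∀ m, (p m).Monic := fun m =>
    Polynomial.monic_prod_of_monic _ _ fun i _ => Polynomial.monic_X_sub_C _
  have hdeg : ∀ m ≤ N, (p m).natDegree ≤ m := by
    intro m hm
    refine (Polynomial.natDegree_prod_le _ _).trans ?_
    refine (Finset.sum_le_card_nsmul _ _ 1 fun i _ => Polynomial.natDegree_X_sub_C_le _).trans ?_
    rw [smul_eq_mul, mul_one]
    have := Finset.card_le_card_of_injOn (s := Finset.univ.filter (fun i : Fin N => i.1 < m))
      (t := Finset.range m) (fun i => i.1) (by intro i; simp) (fun a _ b _ h => Fin.ext h)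
    simpa using this
  have hstep : ∀ m (hm : m < N), p (m + 1) = (Polynomial.X - Polynomial.C (x ⟨m, hm⟩)) * p m := by
    intro m hm
    have : Finset.univ.filter (fun i : Fin N => i.1 < m + 1)
        = insert ⟨m, hm⟩ (Finset.univ.filter (fun i : Fin N => i.1 < m)) := by
      ext i; simp [Fin.ext_iff]; omega
    simp only [p, this]
    rw [Finset.prod_insert (by simp)]
  have hBmono : ∀ m, B (m + 1) ≤ B m := fun m =>
    Algebra.adjoin_mono fun y ⟨i, hi, h⟩ => ⟨i, by omega, h⟩
  have hmem : ∀ m (hm : m < N), x ⟨m, hm⟩ ∈ B m := fun m hm =>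
    Algebra.subset_adjoin ⟨⟨m, hm⟩, le_rfl, rfl⟩
  have key : ∀ j m, m + j = N → (∀ n, (p m).coeff n ∈ B m) ∧ ∀ y ∈ B m, y ∈ V m := by
    intro j
    induction j with
    | zero =>
      intro m hm
      obtain rfl : m = N := by omega
      have hB : B m = ⊥ := by
        rw [eq_bot_iff]
        refine Algebra.adjoin_le ?_
        rintro y ⟨i, hi, -⟩
        exact absurd i.2 (by omega)
      have hp : p m = ∏ i, (Polynomial.X - Polynomial.C (x i)) := by
        simp only [p]; congr 1; ext i; simp
      refine ⟨fun n => ?_, fun y hy => ?_⟩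
      · rw [hB, hp]; exact hx n
      · rw [hB, Algebra.mem_bot] at hy
        obtain ⟨c, rfl⟩ := hy
        rw [Algebra.algebraMap_eq_smul_one]
        exact Submodule.smul_mem _ _ (Submodule.subset_span ⟨0, by simp, by simp, by simp⟩)
    | succ j ih =>
      intro m hm
      have hmN : m < N := by omega
      obtain ⟨ih1, ih2⟩ := ih (m + 1) (by omega)
      have hcoef : ∀ n, (p m).coeff n ∈ B m := by
        have : ∀ d n, N < n + d → (p m).coeff n ∈ B m := by
          intro d
          induction d with
          | zero =>
            intro n hn
            rw [Polynomial.coeff_eq_zero_of_natDegree_lt (by have := hdeg m hmN.le; omega)]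
            exact zero_mem _
          | succ d ihd =>
            intro n hn
            have h := congrArg (fun r => Polynomial.coeff r (n + 1)) (hstep m hmN)
            simp only [sub_mul, Polynomial.coeff_sub, Polynomial.coeff_X_mul,
              Polynomial.coeff_C_mul] at h
            rw [show (p m).coeff n = (p (m + 1)).coeff (n + 1)
              + x ⟨m, hmN⟩ * (p m).coeff (n + 1) by rw [h]; ring]
            exact add_mem (hBmono m (ih1 _)) (mul_mem (hmem m hmN) (ihd (n + 1) (by omega)))
        exact fun n => this (N + 1) n (by omega)
      refine ⟨hcoef, ?_⟩
      -- the module spanned by low powers of `x m` over `B (m+1)`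
      let W : Submodule k Q := Submodule.span k
        {y | ∃ b ∈ B (m + 1), ∃ r ≤ m, y = b * x ⟨m, hmN⟩ ^ r}
      have hroot : ∀ b ∈ B (m + 1), b * x ⟨m, hmN⟩ ^ (m + 1) ∈ W := by
        intro b hb
        have hd1 : (p (m + 1)).natDegree ≤ m + 1 := hdeg (m + 1) hmN
        have hev : (p (m + 1)).eval (x ⟨m, hmN⟩) = 0 := by rw [hstep m hmN]; simp
        have hco : (p (m + 1)).coeff (m + 1) = 1 ∨ (1 : Q) = 0 := by
          by_cases hQ : (1 : Q) = 0
          · exact Or.inr hQ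
          · left
            have : Nontrivial Q := ⟨1, 0, hQ⟩
            have hnd : (p (m + 1)).natDegree = m + 1 := by
              simp only [p]
              rw [Polynomial.natDegree_prod_of_monic _ _ fun i _ => Polynomial.monic_X_sub_C _]
              simp only [Polynomial.natDegree_X_sub_C, Finset.sum_const, smul_eq_mul, mul_one]
              rw [← Finset.card_range (m + 1)]
              refine Finset.card_bij (fun i _ => i.1) (by simp) (fun a _ b _ h => Fin.ext h) ?_
              intro c hc
              simp only [Finset.mem_range] at hc
              exact ⟨⟨c, by omega⟩, by simpa using hc, rfl⟩
            have := (hmonic (m + 1)).coeff_natDegree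
            rwa [hnd] at this
        rcases hco with hco | hQ
        · rw [Polynomial.eval_eq_sum_range' (Nat.lt_succ_of_le hd1), Finset.sum_range_succ, hco,
            one_mul] at hev
          rw [show x ⟨m, hmN⟩ ^ (m + 1)
            = - ∑ r ∈ Finset.range (m + 1), (p (m + 1)).coeff r * x ⟨m, hmN⟩ ^ r from
            eq_neg_of_add_eq_zero_right hev, mul_neg, Finset.mul_sum]
          refine neg_mem (sum_mem fun r hr => ?_)
          rw [← mul_assoc]
          exact Submodule.subset_span ⟨_, mul_mem hb (ih1 r), r,
            by simpa [Nat.lt_succ_iff] using hr, rfl⟩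
        · have : ∀ z : Q, z = 0 := fun z => by rw [← one_mul z, hQ, zero_mul]
          rw [this (b * _)]; exact zero_mem _
      have hWx : ∀ w ∈ W, w * x ⟨m, hmN⟩ ∈ W := by
        intro w hw
        induction hw using Submodule.span_induction with
        | mem w hw =>
          obtain ⟨b, hb, r, hr, rfl⟩ := hw
          rw [mul_assoc, ← pow_succ]
          rcases Nat.lt_or_ge r m with h | h
          · exact Submodule.subset_span ⟨b, hb, r + 1, h, rfl⟩
          · obtain rfl : r = m := le_antisymm hr h
            exact hroot b hb
        | zero => rw [zero_mul]; exact zero_mem _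
        | add u v _ _ hu hv => rw [add_mul]; exact add_mem hu hv
        | smul c u _ hu => rw [smul_mul_assoc]; exact W.smul_mem c hu
      have hWb : ∀ c ∈ B (m + 1), ∀ w ∈ W, w * c ∈ W := by
        intro c hc w hw
        induction hw using Submodule.span_induction with
        | mem w hw =>
          obtain ⟨b, hb, r, hr, rfl⟩ := hw
          exact Submodule.subset_span ⟨b * c, mul_mem hb hc, r, hr, by ring⟩
        | zero => rw [zero_mul]; exact zero_mem _
        | add u v _ _ hu hv => rw [add_mul]; exact add_mem hu hv
        | smul c u _ hu => rw [smul_mul_assoc]; exact W.smul_mem c hu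
      have hBW : ∀ y ∈ B m, ∀ w ∈ W, w * y ∈ W := by
        intro y hy
        induction hy using Algebra.adjoin_induction with
        | mem y hy =>
          obtain ⟨i, hi, rfl⟩ := hy
          rcases Nat.eq_or_lt_of_le hi with h | h
          · obtain rfl : i = ⟨m, hmN⟩ := Fin.ext h.symm
            exact hWx
          · exact hWb _ (Algebra.subset_adjoin ⟨i, h, rfl⟩)
        | algebraMap r =>
          intro w hw
          rw [mul_comm, ← Algebra.smul_def]; exact W.smul_mem r hw
        | add u v _ _ hu hv => intro w hw; rw [mul_add]; exact add_mem (hu w hw) (hv w hw)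
        | mul u v _ _ hu hv => intro w hw; rw [← mul_assoc]; exact hv _ (hu w hw)
      intro y hy
      have hyW : y ∈ W := by
        have := hBW y hy 1 (Submodule.subset_span ⟨1, one_mem _, 0, by omega, by simp⟩)
        rwa [one_mul] at this
      have hsub : ∀ w ∈ W, w ∈ B m := by
        intro w hw
        refine (Submodule.span_le (p := Subalgebra.toSubmodule (B m))).2 ?_ hw
        rintro _ ⟨b, hb, r, -, rfl⟩
        exact (B m).mul_mem (hBmono m hb) (pow_mem (hmem m hmN) r)
      induction hyW using Submodule.span_induction with
      | mem y hyy =>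
        clear hy
        obtain ⟨b, hb, r, hr, rfl⟩ := hyy
        have hbV := ih2 b hb
        clear hb
        induction hbV using Submodule.span_induction with
        | mem b hb =>
          obtain ⟨a, ha, ha0, rfl⟩ := hb
          refine Submodule.subset_span ⟨Function.update a ⟨m, hmN⟩ r, ?_, ?_, ?_⟩
          · intro i
            by_cases h : i = ⟨m, hmN⟩
            · subst h; simpa using hr
            · rw [Function.update_of_ne h]; exact ha i
          · intro i hi
            rw [Function.update_of_ne (fun h => by rw [h] at hi; simp at hi)]
            exact ha0 i (by omega)
          · rw [← Finset.mul_prod_erase _ _ (Finset.mem_univ (⟨m, hmN⟩ : Fin N)),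
              ← Finset.mul_prod_erase _ _ (Finset.mem_univ (⟨m, hmN⟩ : Fin N)),
              Function.update_self, ha0 ⟨m, hmN⟩ (by simp), pow_zero, one_mul, mul_comm]
            congr 1
            refine Finset.prod_congr rfl fun i hi => ?_
            rw [Function.update_of_ne (Finset.ne_of_mem_erase hi)]
        | zero => rw [zero_mul]; exact zero_mem _
        | add u v _ _ hu hv => rw [add_mul]; exact add_mem hu hv
        | smul c u _ hu => rw [smul_mul_assoc]; exact (V m).smul_mem c hu
      | zero => exact zero_mem _
      | add u v hu' hv' hu hv =>
        exact add_mem (hu (hsub u hu')) (hv (hsub v hv'))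
      | smul c u hu' hu =>
        exact (V m).smul_mem c (hu (hsub u hu'))
  intro y hy
  have h0 := (key N 0 (by omega)).2 y (by
    refine Algebra.adjoin_mono ?_ hy
    rintro _ ⟨i, rfl⟩
    exact ⟨i, by omega, rfl⟩)
  refine Submodule.span_mono ?_ h0
  rintro _ ⟨a, h1, -, h2⟩
  exact ⟨a, h1, h2⟩


open MvPolynomial in
/-- Modulo the elementary symmetric polynomials, a homogeneous polynomial is a combination of
staircase monomials of the same degree. -/
lemma exists_esymm_staircase {k : Type} [Field k] {N d : ℕ} (f : MvPolynomial (Fin N) k)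
    (hf : f.IsHomogeneous d) :
    ∃ (p : ℕ → Fin N → MvPolynomial (Fin N) k) (s : MvPolynomial (Fin N) k),
      (∀ n i, (p n i).IsHomogeneous n) ∧ (∀ m ∈ s.support, ∀ i, m i ≤ i) ∧ s.IsHomogeneous d ∧
      f = ∑ i : Fin N, (if i.1 + 1 ≤ d then esymm (Fin N) k (i.1 + 1) * p (d - (i.1 + 1)) i else 0)
        + s := by
  classical
  let I : Ideal (MvPolynomial (Fin N) k) :=
    Ideal.span (Set.range fun i : Fin N => esymm (Fin N) k (i.1 + 1))
  have hI : ∀ j, 0 < j → esymm (Fin N) k j ∈ I := by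
    intro j hj
    rcases le_or_gt j N with h | h
    · refine Ideal.subset_span ⟨⟨j - 1, by omega⟩, ?_⟩
      dsimp only; congr 1; omega
    · rw [esymm, Finset.powersetCard_eq_empty.2 (by simpa using h), Finset.sum_empty]
      exact zero_mem _
  let π := Ideal.Quotient.mkₐ k I
  have h1 := adjoin_le_span_staircase (k := k) (fun i => π (X i)) (by
    intro n
    have h2 : (∏ i, (Polynomial.X - Polynomial.C (π (X i : MvPolynomial (Fin N) k))))
        = (∏ i : Fin N, (Polynomial.X - Polynomial.C (X i : MvPolynomial (Fin N) k))).map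
          π.toRingHom := by
      rw [Polynomial.map_prod]; simp
    have h3 : (∏ i : Fin N, (Polynomial.X - Polynomial.C (X i : MvPolynomial (Fin N) k)))
        = ∑ j ∈ Finset.range (N + 1), (-1) ^ j *
          (Polynomial.C (esymm (Fin N) k j) * Polynomial.X ^ (N - j)) := by
      have := Multiset.prod_X_sub_X_eq_sum_esymm
        (Finset.univ.val.map fun i : Fin N => (X i : MvPolynomial (Fin N) k))
      simp only [Multiset.map_map, Multiset.card_map, Finset.card_val, Finset.card_univ,
        Fintype.card_fin] at this
      rw [← Finset.prod_eq_multiset_prod] at this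
      simpa [esymm_eq_multiset_esymm] using this
    rw [h2, h3, Polynomial.map_sum, Polynomial.finsetSum_coeff]
    refine sum_mem fun j _ => ?_
    rw [Polynomial.map_mul, Polynomial.map_mul, Polynomial.map_C]
    rcases Nat.eq_zero_or_pos j with rfl | hj
    · simp only [pow_zero, Polynomial.map_one, esymm_zero, map_one, one_mul, Polynomial.map_pow,
        Polynomial.map_X, Polynomial.coeff_X_pow]
      split_ifs
      · exact one_mem _
      · exact zero_mem _
    · have : π.toRingHom (esymm (Fin N) k j) = 0 := Ideal.Quotient.eq_zero_iff_mem.2 (hI j hj)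
      rw [this, map_zero, zero_mul, mul_zero, Polynomial.coeff_zero]
      exact zero_mem _)
  have h4 : π f ∈ Algebra.adjoin k (Set.range fun i => π (X i : MvPolynomial (Fin N) k)) := by
    have : Set.range (fun i => π (X i : MvPolynomial (Fin N) k)) = π '' Set.range X := by
      rw [← Set.range_comp]; rfl
    rw [this, ← AlgHom.map_adjoin, adjoin_range_X]
    exact ⟨f, trivial, rfl⟩
  have h5 := h1 h4
  obtain ⟨s, hs, hsf⟩ : ∃ s : MvPolynomial (Fin N) k, (∀ m ∈ s.support, ∀ i, m i ≤ i) ∧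
      π s = π f := by
    clear h4
    generalize π f = z at h5 ⊢
    induction h5 using Submodule.span_induction with
    | mem y hy =>
      obtain ⟨a, ha, rfl⟩ := hy
      refine ⟨monomial (Finsupp.equivFunOnFinite.symm a) 1, ?_, ?_⟩
      · intro m hm i
        have := support_monomial_subset hm
        rw [Finset.mem_singleton] at this
        subst this; exact ha i
      · rw [monomial_eq, map_mul, Finsupp.prod_fintype _ _ (by simp)]
        simp
    | zero => exact ⟨0, by simp, map_zero _⟩
    | add u v _ _ hu hv =>
      obtain ⟨s, hs, hs'⟩ := hu
      obtain ⟨t, ht, ht'⟩ := hv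
      refine ⟨s + t, fun m hm => ?_, by rw [map_add, hs', ht']⟩
      rcases Finset.mem_union.1 (support_add hm) with h | h
      exacts [hs m h, ht m h]
    | smul c u _ hu =>
      obtain ⟨s, hs, hs'⟩ := hu
      exact ⟨c • s, fun m hm => hs m (support_smul hm), by rw [map_smul, hs']⟩
  have h6 : f - s ∈ I := by
    rw [← Ideal.Quotient.eq_zero_iff_mem]
    change π (f - s) = 0
    rw [map_sub, hsf, sub_self]
  rw [Ideal.mem_span_range_iff_exists_fun] at h6
  obtain ⟨g, hg⟩ := h6
  refine ⟨fun n i => homogeneousComponent n (g i), homogeneousComponent d s,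
    fun n i => homogeneousComponent_isHomogeneous _ _, ?_, homogeneousComponent_isHomogeneous _ _,
    ?_⟩
  · intro m hm
    refine hs m ?_
    rw [mem_support_iff, coeff_homogeneousComponent] at hm
    rw [mem_support_iff]
    intro h
    simp [h] at hm
  · have h7 : f = homogeneousComponent d f := by rw [homogeneousComponent_of_mem hf, if_pos rfl]
    rw [h7, show f = ∑ i, g i * esymm (Fin N) k (i.1 + 1) + s by rw [hg]; ring, map_add, map_sum]
    congr 1
    · refine Finset.sum_congr rfl fun i _ => ?_
      have hE : ∀ j, (esymm (Fin N) k j).IsHomogeneous j := by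
        intro j
        refine IsHomogeneous.sum _ _ _ fun t ht => ?_
        rw [← (Finset.mem_powersetCard.1 ht).2, Finset.card_eq_sum_ones]
        exact IsHomogeneous.prod _ _ _ fun i _ => isHomogeneous_X _ _
      have h8 := sum_homogeneousComponent (g i)
      conv_lhs => rw [← h8, Finset.sum_mul, map_sum]
      have h9 : ∀ n, homogeneousComponent d (homogeneousComponent n (g i) *
          esymm (Fin N) k (i.1 + 1))
          = if n + (i.1 + 1) = d then homogeneousComponent n (g i) * esymm (Fin N) k (i.1 + 1)
            else 0 := by
        intro n
        rw [homogeneousComponent_of_mem ((homogeneousComponent_isHomogeneous n (g i)).mul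
          (hE _))]
        simp only [eq_comm]
      simp only [h9]
      split_ifs with h
      · have h10 : ∀ n, n + (i.1 + 1) = d ↔ n = d - (i.1 + 1) := fun n => by omega
        simp only [h10, Finset.sum_ite_eq', Finset.mem_range]
        split_ifs with h11
        · rw [mul_comm]
        · rw [homogeneousComponent_eq_zero _ _ (by omega), mul_zero]
      · exact Finset.sum_eq_zero fun n _ => if_neg (by omega)

end

/-- The product of the generators listed in `l`. -/
def listProd {M : Type} [Monoid M] {N : ℕ} (x : Fin N → Fin N → M) (l : List (Fin N × Fin N)) : M :=
  (l.map fun p => x p.1 p.2).prod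

/-- A weight for which the commutators of quantum matrices have lower weight. -/
def letterWt {N : ℕ} (p : Fin N × Fin N) : ℕ := N * N + 1 - ((p.1 : ℤ) - p.2).natAbs ^ 2

lemma letterWt_cast {N : ℕ} (p : Fin N × Fin N) :
    ((letterWt p : ℕ) : ℤ) = N * N + 1 - ((p.1 : ℤ) - p.2) ^ 2 := by
  have h1 : ((p.1 : ℤ) - p.2).natAbs ≤ N := by have := p.1.2; have := p.2.2; omega
  have h2 : ((p.1 : ℤ) - p.2).natAbs ^ 2 ≤ N * N + 1 := by
    have := Nat.pow_le_pow_left h1 2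
    nlinarith
  rw [letterWt, Nat.cast_sub h2]
  push_cast
  rw [sq_abs]

lemma letterWt_cross {N : ℕ} {i j k l : Fin N} (h1 : i < k) (h2 : j < l) :
    letterWt (i, l) + letterWt (k, j) < letterWt (i, j) + letterWt (k, l) := by
  zify
  simp only [letterWt_cast]
  have h1' : (i : ℤ) < k := by exact_mod_cast h1
  have h2' : (j : ℤ) < l := by exact_mod_cast h2
  nlinarith [mul_pos (sub_pos.2 h1') (sub_pos.2 h2')]

lemma letterWt_diag {N : ℕ} (i : Fin N) : letterWt (i, i) = N * N + 1 := by
  zify; rw [letterWt_cast]; push_cast; ring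

lemma letterWt_lt {N : ℕ} {i j : Fin N} (h : i ≠ j) : letterWt (i, j) < N * N + 1 := by
  zify; rw [letterWt_cast]
  have : (i : ℤ) - j ≠ 0 := by
    intro h'; apply h; ext; omega
  have := sq_pos_of_ne_zero this
  linarith

lemma letterWt_le {N : ℕ} (i j : Fin N) : letterWt (i, j) ≤ N * N + 1 := by
  rcases eq_or_ne i j with rfl | h
  · exact (letterWt_diag i).le
  · exact (letterWt_lt h).le

section Filtration

variable {M : Type} [Ring M] [Algebra ℂ M] {N : ℕ} (x : Fin N → Fin N → M)

/-- The span of the products of generators of weight less than `D`. -/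
def wtFil (D : ℕ) : Submodule ℂ M :=
  Submodule.span ℂ {y | ∃ l : List (Fin N × Fin N), (l.map letterWt).sum < D ∧ y = listProd x l}

variable {x}

lemma wtFil_mono {D E : ℕ} (h : D ≤ E) : wtFil x D ≤ wtFil x E :=
  Submodule.span_mono fun _ ⟨l, hl, hy⟩ => ⟨l, hl.trans_le h, hy⟩

lemma listProd_mem_wtFil {l : List (Fin N × Fin N)} {D : ℕ} (h : (l.map letterWt).sum < D) :
    listProd x l ∈ wtFil x D := Submodule.subset_span ⟨l, h, rfl⟩

lemma wtFil_mul {D E F : ℕ} (h : D + E ≤ F + 1) {u v : M} (hu : u ∈ wtFil x D)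
    (hv : v ∈ wtFil x E) : u * v ∈ wtFil x F := by
  have := Submodule.mul_mem_mul hu hv
  rw [wtFil, wtFil, Submodule.span_mul_span] at this
  refine Submodule.span_mono ?_ this
  rintro _ ⟨_, ⟨l, hl, rfl⟩, _, ⟨l', hl', rfl⟩, rfl⟩
  refine ⟨l ++ l', ?_, by simp [listProd]⟩
  rw [List.map_append, List.sum_append]
  omega

lemma prod_mem_wtFil {T : Type} {y : T → M} {wt : T → ℕ} (hy : ∀ a, y a ∈ wtFil x (wt a + 1))
    (l : List T) : (l.map y).prod ∈ wtFil x ((l.map wt).sum + 1) := by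
  induction l with
  | nil => exact Submodule.subset_span ⟨[], by simp, by simp [listProd]⟩
  | cons a l ih =>
    simp only [List.map_cons, List.prod_cons, List.sum_cons]
    exact wtFil_mul (by omega) (hy a) ih

/-- Reordering a product of elements that commute up to scalars and lower order terms. -/
lemma prod_perm_sub_mem {T : Type} {y : T → M} {wt : T → ℕ} (U : Submonoid ℂ)
    (hy : ∀ a, y a ∈ wtFil x (wt a + 1))
    (hyy : ∀ a b, ∃ c ∈ U, y a * y b - c • (y b * y a) ∈ wtFil x (wt a + wt b))
    {l l' : List T} (h : l.Perm l') :
    ∃ c ∈ U, (l.map y).prod - c • (l'.map y).prod ∈ wtFil x (l.map wt).sum := by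
  induction h with
  | nil => exact ⟨1, U.one_mem, by simp⟩
  | cons a h ih =>
    obtain ⟨c, hc, ih⟩ := ih
    refine ⟨c, hc, ?_⟩
    simp only [List.map_cons, List.prod_cons, List.sum_cons]
    rw [← mul_smul_comm, ← mul_sub]
    exact wtFil_mul (by omega) (hy a) ih
  | swap a b l =>
    obtain ⟨c, hc, h⟩ := hyy b a
    refine ⟨c, hc, ?_⟩
    simp only [List.map_cons, List.prod_cons, List.sum_cons]
    rw [← mul_assoc, ← mul_assoc, ← smul_mul_assoc, ← sub_mul]
    exact wtFil_mul (by omega) h (prod_mem_wtFil hy l)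
  | @trans l l' l'' h h' ih ih' =>
    obtain ⟨c, hc, ih⟩ := ih
    obtain ⟨c', hc', ih'⟩ := ih'
    refine ⟨c * c', U.mul_mem hc hc', ?_⟩
    rw [← (h.map wt).sum_eq] at ih'
    have := add_mem ih (Submodule.smul_mem _ c ih')
    rwa [smul_sub, smul_smul, sub_add_sub_cancel] at this

lemma gen_mem_wtFil (p : Fin N × Fin N) : x p.1 p.2 ∈ wtFil x (letterWt p + 1) := by
  have := listProd_mem_wtFil (x := x) (l := [p]) (D := letterWt p + 1) (by simp)
  simpa [listProd] using this

variable {q : ℂ}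

lemma IsQMat.gen_comm (hx : IsQMat q x) (hq : q ≠ 0) (p r : Fin N × Fin N) :
    ∃ c ∈ nonZeroDivisors ℂ, x p.1 p.2 * x r.1 r.2 - c • (x r.1 r.2 * x p.1 p.2)
      ∈ wtFil x (letterWt p + letterWt r) := by
  have main : ∀ i j k l : Fin N, (i < k ∨ i = k ∧ j ≤ l) → ∃ c : ℂ, c ≠ 0 ∧
      x i j * x k l - c • (x k l * x i j) ∈ wtFil x (letterWt (i, j) + letterWt (k, l)) := by
    rintro i j k l (h | ⟨rfl, h⟩)
    · rcases lt_trichotomy j l with h' | rfl | h'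
      · refine ⟨1, one_ne_zero, ?_⟩
        rw [one_smul, hx.diag i k j l h h']
        refine Submodule.smul_mem _ _ ?_
        refine wtFil_mono (letterWt_cross h h') ?_
        exact wtFil_mul (by omega) (gen_mem_wtFil (i, l)) (gen_mem_wtFil (k, j))
      · exact ⟨q, hq, by rw [hx.col i k j h, sub_self]; exact zero_mem _⟩
      · exact ⟨1, one_ne_zero, by rw [one_smul, hx.anti i k l j h h', sub_self]; exact zero_mem _⟩
    · rcases h.lt_or_eq with h' | rfl
      · exact ⟨q, hq, by rw [hx.row i j l h', sub_self]; exact zero_mem _⟩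
      · exact ⟨1, one_ne_zero, by rw [one_smul, sub_self]; exact zero_mem _⟩
  obtain ⟨i, j⟩ := p
  obtain ⟨k, l⟩ := r
  simp only [mem_nonZeroDivisors_iff_ne_zero]
  by_cases h : i < k ∨ i = k ∧ j ≤ l
  · exact main i j k l h
  · obtain ⟨c, hc, h'⟩ := main k l i j (by
      rcases lt_trichotomy i k with h1 | h1 | h1
      · exact absurd (Or.inl h1) h
      · exact Or.inr ⟨h1.symm, le_of_not_ge fun h2 => h (Or.inr ⟨h1, h2⟩)⟩
      · exact Or.inl h1)
    refine ⟨c⁻¹, inv_ne_zero hc, ?_⟩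
    rw [add_comm (letterWt (i, j))]
    have := Submodule.smul_mem _ (-c⁻¹) h'
    rw [smul_sub, smul_smul, neg_mul, inv_mul_cancel₀ hc] at this
    convert this using 1
    rw [neg_smul, neg_smul, one_smul]
    abel

lemma IsQMat.listProd_perm (hx : IsQMat q x) (hq : q ≠ 0) {l l' : List (Fin N × Fin N)}
    (h : l.Perm l') :
    ∃ c : ℂ, listProd x l - c • listProd x l' ∈ wtFil x (l.map letterWt).sum := by
  obtain ⟨c, -, hc⟩ := prod_perm_sub_mem (y := fun p : Fin N × Fin N => x p.1 p.2) (wt := letterWt)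
    (nonZeroDivisors ℂ) gen_mem_wtFil (hx.gen_comm hq) h
  exact ⟨c, hc⟩

/-- The rescaled diagonal generators. -/
def diagGen (q : ℂ) (x : Fin N → Fin N → M) (i : Fin N) : M := dW q i • x i i

lemma diagGen_mem (i : Fin N) : diagGen q x i ∈ wtFil x (N * N + 1 + 1) := by
  rw [← letterWt_diag i]
  exact Submodule.smul_mem _ _ (gen_mem_wtFil (i, i))

lemma IsQMat.diagGen_perm (hx : IsQMat q x) {l l' : List (Fin N)} (h : l.Perm l') :
    (l.map (diagGen q x)).prod - (l'.map (diagGen q x)).prod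
      ∈ wtFil x (l.length * (N * N + 1)) := by
  have main : ∀ i j : Fin N, i < j → x i i * x j j - x j j * x i i
      ∈ wtFil x ((N * N + 1) + (N * N + 1)) := by
    intro i j h
    rw [hx.diag i j i j h h]
    refine Submodule.smul_mem _ _ ?_
    have := letterWt_cross h h
    rw [letterWt_diag, letterWt_diag] at this
    refine wtFil_mono this ?_
    exact wtFil_mul (by omega) (gen_mem_wtFil (i, j)) (gen_mem_wtFil (j, i))
  obtain ⟨c, hc, h⟩ := prod_perm_sub_mem (x := x) (y := diagGen q x) (wt := fun _ => N * N + 1) ⊥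
    diagGen_mem (fun a b => ⟨1, one_mem _, by
      rw [one_smul, diagGen, diagGen, smul_mul_smul_comm, smul_mul_smul_comm,
        mul_comm (dW q b), ← smul_sub]
      refine Submodule.smul_mem _ _ ?_
      rcases lt_trichotomy a b with h | rfl | h
      · exact main a b h
      · rw [sub_self]; exact zero_mem _
      · rw [← neg_sub]; exact neg_mem (main b a h)⟩) h
  rw [Submonoid.mem_bot] at hc
  simpa [hc] using h

/-- The ordered substitution of the diagonal generators. -/
def diagSub (q : ℂ) (x : Fin N → Fin N → M) : MvPolynomial (Fin N) ℂ →ₗ[ℂ] M :=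
  (MvPolynomial.basisMonomials (Fin N) ℂ).constr ℂ fun a =>
    ((Finsupp.toMultiset a).toList.map (diagGen q x)).prod

lemma diagSub_monomial (a : Fin N →₀ ℕ) :
    diagSub q x (MvPolynomial.monomial a 1)
      = ((Finsupp.toMultiset a).toList.map (diagGen q x)).prod := by
  have := (MvPolynomial.basisMonomials (Fin N) ℂ).constr_basis ℂ
    (fun a => ((Finsupp.toMultiset a).toList.map (diagGen q x)).prod) a
  simpa [diagSub] using this

lemma qMinor_sub_mem (I : Finset (Fin N)) :
    qMinor q x I - ((List.finRange I.card).map fun k =>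
        x ((I.orderIsoOfFin rfl) k).1 ((I.orderIsoOfFin rfl) k).1).prod
      ∈ wtFil x (I.card * (N * N + 1)) := by
  classical
  rw [qMinor, ← Finset.add_sum_erase _ _ (Finset.mem_univ (1 : Equiv.Perm (Fin I.card)))]
  have h1 : invCount (1 : Equiv.Perm (Fin I.card)) = 0 := by
    rw [invCount, Finset.card_eq_zero, Finset.filter_eq_empty_iff]
    rintro p - ⟨h, h'⟩
    exact absurd h (not_lt_of_gt h')
  rw [h1, pow_zero, one_smul]
  simp only [Equiv.Perm.coe_one, id_eq, add_sub_cancel_left]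
  refine sum_mem fun σ hσ => Submodule.smul_mem _ _ ?_
  have := listProd_mem_wtFil (x := x) (l := (List.finRange I.card).map fun k =>
    (((I.orderIsoOfFin rfl) k).1, ((I.orderIsoOfFin rfl) (σ k)).1)) (D := I.card * (N * N + 1)) (by
      rw [List.map_map, ← List.ofFn_eq_map, List.sum_ofFn]
      have h2 : ∃ k, σ k ≠ k := by
        by_contra! h
        exact (Finset.ne_of_mem_erase hσ) (Equiv.ext h)
      obtain ⟨k, hk⟩ := h2
      calc _ < ∑ _k : Fin I.card, (N * N + 1) := by
            refine Finset.sum_lt_sum (fun k _ => letterWt_le _ _) ⟨k, Finset.mem_univ _, ?_⟩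
            refine letterWt_lt fun h => hk ?_
            exact ((I.orderIsoOfFin rfl).injective (Subtype.ext h)).symm
        _ = _ := by simp)
  simpa only [listProd, List.map_map, Function.comp_def] using this

/-- The leading term of `τ_r`. -/
lemma tauCoinv_sub_mem (r : ℕ) :
    tauCoinv q q⁻¹ x r - ∑ I ∈ Finset.univ.powersetCard r,
      ((List.finRange I.card).map fun k => diagGen q x ((I.orderIsoOfFin rfl) k).1).prod
      ∈ wtFil x (r * (N * N + 1)) := by
  rw [tauCoinv, show (Finset.univ.filter (fun I : Finset (Fin N) => I.card = r))
    = Finset.univ.powersetCard r by ext; simp, ← Finset.sum_sub_distrib]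
  refine sum_mem fun I hI => ?_
  have hI' : I.card = r := (Finset.mem_powersetCard.1 hI).2
  subst hI'
  have : ((List.finRange I.card).map fun k => diagGen q x ((I.orderIsoOfFin rfl) k).1).prod
      = q⁻¹ ^ (2 * wtSet I) • ((List.finRange I.card).map fun k =>
        x ((I.orderIsoOfFin rfl) k).1 ((I.orderIsoOfFin rfl) k).1).prod := by
    rw [← dWord_orderEmbOfFin q I rfl, dWord, ← List.prod_ofFn, List.ofFn_eq_map]
    generalize List.finRange I.card = l
    induction l with
    | nil => simp
    | cons a l ih =>
      rw [List.map_cons, List.prod_cons, ih, diagGen, List.map_cons, List.prod_cons,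
        List.map_cons, List.prod_cons, smul_mul_smul_comm]
      rfl
  rw [this, ← smul_sub]
  exact Submodule.smul_mem _ _ (qMinor_sub_mem I)

lemma toMultiset_length {a : Fin N →₀ ℕ} {n : ℕ} (ha : a.degree = n) :
    (Finsupp.toMultiset a).toList.length = n := by
  rw [Multiset.length_toList, Finsupp.card_toMultiset, ← ha]
  simp [Finsupp.degree, Finsupp.sum]
  rfl

/-- Multiplication by `τ_r` is multiplication by the elementary symmetric polynomial, to leading
order. -/
lemma IsQMat.tauCoinv_mul_sub_mem (hx : IsQMat q x) (r n : ℕ) (hr : 0 < r) (c : ℂ)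
    (p : MvPolynomial (Fin N) ℂ) (hp : p.IsHomogeneous n) :
    (tauCoinv q q⁻¹ x r - algebraMap ℂ M c) * diagSub q x p
      - diagSub q x (MvPolynomial.esymm (Fin N) ℂ r * p) ∈ wtFil x ((r + n) * (N * N + 1)) := by
  rw [p.as_sum]
  simp only [map_sum, Finset.mul_sum, ← Finset.sum_sub_distrib]
  refine sum_mem fun b hb => ?_
  rw [show MvPolynomial.monomial b (p.coeff b) = p.coeff b • MvPolynomial.monomial b 1 by
    rw [MvPolynomial.smul_monomial, smul_eq_mul, mul_one], map_smul, mul_smul_comm, mul_smul_comm,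
    map_smul, ← smul_sub]
  refine Submodule.smul_mem _ _ ?_
  have hbn : b.degree = n := by
    have := hp (MvPolynomial.mem_support_iff.1 hb)
    rw [Finsupp.degree_eq_weight_one]
    exact this
  have hmem : diagSub q x (MvPolynomial.monomial b 1) ∈ wtFil x (n * (N * N + 1) + 1) := by
    rw [diagSub_monomial]
    have := prod_mem_wtFil (x := x) (y := diagGen q x) (wt := fun _ => N * N + 1)
      diagGen_mem (Finsupp.toMultiset b).toList
    simpa [toMultiset_length hbn, -Multiset.length_toList] using this
  have h1 := wtFil_mul (F := (r + n) * (N * N + 1)) (by nlinarith) (tauCoinv_sub_mem (x := x) (q := q) r) hmem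
  have h2 : algebraMap ℂ M c * diagSub q x (MvPolynomial.monomial b 1)
      ∈ wtFil x ((r + n) * (N * N + 1)) := by
    rw [← Algebra.smul_def]
    exact Submodule.smul_mem _ _ (wtFil_mono (by nlinarith) hmem)
  have h3 : (∑ I ∈ Finset.univ.powersetCard r,
      ((List.finRange I.card).map fun k => diagGen q x ((I.orderIsoOfFin rfl) k).1).prod)
        * diagSub q x (MvPolynomial.monomial b 1)
      - diagSub q x (MvPolynomial.esymm (Fin N) ℂ r * MvPolynomial.monomial b 1)
      ∈ wtFil x ((r + n) * (N * N + 1)) := by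
    rw [MvPolynomial.esymm, Finset.sum_mul, Finset.sum_mul, map_sum, ← Finset.sum_sub_distrib]
    refine sum_mem fun I hI => ?_
    have hI' : I.card = r := (Finset.mem_powersetCard.1 hI).2
    have h4 : ∏ i ∈ I, (MvPolynomial.X i : MvPolynomial (Fin N) ℂ)
        = MvPolynomial.monomial (∑ i ∈ I, Finsupp.single i 1) 1 := by
      rw [MvPolynomial.monomial_sum_one]; rfl
    rw [h4, MvPolynomial.monomial_mul, mul_one, diagSub_monomial, diagSub_monomial]
    have hperm : ((List.finRange I.card).map (fun k => ((I.orderIsoOfFin rfl) k).1)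
        ++ (Finsupp.toMultiset b).toList).Perm
        (Finsupp.toMultiset ((∑ i ∈ I, Finsupp.single i 1) + b)).toList := by
      rw [← Multiset.coe_eq_coe, ← Multiset.coe_add, Multiset.coe_toList, Multiset.coe_toList,
        map_add, Finsupp.toMultiset_sum_single, one_smul]
      congr 1
      have := congrArg Finset.val (Finset.map_orderEmbOfFin_univ I rfl)
      rw [Finset.map_val] at this
      rw [← this]
      rfl
    have := hx.diagGen_perm hperm
    rw [List.map_append, List.prod_append, List.map_map] at this
    convert this using 2
    · rw [List.length_append, toMultiset_length hbn, List.length_map, List.length_finRange, hI']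
    · rfl
  have := sub_mem (add_mem h1 h3) h2
  convert this using 1
  rw [sub_mul, sub_mul]
  abel

/-- Every product of generators is, modulo the right ideal generated by the `τ_i - c_i`, a
combination of staircase words. -/
theorem IsQMat.straighten (hx : IsQMat q x) (hq : q ≠ 0) (c : Fin N → ℂ)
    (l : List (Fin N × Fin N)) :
    listProd x l ∈ Submodule.span ℂ {y : M | ∃ (i : Fin N) (h : M),
          y = (tauCoinv q q⁻¹ x (i.1 + 1) - algebraMap ℂ M (c i)) * h}
      ⊔ Submodule.span ℂ {y : M | ∃ m : Fin N × Fin N →₀ ℕ, (∀ i, m (i, i) ≤ i) ∧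
          y = listProd x (Finsupp.toMultiset m).toList} := by
  classical
  set Tgt := Submodule.span ℂ {y : M | ∃ (i : Fin N) (h : M),
          y = (tauCoinv q q⁻¹ x (i.1 + 1) - algebraMap ℂ M (c i)) * h}
      ⊔ Submodule.span ℂ {y : M | ∃ m : Fin N × Fin N →₀ ℕ, (∀ i, m (i, i) ≤ i) ∧
          y = listProd x (Finsupp.toMultiset m).toList} with hT
  suffices ∀ D, wtFil x D ≤ Tgt from
    this _ (listProd_mem_wtFil (Nat.lt_succ_self _))
  intro D
  induction D with
  | zero =>
    refine Submodule.span_le.2 ?_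
    rintro _ ⟨l, hl, -⟩
    exact absurd hl (Nat.not_lt_zero _)
  | succ D ih =>
    refine Submodule.span_le.2 ?_
    rintro _ ⟨l, hl, rfl⟩
    rcases Nat.lt_succ_iff_lt_or_eq.1 hl with hl | hl
    · exact ih (listProd_mem_wtFil hl)
    -- move the diagonal letters to the front
    let o := l.filter fun p => ¬ p.1 = p.2
    let dg := (l.filter fun p => p.1 = p.2).map Prod.fst
    have hdg : dg.map (fun i => (i, i)) = l.filter fun p => p.1 = p.2 := by
      simp only [dg, List.map_map]
      conv_rhs => rw [← List.map_id (l.filter _)]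
      refine List.map_congr_left fun p hp => ?_
      have := (List.mem_filter.1 hp).2
      exact Prod.ext rfl (by simpa using this)
    have hperm : l.Perm (dg.map (fun i => (i, i)) ++ o) := by
      rw [hdg]
      have := (List.filter_append_perm (fun p : Fin N × Fin N => decide (p.1 = p.2)) l).symm
      simpa [o] using this
    have hwt : dg.length * (N * N + 1) + (o.map letterWt).sum = D := by
      rw [← hl, (hperm.map letterWt).sum_eq, List.map_append, List.sum_append, List.map_map]
      congr 1
      rw [show letterWt ∘ (fun i : Fin N => (i, i)) = fun _ => N * N + 1 from
        funext letterWt_diag]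
      simp
    obtain ⟨c0, hc0⟩ := hx.listProd_perm hq hperm
    rw [hl] at hc0
    rw [SetLike.mem_coe, ← sub_add_cancel (listProd x l) (c0 • _)]
    refine add_mem (ih hc0) (Submodule.smul_mem _ _ ?_)
    have ho : listProd x o ∈ wtFil x ((o.map letterWt).sum + 1) :=
      listProd_mem_wtFil (Nat.lt_succ_self _)
    have hscal : ∀ l : List (Fin N), ∃ s : ℂ, s ≠ 0 ∧
        (l.map (diagGen q x)).prod = s • listProd x (l.map fun i => (i, i)) := by
      intro l
      induction l with
      | nil => exact ⟨1, one_ne_zero, by simp [listProd]⟩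
      | cons a l ihl =>
        obtain ⟨s, hs, h⟩ := ihl
        refine ⟨dW q a * s, mul_ne_zero (dW_ne_zero hq a) hs, ?_⟩
        rw [List.map_cons, List.prod_cons, h, diagGen, smul_mul_smul_comm]
        rfl
    -- the exponents of the diagonal part
    let a : Fin N →₀ ℕ := Multiset.toFinsupp (dg : Multiset (Fin N))
    have hadeg : a.degree = dg.length := by
      rw [← toMultiset_length rfl]; simp [a]
    have hθ : diagSub q x (MvPolynomial.monomial a 1) * listProd x o ∈ Tgt := by
      obtain ⟨p, s, hp, hs, hsh, heq⟩ := exists_esymm_staircase (k := ℂ) (d := dg.length)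
        (MvPolynomial.monomial a 1) (MvPolynomial.isHomogeneous_monomial _ hadeg)
      rw [heq, map_add, add_mul, map_sum, Finset.sum_mul]
      refine add_mem (sum_mem fun i _ => ?_) ?_
      · split_ifs with hi
        · have h1 := hx.tauCoinv_mul_sub_mem (i.1 + 1) (dg.length - (i.1 + 1)) (by omega) (c i)
            (p (dg.length - (i.1 + 1)) i) (hp _ _)
          rw [Nat.add_sub_cancel' hi] at h1
          have h2 := ih (wtFil_mul (F := D) (by omega) h1 ho)
          have h3 : (tauCoinv q q⁻¹ x (i.1 + 1) - algebraMap ℂ M (c i))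
              * (diagSub q x (p (dg.length - (i.1 + 1)) i) * listProd x o) ∈ Tgt :=
            (le_sup_left : _ ≤ Tgt) (Submodule.subset_span ⟨i, _, rfl⟩)
          have := sub_mem h3 h2
          rwa [sub_mul (_ * _) (diagSub q x _), mul_assoc, sub_sub_cancel] at this
        · rw [map_zero, zero_mul]; exact zero_mem _
      · rw [s.as_sum, map_sum, Finset.sum_mul]
        refine sum_mem fun b hb => ?_
        rw [show MvPolynomial.monomial b (s.coeff b) = s.coeff b • MvPolynomial.monomial b 1 by
          rw [MvPolynomial.smul_monomial, smul_eq_mul, mul_one], map_smul, smul_mul_assoc]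
        refine Submodule.smul_mem _ _ ?_
        have hbn : b.degree = dg.length := by
          have := hsh (MvPolynomial.mem_support_iff.1 hb)
          rw [Finsupp.degree_eq_weight_one]
          exact this
        rw [diagSub_monomial]
        obtain ⟨s0, -, hs0⟩ := hscal (Finsupp.toMultiset b).toList
        rw [hs0, smul_mul_assoc]
        refine Submodule.smul_mem _ _ ?_
        rw [listProd, listProd, ← List.prod_append, ← List.map_append, ← listProd]
        set L := (Finsupp.toMultiset b).toList.map (fun i => (i, i)) ++ o with hL
        let m : Fin N × Fin N →₀ ℕ := Multiset.toFinsupp (L : Multiset (Fin N × Fin N))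
        have hLm : L.Perm (Finsupp.toMultiset m).toList := by
          rw [← Multiset.coe_eq_coe, Multiset.coe_toList]
          simp [m]
        obtain ⟨c1, hc1⟩ := hx.listProd_perm hq hLm
        have hLw : (L.map letterWt).sum = D := by
          rw [hL, List.map_append, List.sum_append, List.map_map,
            show letterWt ∘ (fun i : Fin N => (i, i)) = fun _ => N * N + 1 from
            funext letterWt_diag, ← hwt]
          congr 1
          have := toMultiset_length hbn
          simp only [List.map_const', List.sum_replicate, smul_eq_mul, this]
        rw [hLw] at hc1
        rw [← sub_add_cancel (listProd x L) (c1 • _)]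
        refine add_mem (ih hc1) (Submodule.smul_mem _ _ ?_)
        refine (le_sup_right : _ ≤ Tgt) (Submodule.subset_span ⟨m, fun i => ?_, rfl⟩)
        refine le_trans (le_of_eq ?_) (hs b hb i)
        have h5 : m (i, i) = L.count (i, i) := by
          simp only [m, Multiset.toFinsupp_apply, Multiset.coe_count]
          congr!
        have h6 : o.count (i, i) = 0 := by
          rw [List.count_eq_zero]
          intro h
          have := (List.mem_filter.1 h).2
          simp at this
        have h7 : ((Finsupp.toMultiset b).toList.map (fun i : Fin N => (i, i))).count (i, i)
            = (Finsupp.toMultiset b).toList.count i :=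
          List.count_map_of_injective _ (fun i : Fin N => (i, i))
            (fun _ _ h => (Prod.ext_iff.1 h).1) i
        rw [h5, hL, List.count_append, h6, h7, add_zero, ← Multiset.coe_count, Multiset.coe_toList,
          Finsupp.count_toMultiset]
    obtain ⟨s0, hs0, h0⟩ := hscal (Finsupp.toMultiset a).toList
    rw [diagSub_monomial, h0, smul_mul_assoc] at hθ
    have h1 : listProd x ((Finsupp.toMultiset a).toList.map fun i => (i, i)) * listProd x o ∈ Tgt := by
      have := Submodule.smul_mem Tgt s0⁻¹ hθ
      rwa [smul_smul, inv_mul_cancel₀ hs0, one_smul] at this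
    rw [listProd, listProd, ← List.prod_append, ← List.map_append, ← listProd] at h1
    have hpp : (dg.map (fun i => (i, i)) ++ o).Perm
        ((Finsupp.toMultiset a).toList.map (fun i => (i, i)) ++ o) := by
      refine List.Perm.append_right _ (List.Perm.map _ ?_)
      rw [← Multiset.coe_eq_coe, Multiset.coe_toList]
      simp [a]
    obtain ⟨c1, hc1⟩ := hx.listProd_perm hq hpp
    rw [← (hperm.map letterWt).sum_eq, hl] at hc1
    rw [← sub_add_cancel (listProd x (_ ++ o)) (c1 • _)]
    exact add_mem (ih hc1) (Submodule.smul_mem _ _ h1)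

end Filtration

/-- A place of `ℂ` which is finite on `K` and at which `q` specializes to `1`. -/
theorem exists_place (K : Subfield ℂ) {q : ℂ} (hq : Transcendental K q) :
    ∃ (O : ValuationSubring ℂ) (h : q ∈ O), (∀ a ∈ K, a ∈ O) ∧
      IsLocalRing.residue O ⟨q, h⟩ = 1 := by
  let A : Subring ℂ := (Algebra.adjoin K {q}).toSubring
  have hqA : q ∈ A := Algebra.subset_adjoin rfl
  let y : A := ⟨q, hqA⟩ - 1
  have hI : Ideal.span {y} ≠ ⊤ := by
    rw [Ne, Ideal.eq_top_iff_one, Ideal.mem_span_singleton']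
    rintro ⟨⟨a, ha⟩, h⟩
    have h1 : a * (q - 1) = 1 := congrArg Subtype.val h
    have ha' : a ∈ Algebra.adjoin K {q} := ha
    rw [Algebra.adjoin_singleton_eq_range_aeval] at ha'
    obtain ⟨p, rfl⟩ := ha'
    have h2 : Polynomial.aeval q (p * (Polynomial.X - 1) - 1) = 0 := by
      simp only [map_sub, map_mul, Polynomial.aeval_X, map_one]
      rw [sub_eq_zero]
      exact h1
    have h3 := (transcendental_iff.1 hq) _ h2
    have h4 := congrArg (Polynomial.eval 1) h3
    simp at h4
  obtain ⟨O, hO, hn⟩ := Ideal.image_subset_nonunits_valuationSubring _ hI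
  have hqO : q ∈ O := hO hqA
  refine ⟨O, hqO, fun a ha => hO ?_, ?_⟩
  · exact (Algebra.adjoin K {q}).algebraMap_mem ⟨a, ha⟩
  · have h1 : q - 1 ∈ O.nonunits := hn ⟨y, Ideal.subset_span rfl, rfl⟩
    rw [← sub_eq_zero, ← map_one (IsLocalRing.residue O), ← map_sub, IsLocalRing.residue_eq_zero_iff,
      ← ValuationSubring.coe_mem_nonunits_iff]
    exact h1

section Place

variable (O : ValuationSubring ℂ)

/-- The pairs of an integral number and its reduction. -/
def redPair : Subring (ℂ × IsLocalRing.ResidueField O) :=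
  (O.subtype.prod (IsLocalRing.residue O)).range

variable {O}

lemma redPair_coe (a : O) : ((a : ℂ), IsLocalRing.residue O a) ∈ redPair O := ⟨a, rfl⟩

lemma redPair.fun {z : ℂ} {a b : IsLocalRing.ResidueField O} (h : (z, a) ∈ redPair O)
    (h' : (z, b) ∈ redPair O) : a = b := by
  obtain ⟨u, hu⟩ := h
  obtain ⟨v, hv⟩ := h'
  have h1 := Prod.ext_iff.1 hu
  have h2 := Prod.ext_iff.1 hv
  have : u = v := Subtype.ext (h1.1.trans h2.1.symm)
  subst this
  exact h1.2.symm.trans h2.2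

lemma redPair.ne_zero {z : ℂ} {a : IsLocalRing.ResidueField O} (h : (z, a) ∈ redPair O)
    (ha : a ≠ 0) : z ≠ 0 := by
  rintro rfl
  exact ha (redPair.fun h (redPair O).zero_mem)

lemma redPair.add {z w : ℂ} {a b : IsLocalRing.ResidueField O} (h : (z, a) ∈ redPair O)
    (h' : (w, b) ∈ redPair O) : (z + w, a + b) ∈ redPair O := (redPair O).add_mem h h'

lemma redPair.mul {z w : ℂ} {a b : IsLocalRing.ResidueField O} (h : (z, a) ∈ redPair O)
    (h' : (w, b) ∈ redPair O) : (z * w, a * b) ∈ redPair O := (redPair O).mul_mem h h'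

lemma redPair.neg {z : ℂ} {a : IsLocalRing.ResidueField O} (h : (z, a) ∈ redPair O) :
    (-z, -a) ∈ redPair O := (redPair O).neg_mem h

lemma redPair.zero : ((0 : ℂ), (0 : IsLocalRing.ResidueField O)) ∈ redPair O :=
  (redPair O).zero_mem

lemma redPair.one : ((1 : ℂ), (1 : IsLocalRing.ResidueField O)) ∈ redPair O :=
  (redPair O).one_mem

lemma redPair.pow {z : ℂ} {a : IsLocalRing.ResidueField O} (h : (z, a) ∈ redPair O) (n : ℕ) :
    (z ^ n, a ^ n) ∈ redPair O := (redPair O).pow_mem h n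

lemma redPair.sum {T : Type*} {s : Finset T} {z : T → ℂ} {a : T → IsLocalRing.ResidueField O}
    (h : ∀ t ∈ s, (z t, a t) ∈ redPair O) : (∑ t ∈ s, z t, ∑ t ∈ s, a t) ∈ redPair O := by
  have := (redPair O).sum_mem h
  rwa [show ∑ t ∈ s, (z t, a t) = (∑ t ∈ s, z t, ∑ t ∈ s, a t) from
    Prod.ext Prod.fst_sum Prod.snd_sum] at this

lemma redPair.inv {z : ℂ} {a : IsLocalRing.ResidueField O} (h : (z, a) ∈ redPair O)
    (ha : a ≠ 0) : (z⁻¹, a⁻¹) ∈ redPair O := by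
  obtain ⟨u, hu⟩ := h
  obtain ⟨rfl, rfl⟩ : (u : ℂ) = z ∧ IsLocalRing.residue O u = a := Prod.ext_iff.1 hu
  obtain ⟨v, hv⟩ := ((IsLocalRing.residue_ne_zero_iff_isUnit u).1 ha).exists_right_inv
  refine ⟨v, Prod.ext ?_ ?_⟩
  · exact eq_inv_of_mul_eq_one_right (congrArg Subtype.val hv)
  · refine eq_inv_of_mul_eq_one_right ?_
    have := congrArg (IsLocalRing.residue O) hv
    rwa [map_mul, map_one] at this

/-- A nonzero finite family of numbers can be rescaled to be integral with nonzero reduction. -/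
lemma exists_scale_redPair {T : Type*} (s : Finset T) (c : T → ℂ) {t₀ : T} (ht₀ : t₀ ∈ s)
    (h0 : c t₀ ≠ 0) : ∃ (μ : ℂ) (a : T → IsLocalRing.ResidueField O),
      (∀ t ∈ s, (μ * c t, a t) ∈ redPair O) ∧ ∃ t ∈ s, a t ≠ 0 := by
  classical
  obtain ⟨m, hm, hmax⟩ := s.exists_max_image (fun t => O.valuation (c t)) ⟨t₀, ht₀⟩
  have hm0 : c m ≠ 0 := by
    intro h
    have := hmax t₀ ht₀
    rw [h, map_zero, le_zero_iff, map_eq_zero] at this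
    exact h0 this
  have hO : ∀ t ∈ s, (c m)⁻¹ * c t ∈ O := by
    intro t ht
    rw [← ValuationSubring.valuation_le_one_iff, map_mul, map_inv₀]
    have hv : O.valuation (c m) ≠ 0 := (map_ne_zero _).2 hm0
    rw [inv_mul_le_iff₀ (zero_lt_iff.2 hv), mul_one]
    exact hmax t ht
  refine ⟨(c m)⁻¹, fun t => if ht : t ∈ s then IsLocalRing.residue O ⟨_, hO t ht⟩ else 0,
    fun t ht => ?_, m, hm, ?_⟩
  · simp only [dif_pos ht]; exact redPair_coe ⟨_, hO t ht⟩
  · simp only [dif_pos hm]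
    rw [show (⟨_, hO m hm⟩ : O) = 1 from Subtype.ext (inv_mul_cancel₀ hm0), map_one]
    exact one_ne_zero

end Place

section Operators

variable (O : ValuationSubring ℂ)

/-- Reduction followed by evaluation at `(1, 1, …)`. -/
def evalOne : MvPolynomial ℕ O →+* IsLocalRing.ResidueField O :=
  MvPolynomial.eval₂Hom (IsLocalRing.residue O) fun _ => 1

/-- The operators preserving integral polynomials, together with the scalar by which they act after
reduction and evaluation. -/
def opPair : Subring (Module.End ℂ (MvPolynomial ℕ ℂ) × IsLocalRing.ResidueField O) where
  carrier := {T | ∀ p : MvPolynomial ℕ O, ∃ p' : MvPolynomial ℕ O,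
    T.1 (MvPolynomial.map O.subtype p) = MvPolynomial.map O.subtype p'
      ∧ evalOne O p' = T.2 * evalOne O p}
  mul_mem' := by
    rintro T U hT hU p
    obtain ⟨p', h1, h2⟩ := hU p
    obtain ⟨p'', h3, h4⟩ := hT p'
    refine ⟨p'', ?_, ?_⟩
    · rw [Prod.fst_mul, Module.End.mul_apply, h1, h3]
    · rw [h4, h2, Prod.snd_mul, mul_assoc]
  one_mem' := fun p => ⟨p, rfl, by simp⟩
  add_mem' := by
    rintro T U hT hU p
    obtain ⟨p', h1, h2⟩ := hU p
    obtain ⟨p'', h3, h4⟩ := hT p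
    refine ⟨p'' + p', ?_, ?_⟩
    · rw [Prod.fst_add, LinearMap.add_apply, h1, h3, map_add]
    · rw [map_add, h4, h2, Prod.snd_add, add_mul]
  zero_mem' := fun p => ⟨0, by simp, by simp⟩
  neg_mem' := by
    rintro T hT p
    obtain ⟨p', h1, h2⟩ := hT p
    exact ⟨-p', by simp [h1], by simp [h2]⟩

variable {O}

lemma opPair_zero {a : IsLocalRing.ResidueField O} (h : (0, a) ∈ opPair O) : a = 0 := by
  obtain ⟨p', h1, h2⟩ := h 1
  have : p' = 0 := by
    have hinj : Function.Injective (MvPolynomial.map (σ := ℕ) O.subtype) :=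
      MvPolynomial.map_injective _ Subtype.val_injective
    apply hinj
    rw [← h1]; simp
  simpa [this] using h2.symm

lemma opPair_smul {z : ℂ} {a b : IsLocalRing.ResidueField O} {T : Module.End ℂ (MvPolynomial ℕ ℂ)}
    (h : (z, a) ∈ redPair O) (hT : (T, b) ∈ opPair O) : (z • T, a * b) ∈ opPair O := by
  obtain ⟨u, hu⟩ := h
  obtain ⟨rfl, rfl⟩ : (u : ℂ) = z ∧ IsLocalRing.residue O u = a := Prod.ext_iff.1 hu
  intro p
  obtain ⟨p', h1, h2⟩ := hT p
  refine ⟨MvPolynomial.C u * p', ?_, ?_⟩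
  · simp only [LinearMap.smul_apply]
    rw [h1, map_mul, MvPolynomial.map_C, MvPolynomial.smul_eq_C_mul]
    rfl
  · rw [map_mul, h2, mul_assoc]
    simp [evalOne]

lemma opPair_mul {a b : IsLocalRing.ResidueField O} {T U : Module.End ℂ (MvPolynomial ℕ ℂ)}
    (hT : (T, a) ∈ opPair O) (hU : (U, b) ∈ opPair O) : (T * U, a * b) ∈ opPair O :=
  (opPair O).mul_mem hT hU

lemma opPair_sum {T : Type*} {s : Finset T} {z : T → Module.End ℂ (MvPolynomial ℕ ℂ)}
    {a : T → IsLocalRing.ResidueField O}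
    (h : ∀ t ∈ s, (z t, a t) ∈ opPair O) : (∑ t ∈ s, z t, ∑ t ∈ s, a t) ∈ opPair O := by
  have := (opPair O).sum_mem h
  rwa [show ∑ t ∈ s, (z t, a t) = (∑ t ∈ s, z t, ∑ t ∈ s, a t) from
    Prod.ext Prod.fst_sum Prod.snd_sum] at this

/-- Multiplication by the `n`-th variable. -/
def mulX (n : ℕ) : Module.End ℂ (MvPolynomial ℕ ℂ) := LinearMap.mulLeft ℂ (MvPolynomial.X n)

/-- Rescaling the `n`-th variable. -/
def scaleX (c : ℂ) (n : ℕ) : Module.End ℂ (MvPolynomial ℕ ℂ) :=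
  (MvPolynomial.aeval fun m => (if m = n then MvPolynomial.C c else 1) *
    MvPolynomial.X m : MvPolynomial ℕ ℂ →ₐ[ℂ] MvPolynomial ℕ ℂ).toLinearMap

lemma scaleX_mul_mulX (c : ℂ) (n : ℕ) : scaleX c n * mulX n = c • (mulX n * scaleX c n) := by
  ext1 p
  refine LinearMap.ext fun z => ?_
  simp [scaleX, mulX, MvPolynomial.smul_eq_C_mul, mul_assoc]

lemma scaleX_comm_mulX (c : ℂ) {m n : ℕ} (h : m ≠ n) : Commute (scaleX c n) (mulX m) := by
  refine LinearMap.ext fun z => ?_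
  simp [scaleX, mulX, h]

lemma mulX_comm_mulX (m n : ℕ) : Commute (mulX m) (mulX n) := by
  refine LinearMap.ext fun z => ?_
  simp only [mulX, Module.End.mul_apply, LinearMap.mulLeft_apply]
  ring

lemma scaleX_mul_scaleX_aux (c d : ℂ) (m n : ℕ) : scaleX c m * scaleX d n =
    (MvPolynomial.aeval fun l => (if l = m then MvPolynomial.C c else 1) *
      ((if l = n then MvPolynomial.C d else 1) * MvPolynomial.X l) :
      MvPolynomial ℕ ℂ →ₐ[ℂ] MvPolynomial ℕ ℂ).toLinearMap := by
  rw [Module.End.mul_eq_comp, scaleX, scaleX, ← AlgHom.comp_toLinearMap]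
  congr 1
  refine MvPolynomial.algHom_ext fun l => ?_
  simp only [AlgHom.comp_apply, MvPolynomial.aeval_X, map_mul]
  split_ifs <;> simp only [MvPolynomial.algHom_C, MvPolynomial.algebraMap_eq, map_one]
  all_goals try ring

lemma scaleX_comm_scaleX (c d : ℂ) (m n : ℕ) : Commute (scaleX c m) (scaleX d n) := by
  rw [Commute, SemiconjBy, scaleX_mul_scaleX_aux, scaleX_mul_scaleX_aux]
  congr 2
  funext l
  ring

lemma scaleX_mul_inv {c : ℂ} (hc : c ≠ 0) (n : ℕ) : scaleX c n * scaleX c⁻¹ n = 1 := by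
  rw [scaleX_mul_scaleX_aux]
  refine LinearMap.ext fun z => ?_
  rw [Module.End.one_apply, AlgHom.toLinearMap_apply]
  conv_rhs => rw [← MvPolynomial.aeval_X_left_apply z]
  congr 2
  funext l
  split_ifs
  · rw [← mul_assoc, ← map_mul, mul_inv_cancel₀ hc, map_one, one_mul]
  · simp

lemma scaleX_inv_mul {c : ℂ} (hc : c ≠ 0) (n : ℕ) : scaleX c⁻¹ n * scaleX c n = 1 := by
  rw [scaleX_comm_scaleX, scaleX_mul_inv hc]

lemma mulX_mem (n : ℕ) : (mulX n, (1 : IsLocalRing.ResidueField O)) ∈ opPair O := by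
  intro p
  exact ⟨MvPolynomial.X n * p, by simp [mulX], by simp [evalOne]⟩

lemma scaleX_mem {c : ℂ} (hc : (c, (1 : IsLocalRing.ResidueField O)) ∈ redPair O) (n : ℕ) :
    (scaleX c n, (1 : IsLocalRing.ResidueField O)) ∈ opPair O := by
  obtain ⟨u, hu⟩ := hc
  obtain ⟨rfl, h1⟩ : (u : ℂ) = c ∧ IsLocalRing.residue O u = 1 := Prod.ext_iff.1 hu
  let ψ : MvPolynomial ℕ O →+* MvPolynomial ℕ O := MvPolynomial.eval₂Hom MvPolynomial.C
    fun m => (if m = n then MvPolynomial.C u else 1) * MvPolynomial.X m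
  intro p
  refine ⟨ψ p, ?_, ?_⟩
  · have : (MvPolynomial.aeval fun m => (if m = n then MvPolynomial.C (u : ℂ) else 1) *
        MvPolynomial.X m : MvPolynomial ℕ ℂ →ₐ[ℂ] MvPolynomial ℕ ℂ).toRingHom.comp
          (MvPolynomial.map O.subtype) = (MvPolynomial.map O.subtype).comp ψ := by
      refine MvPolynomial.ringHom_ext (fun r => ?_) fun m => ?_
      · simp [ψ, MvPolynomial.algebraMap_eq]
      · simp only [ψ, RingHom.comp_apply, MvPolynomial.map_X, AlgHom.toRingHom_eq_coe,
          RingHom.coe_coe, MvPolynomial.aeval_X, MvPolynomial.coe_eval₂Hom, MvPolynomial.eval₂_X,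
          map_mul]
        split_ifs <;> simp
    exact RingHom.congr_fun this p
  · rw [one_mul]
    have : (evalOne O).comp ψ = evalOne O := by
      refine MvPolynomial.ringHom_ext (fun r => ?_) fun m => ?_
      · simp [ψ, evalOne]
      · simp only [ψ, RingHom.comp_apply, MvPolynomial.coe_eval₂Hom, MvPolynomial.eval₂_X, map_mul]
        split_ifs <;> simp [evalOne, h1]
    exact RingHom.congr_fun this p

end Operators

lemma perm_eq_one_of_le {n : ℕ} (σ : Equiv.Perm (Fin n)) (h : ∀ k, k ≤ σ k) : σ = 1 := by
  have h1 : ∑ k : Fin n, (k : ℕ) = ∑ k, (σ k : ℕ) := (Equiv.sum_comp σ fun k => (k : ℕ)).symm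
  have h2 := (Finset.sum_eq_sum_iff_of_le fun k _ => (Fin.le_def.1 (h k))).1 h1
  exact Equiv.ext fun k => Fin.ext (h2 k (Finset.mem_univ k)).symm

/-- The quantum determinant of a triangular matrix with invertible diagonal entries. -/
lemma isUnit_qdet_of_triangular {B : Type} [Ring B] [Algebra ℂ B] {N : ℕ} (q : ℂ)
    (y : Fin N → Fin N → B)
    (hy : (∀ i j, j < i → y i j = 0) ∨ (∀ i j, i < j → y i j = 0)) (hu : ∀ i, IsUnit (y i i)) :
    IsUnit (qdet q y) := by
  classical
  rw [qdet, qMinor, Finset.sum_eq_single 1]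
  · have h1 : invCount (1 : Equiv.Perm (Fin (Finset.univ : Finset (Fin N)).card)) = 0 := by
      rw [invCount, Finset.card_eq_zero, Finset.filter_eq_empty_iff]
      rintro p - ⟨h, h'⟩
      exact absurd h (not_lt_of_gt h')
    rw [h1, pow_zero, one_smul]
    refine List.prod_isUnit fun m hm => ?_
    obtain ⟨k, -, rfl⟩ := List.mem_map.1 hm
    exact hu _
  · intro σ _ hσ
    rw [List.prod_eq_zero, smul_zero]
    suffices ∃ k, y ((Finset.univ.orderIsoOfFin rfl) k).1 ((Finset.univ.orderIsoOfFin rfl) (σ k)).1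
        = 0 by
      obtain ⟨k, hk⟩ := this
      exact List.mem_map.2 ⟨k, List.mem_finRange k, hk⟩
    rcases hy with hy | hy
    · obtain ⟨k, hk⟩ : ∃ k, σ k < k := by
        by_contra! h
        exact hσ (perm_eq_one_of_le σ h)
      exact ⟨k, hy _ _ ((Finset.univ.orderIsoOfFin rfl).strictMono hk)⟩
    · obtain ⟨k, hk⟩ : ∃ k, k < σ k := by
        by_contra! h
        refine hσ (inv_eq_one.1 (perm_eq_one_of_le σ⁻¹ fun k => ?_))
        have := h (σ⁻¹ k)
        rwa [← Equiv.Perm.mul_apply, mul_inv_cancel, Equiv.Perm.one_apply] at this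
      exact ⟨k, hy _ _ ((Finset.univ.orderIsoOfFin rfl).strictMono hk)⟩
  · exact fun h => absurd (Finset.mem_univ _) h

/-- A triangular matrix of operators deforming an elementary transvection. -/
def elemMat {B : Type*} [Ring B] {N : ℕ} (i₀ i₁ a b : Fin N) (D D' u : B) : Matrix (Fin N) (Fin N) B :=
  Matrix.of fun i j => if i = j then (if i = i₀ then D else if i = i₁ then D' else 1)
    else if i = a ∧ j = b then u else 0

section Elem

variable {B : Type*} [Ring B] [Algebra ℂ B] {N : ℕ} {q : ℂ} {i₀ i₁ a b : Fin N} {D D' u : B}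

lemma elemMat_isQMat (h01 : i₀.1 + 1 = i₁.1) (hab : (a = i₀ ∧ b = i₁) ∨ (a = i₁ ∧ b = i₀))
    (h1 : D * D' = 1) (h2 : D' * D = 1) (hu : D * u = q • (u * D)) :
    IsQMat q (fun i j => elemMat i₀ i₁ a b D D' u i j) := by
  have hu' : u * D' = q • (D' * u) := by
    calc u * D' = D' * (D * u) * D' := by rw [← mul_assoc, h2, one_mul]
      _ = q • (D' * u * (D * D')) := by
        rw [hu, mul_smul_comm, smul_mul_assoc]; simp only [mul_assoc]
      _ = _ := by rw [h1, mul_one]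
  have hne : i₀ ≠ i₁ := by intro h; rw [h] at h01; omega
  have hzero : ∀ i k j l : Fin N, i < k → j < l →
      elemMat i₀ i₁ a b D D' u i l = 0 ∨ elemMat i₀ i₁ a b D D' u k j = 0 := by
    intro i k j l h h'
    simp only [elemMat, Matrix.of_apply]
    rcases hab with ⟨rfl, rfl⟩ | ⟨rfl, rfl⟩
    · have : ¬ (k = j) ∨ ¬ i = l := by by_contra! h3; omega
      by_cases h3 : i = l
      · right; rw [if_neg (by omega), if_neg (by omega)]
      · by_cases h4 : i = a ∧ l = b
        · right; rw [if_neg (by omega), if_neg (by omega)]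
        · left; rw [if_neg h3, if_neg h4]
    · by_cases h3 : i = l
      · right; rw [if_neg (by omega), if_neg (by omega)]
      · by_cases h4 : i = a ∧ l = b
        · right; rw [if_neg (by omega), if_neg (by omega)]
        · left; rw [if_neg h3, if_neg h4]
  constructor
  · intro i j l h
    simp only [elemMat, Matrix.of_apply]
    rcases hab with ⟨rfl, rfl⟩ | ⟨rfl, rfl⟩
    · by_cases h3 : i = a ∧ l = b
      · obtain ⟨rfl, rfl⟩ := h3
        by_cases h4 : i = j
        · subst h4; simpa [hne] using hu
        · simp [h4, h.ne]
      · by_cases h4 : i = l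
        · subst h4
          rw [if_neg h.ne', if_neg (by omega)]; simp
        · rw [if_neg h4, if_neg h3]; simp
    · by_cases h3 : i = a ∧ j = b
      · obtain ⟨rfl, rfl⟩ := h3
        by_cases h4 : i = l
        · subst h4; simpa [hne, hne.symm] using hu'
        · simp [h4, h.ne']
      · by_cases h4 : i = j
        · subst h4
          have h5 : ¬ (i = a ∧ l = b) := by omega
          simp [h.ne, h5]
        · rw [if_neg h4, if_neg h3]; simp
  · intro i k j h
    simp only [elemMat, Matrix.of_apply]
    rcases hab with ⟨rfl, rfl⟩ | ⟨rfl, rfl⟩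
    · by_cases h3 : i = a ∧ j = b
      · obtain ⟨rfl, rfl⟩ := h3
        by_cases h4 : k = j
        · subst h4; simpa [hne, hne.symm] using hu'
        · simp [h4, h.ne']
      · by_cases h4 : i = j
        · subst h4
          have h5 : ¬ (k = a ∧ i = b) := by omega
          simp [h.ne', h5]
        · rw [if_neg h4, if_neg h3]; simp
    · by_cases h3 : k = a ∧ j = b
      · obtain ⟨rfl, rfl⟩ := h3
        by_cases h4 : i = j
        · subst h4; simpa [hne, hne.symm] using hu
        · simp [h4, h.ne]
      · by_cases h4 : k = j
        · subst h4
          rw [if_neg h.ne, if_neg (by omega)]; simp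
        · rw [if_neg h4, if_neg h3]; simp
  · intro i k j l h h'
    rcases hzero i k j l h h' with h3 | h3 <;> simp [h3]
  · intro i k j l h h'
    have hz : elemMat i₀ i₁ a b D D' u i l * elemMat i₀ i₁ a b D D' u k j = 0 := by
      rcases hzero i k j l h h' with h3 | h3 <;> simp [h3]
    rw [hz, smul_zero, sub_eq_zero]
    simp only [elemMat, Matrix.of_apply]
    by_cases h3 : i = j
    · subst h3
      by_cases h4 : k = l
      · subst h4
        simp only [if_true]
        split_ifs <;> simp_all
      · rw [if_neg h4]
        split_ifs <;> first | omega | simp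
    · rw [if_neg h3]
      by_cases h4 : k = l
      · subst h4
        split_ifs <;> first | omega | simp
      · rw [if_neg h4]
        split_ifs <;> first | omega | simp

lemma elemMat_mul {B : Type*} [Ring B] {D D' u : B} (hab : a ≠ b) {E E' : B} (h1 : D * E = 1) (h2 : D' * E' = 1)
    {v : B} (h3 : elemMat i₀ i₁ a b D D' u a a * v + u * elemMat i₀ i₁ a b E E' v b b = 0) :
    elemMat i₀ i₁ a b D D' u * elemMat i₀ i₁ a b E E' v = 1 := by
  have hdec : ∀ D D' u : B, elemMat i₀ i₁ a b D D' u
      = Matrix.diagonal (fun i => elemMat i₀ i₁ a b D D' u i i) + Matrix.single a b u := by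
    intro D D' u
    ext i j
    simp only [elemMat, Matrix.of_apply, Matrix.add_apply, Matrix.diagonal_apply, Matrix.single_apply]
    by_cases h : i = j
    · subst h
      have h5 : ¬ (a = i ∧ b = i) := fun h => hab (h.1.trans h.2.symm)
      simp [h5]
    · simp [h, eq_comm]
  rw [hdec D D' u, hdec E E' v, add_mul, mul_add, mul_add, Matrix.diagonal_mul_diagonal,
    Matrix.single_mul_single_of_ne _ _ _ _ hab.symm, add_zero, add_assoc]
  have h4 : (Matrix.diagonal (fun i => elemMat i₀ i₁ a b D D' u i i) * Matrix.single a b v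
      + Matrix.single a b u * Matrix.diagonal (fun i => elemMat i₀ i₁ a b E E' v i i)
      : Matrix (Fin N) (Fin N) B) = 0 := by
    ext i j
    rw [Matrix.add_apply, Matrix.diagonal_mul, Matrix.mul_diagonal, Matrix.single_apply,
      Matrix.single_apply]
    split_ifs with h
    · obtain ⟨rfl, rfl⟩ := h
      exact h3
    · simp
  rw [h4, add_zero, ← Matrix.diagonal_one]
  congr 1
  funext i
  simp only [elemMat, Matrix.of_apply, if_true]
  split_ifs
  · exact h1
  · exact h2
  · exact one_mul 1

end Elem

section

/-- Quantum matrices with invertible quantum determinant extend to the quantum group. -/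
def ExtProp {M G : Type} [Ring M] [Algebra ℂ M] [Ring G] [Algebra ℂ G] {N : ℕ} (q : ℂ)
    (x : Fin N → Fin N → M) (ι : M →ₐ[ℂ] G) : Prop :=
  ∀ (B : Type) [Ring B] [Algebra ℂ B] (y : Fin N → Fin N → B), IsQMat q y → IsUnit (qdet q y) →
    ∃ ψ : G →ₐ[ℂ] B, ∀ i j, ψ (ι (x i j)) = y i j

/-- The operators in the `n`-th variable. -/
def opAlg (q : ℂ) (n : ℕ) : Subalgebra ℂ (Module.End ℂ (MvPolynomial ℕ ℂ)) :=
  Algebra.adjoin ℂ {mulX n, scaleX q n, scaleX q⁻¹ n}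

lemma scaleX_inv_commute {q : ℂ} (hq : q ≠ 0) {T : Module.End ℂ (MvPolynomial ℕ ℂ)} {n : ℕ}
    (h : Commute T (scaleX q n)) : Commute T (scaleX q⁻¹ n) := by
  have h1 : scaleX q n * scaleX q⁻¹ n = 1 := scaleX_mul_inv hq n
  have h2 : scaleX q⁻¹ n * scaleX q n = 1 := scaleX_inv_mul hq n
  calc T * scaleX q⁻¹ n = scaleX q⁻¹ n * (scaleX q n * T) * scaleX q⁻¹ n := by
        rw [← mul_assoc, h2, one_mul]
    _ = scaleX q⁻¹ n * T * (scaleX q n * scaleX q⁻¹ n) := by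
        rw [← h.eq]; simp only [mul_assoc]
    _ = _ := by rw [h1, mul_one]

lemma opAlg_commute {q : ℂ} (hq : q ≠ 0) {T : Module.End ℂ (MvPolynomial ℕ ℂ)} {n : ℕ}
    (h : Commute T (mulX n)) (h' : Commute T (scaleX q n)) {U : Module.End ℂ (MvPolynomial ℕ ℂ)}
    (hU : U ∈ opAlg q n) : Commute T U := by
  refine Algebra.adjoin_induction (p := fun U _ => Commute T U) ?_ ?_ ?_ ?_ hU
  · rintro U (rfl | rfl | rfl)
    · exact h
    · exact h'
    · exact scaleX_inv_commute hq h'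
  · intro r; exact (Algebra.commutes r T).symm
  · intro U V _ _ h1 h2; exact h1.add_right h2
  · intro U V _ _ h1 h2; exact h1.mul_right h2

lemma opAlg_commute_mulX {q : ℂ} (hq : q ≠ 0) {m n : ℕ} (h : m ≠ n)
    {U : Module.End ℂ (MvPolynomial ℕ ℂ)} (hU : U ∈ opAlg q n) : Commute U (mulX m) :=
  (opAlg_commute hq (mulX_comm_mulX m n) (scaleX_comm_mulX q h).symm hU).symm

lemma opAlg_commute_scaleX {q : ℂ} (hq : q ≠ 0) {m n : ℕ} (h : m ≠ n)
    {U : Module.End ℂ (MvPolynomial ℕ ℂ)} (hU : U ∈ opAlg q n) : Commute U (scaleX q m) :=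
  (opAlg_commute hq (scaleX_comm_mulX q h.symm) (scaleX_comm_scaleX q q m n) hU).symm

variable {M G : Type} [Ring M] [Algebra ℂ M] [Ring G] [Algebra ℂ G] {N : ℕ} {q : ℂ}
  {x : Fin N → Fin N → M} {ι : M →ₐ[ℂ] G} {dInv : G} {ΔM : M →ₐ[ℂ] M ⊗[ℂ] M}
  {ΔG : G →ₐ[ℂ] G ⊗[ℂ] G} {εG : G →ₐ[ℂ] ℂ} {St : G →ₗ[ℂ] G} {O : ValuationSubring ℂ}

/-- A representation specializing to the point `g`, in the first `n` variables. -/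
def HasRep (q : ℂ) (x : Fin N → Fin N → M) (ι : M →ₐ[ℂ] G) (St : G →ₗ[ℂ] G)
    (g : Matrix (Fin N) (Fin N) (IsLocalRing.ResidueField O)) (n : ℕ) : Prop :=
  ∃ ρ : G →ₐ[ℂ] Module.End ℂ (MvPolynomial ℕ ℂ),
    (∀ i j, (ρ (ι (x i j)), g i j) ∈ opPair O) ∧
    (∀ i j, (ρ (St (ι (x i j))), g⁻¹ i j) ∈ opPair O) ∧
    ∀ a m, n ≤ m → Commute (ρ a) (mulX m) ∧ Commute (ρ a) (scaleX q m)

lemma IsQGL.map_sMat (H : IsQGL q x ι dInv ΔM ΔG εG St) {B : Type} [Ring B] [Algebra ℂ B]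
    (ρ : G →ₐ[ℂ] B) (z : Matrix (Fin N) (Fin N) B)
    (hz : z * (Matrix.of fun i j => ρ (ι (x i j))) = 1) (i j : Fin N) :
    ρ (St (ι (x i j))) = z i j := by
  have h1 : (Matrix.of fun i j => ρ (ι (x i j))) * (Matrix.of fun i j => ρ (St (ι (x i j)))) = 1 := by
    ext i j
    have := congrArg ρ (H.sum_t_s_one i j)
    simp only [map_sum, map_mul] at this
    rw [Matrix.mul_apply]
    simp only [Matrix.of_apply]
    rw [this, Matrix.one_apply]
    split_ifs <;> simp
  exact (congrArg (fun m : Matrix (Fin N) (Fin N) B => m i j) (left_inv_eq_right_inv hz h1)).symm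

lemma HasRep.one (H : IsQGL q x ι dInv ΔM ΔG εG St) :
    HasRep q x ι St (1 : Matrix (Fin N) (Fin N) (IsLocalRing.ResidueField O)) 0 := by
  have hmem : ∀ i j : Fin N, (((if i = j then 1 else 0 : Module.End ℂ (MvPolynomial ℕ ℂ))),
      (1 : Matrix (Fin N) (Fin N) (IsLocalRing.ResidueField O)) i j) ∈ opPair O := by
    intro i j
    rw [Matrix.one_apply]
    split_ifs
    · exact (opPair O).one_mem
    · exact (opPair O).zero_mem
  have hρ : ∀ i j, ((Algebra.ofId ℂ (Module.End ℂ (MvPolynomial ℕ ℂ))).comp εG) (ι (x i j))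
      = if i = j then 1 else 0 := by
    intro i j
    rw [AlgHom.comp_apply, H.counit]
    split_ifs <;> simp
  refine ⟨(Algebra.ofId ℂ _).comp εG, fun i j => ?_, fun i j => ?_, fun a m _ => ⟨?_, ?_⟩⟩
  · rw [hρ]; exact hmem i j
  · rw [H.map_sMat _ 1 (by ext i j; simp only [one_mul, Matrix.of_apply, hρ, Matrix.one_apply]),
      Matrix.one_apply, inv_one]
    exact hmem i j
  · exact Algebra.commutes (εG a) (mulX m)
  · exact Algebra.commutes (εG a) (scaleX q m)

lemma HasRep.mul (H : IsQGL q x ι dInv ΔM ΔG εG St) (E : ExtProp q x ι)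
    {g h : Matrix (Fin N) (Fin N) (IsLocalRing.ResidueField O)} {n : ℕ}
    (hg : HasRep q x ι St g n) (y z : Matrix (Fin N) (Fin N) (opAlg q n))
    (hy : IsQMat q (fun i j => y i j)) (hd : IsUnit (qdet q (fun i j => y i j)))
    (hzy : z * y = 1) (hyh : ∀ i j, ((y i j : Module.End ℂ (MvPolynomial ℕ ℂ)), h i j) ∈ opPair O)
    (hzh : ∀ i j, ((z i j : Module.End ℂ (MvPolynomial ℕ ℂ)), h⁻¹ i j) ∈ opPair O) :
    HasRep q x ι St (g * h) (n + 1) := by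
  obtain ⟨ρ, h1, h2, h3⟩ := hg
  obtain ⟨ψ, hψ⟩ := E _ _ hy hd
  have hcomm : ∀ a b, Commute (ρ a) ((opAlg q n).val.comp ψ b) := fun a b =>
    opAlg_commute H.q_ne (h3 a n le_rfl).1 (h3 a n le_rfl).2 (ψ b).2
  let Ψ := (Algebra.TensorProduct.lift ρ ((opAlg q n).val.comp ψ) hcomm).comp ΔG
  have hΨ : ∀ i j, Ψ (ι (x i j)) = ∑ k, ρ (ι (x i k)) * (y k j : Module.End ℂ _) := by
    intro i j
    have : ΔG (ι (x i j)) = ∑ k, ι (x i k) ⊗ₜ[ℂ] ι (x k j) := by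
      rw [H.comulG, H.comulM]; simp
    simp only [Ψ, AlgHom.comp_apply]
    rw [this, map_sum]
    simp [hψ]
  have hρ' : (Matrix.of fun i j => ρ (St (ι (x i j)))) * (Matrix.of fun i j => ρ (ι (x i j))) = 1 := by
    ext i j
    have := congrArg ρ (H.sum_s_t_one i j)
    simp only [map_sum, map_mul] at this
    rw [Matrix.mul_apply]
    simp only [Matrix.of_apply]
    rw [this, Matrix.one_apply]
    split_ifs <;> simp
  have hzy' : (z.map (opAlg q n).val) * (y.map (opAlg q n).val) = 1 := by
    rw [← Matrix.map_mul, hzy, Matrix.map_one _ (map_zero _) (map_one _)]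
  have hS := H.map_sMat Ψ ((z.map (opAlg q n).val) * (Matrix.of fun i j => ρ (St (ι (x i j))))) (by
    have : (Matrix.of fun i j => Ψ (ι (x i j)))
        = (Matrix.of fun i j => ρ (ι (x i j))) * (y.map (opAlg q n).val) := by
      ext1 i j
      rw [Matrix.of_apply, hΨ, Matrix.mul_apply]
      rfl
    rw [this, mul_assoc, ← mul_assoc (Matrix.of fun i j => ρ (St (ι (x i j)))), hρ', one_mul, hzy'])
  refine ⟨Ψ, fun i j => ?_, fun i j => ?_, fun a m hm => ?_⟩
  · rw [hΨ, Matrix.mul_apply]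
    exact opPair_sum fun k _ => opPair_mul (h1 i k) (hyh k j)
  · rw [hS, Matrix.mul_inv_rev, Matrix.mul_apply, Matrix.mul_apply]
    exact opPair_sum fun k _ => opPair_mul (hzh i k) (h2 k j)
  · simp only [Ψ, AlgHom.comp_apply]
    generalize ΔG a = w
    induction w with
    | zero => simp
    | add u v hu hv => simp only [map_add]; exact ⟨hu.1.add_left hv.1, hu.2.add_left hv.2⟩
    | tmul u v =>
      rw [Algebra.TensorProduct.lift_tmul]
      refine ⟨(h3 u m (by omega)).1.mul_left ?_, (h3 u m (by omega)).2.mul_left ?_⟩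
      · exact opAlg_commute_mulX H.q_ne (by omega) (ψ v).2
      · exact opAlg_commute_scaleX H.q_ne (by omega) (ψ v).2

/-- Right multiplication by `h` preserves the points with a representation. -/
def RepMul (q : ℂ) (x : Fin N → Fin N → M) (ι : M →ₐ[ℂ] G) (St : G →ₗ[ℂ] G)
    (h : Matrix (Fin N) (Fin N) (IsLocalRing.ResidueField O)) : Prop :=
  ∀ g n, HasRep q x ι St g n → ∃ m, HasRep q x ι St (g * h) m

lemma RepMul.mul {g h : Matrix (Fin N) (Fin N) (IsLocalRing.ResidueField O)}
    (hg : RepMul q x ι St g) (hh : RepMul q x ι St h) : RepMul q x ι St (g * h) := by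
  intro a n ha
  obtain ⟨m, hm⟩ := hg a n ha
  obtain ⟨l, hl⟩ := hh _ m hm
  exact ⟨l, by rwa [mul_assoc] at hl⟩

lemma RepMul.diagonal (H : IsQGL q x ι dInv ΔM ΔG εG St) (E : ExtProp q x ι) (d : Fin N → ℂ)
    (d' : Fin N → IsLocalRing.ResidueField O) (hd : ∀ i, (d i, d' i) ∈ redPair O)
    (h0 : ∀ i, d' i ≠ 0) : RepMul q x ι St (Matrix.diagonal d') := by
  intro g n hg
  have hd0 : ∀ i, d i ≠ 0 := fun i => redPair.ne_zero (hd i) (h0 i)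
  have hmem : ∀ (c : Fin N → ℂ) (c' : Fin N → IsLocalRing.ResidueField O),
      (∀ i, (c i, c' i) ∈ redPair O) → ∀ i j,
      (((Matrix.diagonal fun i => algebraMap ℂ (opAlg q n) (c i)) i j :
        Module.End ℂ (MvPolynomial ℕ ℂ)), Matrix.diagonal c' i j) ∈ opPair O := by
    intro c c' hc i j
    simp only [Matrix.diagonal_apply]
    split_ifs
    · have := opPair_smul (hc i) (opPair O).one_mem
      rw [mul_one] at this
      rw [Subalgebra.coe_algebraMap, Algebra.algebraMap_eq_smul_one]
      exact this
    · exact (opPair O).zero_mem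
  refine ⟨n + 1, HasRep.mul H E hg (Matrix.diagonal fun i => algebraMap ℂ (opAlg q n) (d i))
    (Matrix.diagonal fun i => algebraMap ℂ (opAlg q n) (d i)⁻¹) ?_ ?_ ?_ (hmem _ _ hd) ?_⟩
  · constructor
    · intro i j l h
      by_cases h1 : i = j
      · subst h1; simp [Matrix.diagonal_apply_ne _ h.ne]
      · simp [Matrix.diagonal_apply_ne _ h1]
    · intro i k j h
      by_cases h1 : i = j
      · subst h1; simp [Matrix.diagonal_apply_ne _ h.ne']
      · simp [Matrix.diagonal_apply_ne _ h1]
    · intro i k j l h h'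
      by_cases h1 : i = l
      · rw [Matrix.diagonal_apply_ne _ (show k ≠ j by omega)]; simp
      · simp [Matrix.diagonal_apply_ne _ h1]
    · intro i k j l h h'
      have h2 : (Matrix.diagonal fun i => algebraMap ℂ (opAlg q n) (d i)) i l *
          (Matrix.diagonal fun i => algebraMap ℂ (opAlg q n) (d i)) k j = 0 := by
        by_cases h1 : i = l
        · rw [Matrix.diagonal_apply_ne _ (show k ≠ j by omega)]; simp
        · simp [Matrix.diagonal_apply_ne _ h1]
      rw [h2, smul_zero, sub_eq_zero]
      by_cases h1 : i = j
      · subst h1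
        rw [Matrix.diagonal_apply_eq]
        exact Algebra.commutes _ _
      · simp [Matrix.diagonal_apply_ne _ h1]
  · refine isUnit_qdet_of_triangular q _ (Or.inl fun i j h => Matrix.diagonal_apply_ne _ h.ne') ?_
    intro i
    rw [Matrix.diagonal_apply_eq]
    exact (isUnit_iff_ne_zero.2 (hd0 i)).map (algebraMap ℂ (opAlg q n))
  · rw [Matrix.diagonal_mul_diagonal, ← Matrix.diagonal_one]
    congr 1
    funext i
    rw [← map_mul, inv_mul_cancel₀ (hd0 i), map_one]
  · have : (Matrix.diagonal d')⁻¹ = Matrix.diagonal fun i => (d' i)⁻¹ := by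
      refine Matrix.inv_eq_right_inv ?_
      rw [Matrix.diagonal_mul_diagonal, ← Matrix.diagonal_one]
      congr 1
      funext i
      exact mul_inv_cancel₀ (h0 i)
    rw [this]
    exact hmem _ _ fun i => redPair.inv (hd i) (h0 i)

lemma add_neg_mul_mul_eq_zero {R : Type*} [Ring R] (a x b' b : R) (h : b' * b = 1) :
    a * x + -(a * x * b') * b = 0 := by
  rw [neg_mul, mul_assoc (a * x), h, mul_one, add_neg_cancel]

lemma RepMul.transvection_adj (H : IsQGL q x ι dInv ΔM ΔG εG St) (E : ExtProp q x ι)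
    (hq1 : (q, (1 : IsLocalRing.ResidueField O)) ∈ redPair O) {i₀ i₁ a b : Fin N}
    (h01 : i₀.1 + 1 = i₁.1) (hab : (a = i₀ ∧ b = i₁) ∨ (a = i₁ ∧ b = i₀))
    {c : ℂ} {c' : IsLocalRing.ResidueField O} (hc : (c, c') ∈ redPair O) :
    RepMul q x ι St (Matrix.transvection a b c') := by
  intro g n hg
  have hq := H.q_ne
  have hne : a ≠ b := by rintro rfl; omega
  let D : opAlg q n := ⟨scaleX q n, Algebra.subset_adjoin (by simp)⟩
  let D' : opAlg q n := ⟨scaleX q⁻¹ n, Algebra.subset_adjoin (by simp)⟩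
  let X : opAlg q n := ⟨mulX n, Algebra.subset_adjoin (by simp)⟩
  have hDD : D * D' = 1 := Subtype.ext (scaleX_mul_inv hq n)
  have hDD' : D' * D = 1 := Subtype.ext (scaleX_inv_mul hq n)
  have hDX : D * X = q • (X * D) := Subtype.ext (scaleX_mul_mulX q n)
  have hq1' : (q⁻¹, (1 : IsLocalRing.ResidueField O)) ∈ redPair O := by
    simpa using redPair.inv hq1 one_ne_zero
  have hD : ((D : Module.End ℂ (MvPolynomial ℕ ℂ)), (1 : IsLocalRing.ResidueField O)) ∈ opPair O :=
    scaleX_mem hq1 n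
  have hD' : ((D' : Module.End ℂ (MvPolynomial ℕ ℂ)), (1 : IsLocalRing.ResidueField O)) ∈ opPair O :=
    scaleX_mem hq1' n
  have hmem : ∀ (T T' U : opAlg q n) (t : IsLocalRing.ResidueField O),
      ((T : Module.End ℂ (MvPolynomial ℕ ℂ)), (1 : IsLocalRing.ResidueField O)) ∈ opPair O →
      ((T' : Module.End ℂ (MvPolynomial ℕ ℂ)), (1 : IsLocalRing.ResidueField O)) ∈ opPair O →
      ((U : Module.End ℂ (MvPolynomial ℕ ℂ)), t) ∈ opPair O → ∀ i j,
      (Subtype.val (elemMat i₀ i₁ a b T T' U i j),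
        Matrix.transvection a b t i j) ∈ opPair O := by
    intro T T' U t hT hT' hU i j
    simp only [elemMat, Matrix.transvection, Matrix.of_apply, Matrix.add_apply, Matrix.one_apply,
      Matrix.single_apply]
    by_cases h : i = j
    · subst h
      have h5 : ¬ (a = i ∧ b = i) := fun h => hne (h.1.trans h.2.symm)
      rw [if_pos rfl, if_pos rfl, if_neg h5, add_zero]
      split_ifs
      · exact hT
      · exact hT'
      · exact (opPair O).one_mem
    · rw [if_neg h, if_neg h, zero_add]
      by_cases h6 : i = a ∧ j = b
      · rw [if_pos h6, if_pos ⟨h6.1.symm, h6.2.symm⟩]; exact hU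
      · rw [if_neg h6, if_neg fun h7 => h6 ⟨h7.1.symm, h7.2.symm⟩]; exact (opPair O).zero_mem
  have hu : (((c • X : opAlg q n) : Module.End ℂ (MvPolynomial ℕ ℂ)), c') ∈ opPair O := by
    have := opPair_smul hc (mulX_mem (O := O) n)
    rwa [mul_one] at this
  -- the off-diagonal entry of the inverse
  obtain ⟨Z, hZ, hz⟩ : ∃ Z : opAlg q n, elemMat i₀ i₁ a b D' D Z * elemMat i₀ i₁ a b D D' (c • X) = 1
      ∧ ((Z : Module.End ℂ (MvPolynomial ℕ ℂ)), -c') ∈ opPair O := by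
    let A := elemMat i₀ i₁ a b D' D 0 a a
    let B := elemMat i₀ i₁ a b D D' (0 : opAlg q n) b b
    let B' := elemMat i₀ i₁ a b D' D (0 : opAlg q n) b b
    have hA1 := hmem D' D 0 0 hD' hD (opPair O).zero_mem a a
    have hB1 := hmem D' D 0 0 hD' hD (opPair O).zero_mem b b
    rw [Matrix.transvection_zero, Matrix.one_apply_eq] at hA1 hB1
    have hBB : B' * B = 1 := by
      simp only [B, B', elemMat, Matrix.of_apply, if_true]
      split_ifs
      · exact hDD'
      · exact hDD
      · exact one_mul 1
    refine ⟨-(A * (c • X) * B'), elemMat_mul hne hDD' hDD ?_, ?_⟩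
    · have e1 : elemMat i₀ i₁ a b D' D (-(A * (c • X) * B')) a a = A := by
        simp only [A, elemMat, Matrix.of_apply, if_true]
      have e2 : elemMat i₀ i₁ a b D D' (c • X) b b = B := by
        simp only [B, elemMat, Matrix.of_apply, if_true]
      rw [e1, e2]
      exact add_neg_mul_mul_eq_zero _ _ _ _ hBB
    · have := (opPair O).neg_mem (opPair_mul (opPair_mul hA1 hu) hB1)
      rw [one_mul, mul_one] at this
      exact this
  refine ⟨n + 1, HasRep.mul H E hg (elemMat i₀ i₁ a b D D' (c • X)) (elemMat i₀ i₁ a b D' D Z)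
    (elemMat_isQMat h01 hab hDD hDD' ?_) ?_ hZ (hmem _ _ _ _ hD hD' hu) ?_⟩
  · rw [mul_smul_comm, hDX, smul_mul_assoc, smul_comm]
  · refine isUnit_qdet_of_triangular q _ ?_ ?_
    · rcases hab with ⟨rfl, rfl⟩ | ⟨rfl, rfl⟩
      · left
        intro i j h
        simp only [elemMat, Matrix.of_apply]
        rw [if_neg (by omega), if_neg (by omega)]
      · right
        intro i j h
        simp only [elemMat, Matrix.of_apply]
        rw [if_neg (by omega), if_neg (by omega)]
    · intro i
      simp only [elemMat, Matrix.of_apply, if_true]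
      split_ifs
      · exact ⟨⟨D, D', hDD, hDD'⟩, rfl⟩
      · exact ⟨⟨D', D, hDD', hDD⟩, rfl⟩
      · exact isUnit_one
  · have : (Matrix.transvection a b c')⁻¹ = Matrix.transvection a b (-c') := by
      refine Matrix.inv_eq_right_inv ?_
      rw [Matrix.transvection_mul_transvection_same _ _ hne, add_neg_cancel, Matrix.transvection_zero]
    rw [this]
    exact hmem _ _ _ _ hD' hD hz

end

section

/-- The reduction map on a subfield contained in the valuation ring. -/
def resHom {K : Subfield ℂ} {O : ValuationSubring ℂ} (hK : ∀ a ∈ K, a ∈ O) :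
    K →+* IsLocalRing.ResidueField O :=
  (IsLocalRing.residue O).comp
    { toFun := fun a => ⟨a, hK a a.2⟩
      map_one' := rfl
      map_mul' := fun _ _ => rfl
      map_zero' := rfl
      map_add' := fun _ _ => rfl }

section

variable {K : Subfield ℂ} {O : ValuationSubring ℂ}

lemma resHom_mem (hK : ∀ a ∈ K, a ∈ O) (a : K) : ((a : ℂ), resHom hK a) ∈ redPair O :=
  redPair_coe (O := O) ⟨a, hK a a.2⟩

lemma residue_natCast_ne_zero (hK : ∀ a ∈ K, a ∈ O) {n : ℕ} (hn : n ≠ 0) : (n : IsLocalRing.ResidueField O) ≠ 0 := by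
  have : resHom hK (n : K) ≠ 0 := by
    rw [map_ne_zero]
    exact_mod_cast hn
  rwa [map_natCast] at this

lemma qFact_ne_zero (hK : ∀ a ∈ K, a ∈ O) {q : ℂ} (hq1 : (q, (1 : IsLocalRing.ResidueField O)) ∈ redPair O) (n : ℕ) :
    qFact q n ≠ 0 := by
  refine redPair.ne_zero (O := O) (a := ∑ σ : Equiv.Perm (Fin n), (-1) ^ invCount σ * (-1) ^ invCount σ)
    (redPair.sum fun σ _ => redPair.mul (redPair.pow (redPair.neg hq1) _) (redPair.pow (redPair.neg hq1) _)) ?_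
  have : ∀ σ : Equiv.Perm (Fin n),
      ((-1) ^ invCount σ * (-1) ^ invCount σ : IsLocalRing.ResidueField O) = 1 := fun σ => by
    rw [← mul_pow]; simp
  simp only [this, Finset.sum_const, nsmul_eq_mul, mul_one]
  exact residue_natCast_ne_zero hK (by simp [Fintype.card_perm, Nat.factorial_ne_zero])

lemma add_inv_ne_zero (hK : ∀ a ∈ K, a ∈ O) {q : ℂ} (hq1 : (q, (1 : IsLocalRing.ResidueField O)) ∈ redPair O) :
    q + q⁻¹ ≠ 0 := by
  refine redPair.ne_zero (redPair.add hq1 (redPair.inv hq1 one_ne_zero)) ?_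
  have := residue_natCast_ne_zero hK two_ne_zero
  rw [inv_one, one_add_one_eq_two]
  exact_mod_cast this

end

lemma transvection_commutator {R : Type*} [CommRing R] {N : ℕ} {i k j : Fin N} (hik : i ≠ k)
    (hkj : k ≠ j) (hij : i ≠ j) (c : R) :
    Matrix.transvection i k c * Matrix.transvection k j 1 *
      (Matrix.transvection i k (-c) * Matrix.transvection k j (-1)) = Matrix.transvection i j c := by
  simp only [Matrix.transvection]
  simp only [mul_add, add_mul, mul_one, one_mul, Matrix.single_mul_single_same,
    Matrix.single_mul_single_of_ne _ _ _ _ hik.symm, Matrix.single_mul_single_of_ne _ _ _ _ hkj.symm,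
    Matrix.single_mul_single_of_ne _ _ _ _ hij.symm, add_zero, neg_mul, mul_neg,
    ← Matrix.single_neg]
  abel

variable {M G : Type} [Ring M] [Algebra ℂ M] [Ring G] [Algebra ℂ G] {N : ℕ} {q : ℂ}
  {x : Fin N → Fin N → M} {ι : M →ₐ[ℂ] G} {dInv : G} {ΔM : M →ₐ[ℂ] M ⊗[ℂ] M}
  {ΔG : G →ₐ[ℂ] G ⊗[ℂ] G} {εG : G →ₐ[ℂ] ℂ} {St : G →ₗ[ℂ] G} {O : ValuationSubring ℂ}
  {K : Subfield ℂ}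

lemma RepMul.transvection (hK : ∀ a ∈ K, a ∈ O) (H : IsQGL q x ι dInv ΔM ΔG εG St)
    (E : ExtProp q x ι) (hq1 : (q, (1 : IsLocalRing.ResidueField O)) ∈ redPair O) (d : ℕ) :
    ∀ {i j : Fin N}, (i.1 + d + 1 = j.1 ∨ j.1 + d + 1 = i.1) → ∀ c : K,
      RepMul q x ι St (Matrix.transvection i j (resHom hK c)) := by
  have hadj : ∀ {i j : Fin N}, (i.1 + 1 = j.1 ∨ j.1 + 1 = i.1) → ∀ c : K,
      RepMul q x ι St (Matrix.transvection i j (resHom hK c)) := by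
    rintro i j (h | h) c
    · exact RepMul.transvection_adj H E hq1 h (Or.inl ⟨rfl, rfl⟩) (resHom_mem hK c)
    · exact RepMul.transvection_adj H E hq1 h (Or.inr ⟨rfl, rfl⟩) (resHom_mem hK c)
  induction d with
  | zero => exact fun h c => hadj h c
  | succ d ih =>
    intro i j h c
    obtain ⟨k, h1, h2⟩ : ∃ k : Fin N, (i.1 + d + 1 = k.1 ∨ k.1 + d + 1 = i.1) ∧
        (k.1 + 1 = j.1 ∨ j.1 + 1 = k.1) := by
      have := i.2
      have := j.2
      rcases h with h | h
      · exact ⟨⟨j.1 - 1, by omega⟩, Or.inl (by dsimp only; omega), Or.inl (by dsimp only; omega)⟩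
      · exact ⟨⟨j.1 + 1, by omega⟩, Or.inr (by dsimp only; omega), Or.inr rfl⟩
    have e1 := ih h1
    have e2 := hadj h2
    have h3 := ((e1 c).mul (e2 1)).mul ((e1 (-c)).mul (e2 (-1)))
    rw [map_neg, map_neg, map_one, transvection_commutator] at h3
    · exact h3
    all_goals rw [Ne, Fin.ext_iff]; omega

lemma HasRep.exists (hK : ∀ a ∈ K, a ∈ O) (H : IsQGL q x ι dInv ΔM ΔG εG St)
    (E : ExtProp q x ι) (hq1 : (q, (1 : IsLocalRing.ResidueField O)) ∈ redPair O)
    (g : Matrix (Fin N) (Fin N) K) (hg : g.det ≠ 0) :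
    ∃ n, HasRep q x ι St (g.map (resHom hK)) n := by
  suffices RepMul q x ι St (g.map (resHom hK)) by
    obtain ⟨m, hm⟩ := this 1 0 (HasRep.one H)
    exact ⟨m, by rwa [one_mul] at hm⟩
  refine Matrix.diagonal_transvection_induction_of_det_ne_zero
    (fun g => RepMul q x ι St (g.map (resHom hK))) g hg ?_ ?_ ?_
  · intro d hd
    rw [Matrix.det_diagonal] at hd
    rw [Matrix.diagonal_map (map_zero _)]
    exact RepMul.diagonal H E (fun i => d i) _ (fun i => resHom_mem hK (d i)) fun i =>
      (map_ne_zero _).2 fun h => hd (Finset.prod_eq_zero (Finset.mem_univ i) h)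
  · intro t
    have : t.toMatrix.map (resHom hK) = Matrix.transvection t.i t.j (resHom hK t.c) := by
      rw [Matrix.TransvectionStruct.toMatrix, Matrix.transvection, Matrix.transvection,
        Matrix.map_add _ (map_add _), Matrix.map_one _ (map_zero _) (map_one _)]
      congr 1
      ext i j
      simp only [Matrix.map_apply, Matrix.single_apply]
      split_ifs <;> simp
    rw [this]
    have hne : t.i.1 ≠ t.j.1 := fun h => t.hij (Fin.ext h)
    rcases Nat.lt_or_gt_of_ne hne with h | h
    · exact RepMul.transvection hK H E hq1 (t.j.1 - t.i.1 - 1) (Or.inl (by omega)) _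
    · exact RepMul.transvection hK H E hq1 (t.i.1 - t.j.1 - 1) (Or.inr (by omega)) _
  · intro A B _ _ hA hB
    rw [Matrix.map_mul]
    exact hA.mul hB

end

lemma neg_one_pow_invCount {n : ℕ} (σ : Equiv.Perm (Fin n)) :
    (-1 : ℂ) ^ invCount σ = ((Equiv.Perm.sign σ : ℤ) : ℂ) := by
  rw [Equiv.Perm.sign_eq_prod_prod_Ioi, invCount, ← Finset.prod_const, Finset.prod_filter,
    Fintype.prod_prod_type]
  push_cast
  refine Finset.prod_congr rfl fun i _ => ?_
  rw [show Finset.Ioi i = Finset.univ.filter (i < ·) by ext; simp, Finset.prod_filter]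
  refine Finset.prod_congr rfl fun j _ => ?_
  by_cases h : i < j
  · have h1 : σ j < σ i ↔ ¬ σ i < σ j := by
      have : σ i ≠ σ j := fun h' => h.ne (σ.injective h')
      rw [not_lt]
      exact ⟨le_of_lt, fun h2 => lt_of_le_of_ne h2 this.symm⟩
    by_cases h2 : σ i < σ j <;> simp [h, h1, h2]
  · simp [h]

lemma qMinor_one {N : ℕ} (x : Matrix (Fin N) (Fin N) ℂ) (I : Finset (Fin N)) :
    qMinor (1 : ℂ) (fun i j => x i j) I
      = (x.submatrix (Subtype.val : I → Fin N) (Subtype.val : I → Fin N)).det := by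
  rw [← Matrix.det_submatrix_equiv_self (I.orderIsoOfFin rfl).toEquiv, ← Matrix.det_transpose,
    Matrix.det_apply', qMinor]
  refine Finset.sum_congr rfl fun σ _ => ?_
  rw [neg_one_pow_invCount, smul_eq_mul, ← List.ofFn_eq_map, List.prod_ofFn]
  rfl

/-- At `q = 1` the invariants `τ_k` are the coefficients of the characteristic polynomial. -/
lemma tauCoinv_one {N k : ℕ} (x : Matrix (Fin N) (Fin N) ℂ) (hk : k ≤ N) :
    tauCoinv (1 : ℂ) (1 : ℂ)⁻¹ (fun i j => x i j) k = (-1) ^ k * x.charpoly.coeff (N - k) := by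
  have h := Matrix.charpoly_coeff_eq_sum_minors x k (by simpa using hk)
  rw [Fintype.card_fin] at h
  rw [h, ← mul_assoc, ← mul_pow, tauCoinv]
  simp only [qMinor_one]
  rw [show Finset.univ.filter (fun I : Finset (Fin N) => I.card = k)
    = Finset.univ.powersetCard k by ext s; simp [Finset.mem_powersetCard]]
  simp

/-- The rows `v, v x, v x², …`. -/
def krylov {R : Type*} [CommRing R] {N : ℕ} (v : Fin N → R) (x : Matrix (Fin N) (Fin N) R) :
    Matrix (Fin N) (Fin N) R :=
  Matrix.of fun i => Matrix.vecMul v (x ^ (i : ℕ))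

/-- The companion matrix. -/
def compMat {R : Type*} [CommRing R] (N : ℕ) (c : ℕ → R) : Matrix (Fin N) (Fin N) R :=
  Matrix.of fun i j => if i.1 + 1 < N then (if j.1 = i.1 + 1 then 1 else 0) else - c j

lemma krylov_mul {R : Type*} [CommRing R] [Nontrivial R] {N : ℕ} (v : Fin N → R)
    (x : Matrix (Fin N) (Fin N) R) :
    krylov v x * x = compMat N x.charpoly.coeff * krylov v x := by
  have hrow : ∀ i, (krylov v x * x) i = Matrix.vecMul v (x ^ (i.1 + 1)) := by
    intro i
    rw [pow_succ, ← Matrix.vecMul_vecMul]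
    rfl
  funext i
  rw [hrow]
  have hR : (compMat N x.charpoly.coeff * krylov v x) i
      = ∑ j, compMat N x.charpoly.coeff i j • Matrix.vecMul v (x ^ (j : ℕ)) := by
    funext l
    rw [Matrix.mul_apply, Finset.sum_apply]
    rfl
  rw [hR]
  by_cases h : i.1 + 1 < N
  · rw [Finset.sum_eq_single ⟨i.1 + 1, h⟩]
    · simp [compMat, h]
    · intro b _ hb
      have : b.1 ≠ i.1 + 1 := fun h' => hb (Fin.ext h')
      simp [compMat, h, this]
    · simp
  · have hN : i.1 + 1 = N := by have := i.2; omega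
    have hc := Matrix.aeval_self_charpoly x
    rw [Polynomial.aeval_eq_sum_range, Matrix.charpoly_natDegree_eq_dim, Fintype.card_fin,
      Finset.sum_range_succ] at hc
    have hl : x.charpoly.coeff N = 1 := by
      have := Matrix.charpoly_monic x
      rwa [Polynomial.Monic, Polynomial.leadingCoeff, Matrix.charpoly_natDegree_eq_dim,
        Fintype.card_fin] at this
    rw [hl, one_smul] at hc
    rw [hN, ← neg_eq_of_add_eq_zero_right hc, ← Fin.sum_univ_eq_sum_range
      (fun i => x.charpoly.coeff i • x ^ i)]
    simp only [Matrix.vecMul_neg, compMat, Matrix.of_apply, if_neg h, neg_smul,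
      Finset.sum_neg_distrib]
    congr 1
    funext l
    simp only [Matrix.vecMul, dotProduct, Matrix.sum_apply, Finset.sum_apply, Pi.smul_apply,
      Matrix.smul_apply, smul_eq_mul, Finset.mul_sum]
    rw [Finset.sum_comm]
    exact Finset.sum_congr rfl fun _ _ => Finset.sum_congr rfl fun _ _ => by ring

/-- Two matrices with cyclic vectors and equal characteristic polynomials are conjugate. -/
lemma exists_conj_of_krylov {F : Type*} [Field F] {N : ℕ} {v w : Fin N → F}
    {x y : Matrix (Fin N) (Fin N) F} (hx : (krylov v x).det ≠ 0) (hy : (krylov w y).det ≠ 0)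
    (h : x.charpoly = y.charpoly) :
    ∃ g : Matrix (Fin N) (Fin N) F, g.det ≠ 0 ∧ y = g⁻¹ * x * g := by
  have hxu : IsUnit (krylov v x).det := isUnit_iff_ne_zero.2 hx
  have hyu : IsUnit (krylov w y).det := isUnit_iff_ne_zero.2 hy
  refine ⟨(krylov v x)⁻¹ * krylov w y, ?_, ?_⟩
  · rw [Matrix.det_mul, Matrix.det_nonsing_inv]
    exact mul_ne_zero (by simpa using hx) hy
  · have h1 := krylov_mul v x
    have h2 := krylov_mul w y
    rw [← h] at h2
    have h3 : compMat N x.charpoly.coeff = krylov v x * x * (krylov v x)⁻¹ := by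
      rw [h1, mul_assoc, Matrix.mul_nonsing_inv _ hxu, mul_one]
    rw [Matrix.mul_inv_rev, Matrix.nonsing_inv_nonsing_inv _ hxu]
    calc y = (krylov w y)⁻¹ * (krylov w y * y) := by
          rw [← mul_assoc, Matrix.nonsing_inv_mul _ hyu, one_mul]
      _ = _ := by rw [h2, h3]; simp only [mul_assoc]

/-- The matrix with diagonal `a`, superdiagonal `s` and lower left corner `z`. -/
def cycMat {N : ℕ} (a : Fin N → ℂ) (s z : ℂ) : Matrix (Fin N) (Fin N) ℂ :=
  Matrix.of fun i j => if i = j then a i else if j.1 = i.1 + 1 then s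
    else if i.1 + 1 = N ∧ j.1 = 0 then z else 0

lemma det_cycMat {n : ℕ} (a : Fin (n + 2) → ℂ) (s z : ℂ) :
    (cycMat a s z).det = ∏ i, a i + (-1) ^ (n + 1) * z * s ^ (n + 1) := by
  rw [Matrix.det_succ_column_zero, Fin.sum_univ_succ, Finset.sum_eq_single (Fin.last n)]
  · have h1 : ((cycMat a s z).submatrix (Fin.succAbove 0) Fin.succ).det = ∏ i : Fin (n + 1), a i.succ := by
      rw [Matrix.det_of_isUpperTriangular]
      · simp [cycMat]
      · intro i j hij
        have h2 : j.1 < i.1 := hij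
        simp only [Matrix.submatrix_apply, cycMat, Matrix.of_apply, Fin.succAbove_zero, Fin.ext_iff,
          Fin.val_succ]
        rw [if_neg (by omega), if_neg (by omega), if_neg (by omega)]
    have h2 : ((cycMat a s z).submatrix (Fin.succAbove (Fin.last n).succ) Fin.succ).det
        = s ^ (n + 1) := by
      rw [Fin.succ_last, Fin.succAbove_last, Matrix.det_of_isLowerTriangular]
      · simp only [Matrix.submatrix_apply, cycMat, Matrix.of_apply, Fin.ext_iff,
          Fin.val_succ, Fin.val_castSucc]
        rw [Finset.prod_congr rfl fun i _ => by rw [if_neg (by omega), if_pos trivial],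
          Finset.prod_const, Finset.card_univ, Fintype.card_fin]
      · intro i j hij
        have h2 : i.1 < j.1 := hij
        have h3 := i.2
        simp only [Matrix.submatrix_apply, cycMat, Matrix.of_apply, Fin.ext_iff,
          Fin.val_succ, Fin.val_castSucc]
        rw [if_neg (by omega), if_neg (by omega), if_neg (by omega)]
    have h3 : cycMat a s z (Fin.last n).succ 0 = z := by
      simp only [cycMat, Matrix.of_apply, Fin.ext_iff, Fin.val_succ, Fin.val_zero, Fin.val_last]
      rw [if_neg (by omega), if_neg (by omega), if_pos ⟨trivial, trivial⟩]
    have h4 : cycMat a s z 0 0 = a 0 := by simp [cycMat]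
    rw [h1, h2, h3, h4, Fin.prod_univ_succ a]
    simp
  · intro i _ hi
    have : i.1 ≠ n := fun h => hi (Fin.ext h)
    have h3 : cycMat a s z i.succ 0 = 0 := by
      simp only [cycMat, Matrix.of_apply, Fin.ext_iff, Fin.val_succ, Fin.val_zero]
      rw [if_neg (by omega), if_neg (by omega), if_neg (by omega)]
    rw [h3]; simp
  · simp

lemma eval_charpoly_cycMat {N : ℕ} (hN : 2 ≤ N) (a : Fin N → ℂ) (z t : ℂ) :
    (cycMat a 1 z).charpoly.eval t = ∏ i, (t - a i) - z := by
  obtain ⟨n, rfl⟩ := Nat.exists_eq_add_of_le' hN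
  have : Matrix.scalar (Fin (n + 2)) t - cycMat a 1 z = cycMat (fun i => t - a i) (-1) (-z) := by
    ext i j
    simp only [Matrix.sub_apply, Matrix.scalar_apply, Matrix.diagonal_apply, cycMat, Matrix.of_apply]
    split_ifs <;> simp
  rw [Matrix.eval_charpoly, this, det_cycMat]
  have h1 : ((-1 : ℂ) ^ (n + 1)) * (-1) ^ (n + 1) = 1 := by rw [← mul_pow]; simp
  linear_combination (-z) * h1

lemma krylov_cycMat {N : ℕ} (hN : 0 < N) (a : Fin N → ℂ) (z : ℂ) :
    (krylov (Pi.single ⟨0, hN⟩ 1) (cycMat a 1 z)).det = 1 := by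
  have key : ∀ i (hi : i < N), (∀ j : Fin N, i < j.1 →
      Matrix.vecMul (Pi.single ⟨0, hN⟩ 1) (cycMat a 1 z ^ i) j = 0) ∧
      Matrix.vecMul (Pi.single ⟨0, hN⟩ 1) (cycMat a 1 z ^ i) ⟨i, hi⟩ = 1 := by
    intro i
    induction i with
    | zero =>
      intro hi
      refine ⟨fun j hj => ?_, by simp⟩
      rw [pow_zero, Matrix.vecMul_one, Pi.single_eq_of_ne]
      exact fun h => by rw [h] at hj; simp at hj
    | succ i ih =>
      intro hi
      obtain ⟨h1, h2⟩ := ih (by omega)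
      have hz : ∀ l j : Fin N, i + 1 ≤ j.1 → l.1 ≠ i ∨ i + 1 < j.1 →
          Matrix.vecMul (Pi.single ⟨0, hN⟩ 1) (cycMat a 1 z ^ i) l * cycMat a 1 z l j = 0 := by
        intro l j hj hl
        rcases lt_or_ge i l.1 with h | h
        · rw [h1 l h, zero_mul]
        · have : cycMat a 1 z l j = 0 := by
            simp only [cycMat, Matrix.of_apply, Fin.ext_iff]
            rw [if_neg (by omega), if_neg (by omega), if_neg (by omega)]
          rw [this, mul_zero]
      refine ⟨fun j hj => ?_, ?_⟩
      · rw [pow_succ, ← Matrix.vecMul_vecMul]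
        exact (Finset.sum_eq_zero fun l _ => hz l j hj.le (Or.inr hj) :
          ∑ l, Matrix.vecMul (Pi.single ⟨0, hN⟩ 1) (cycMat a 1 z ^ i) l * cycMat a 1 z l j = 0)
      · rw [pow_succ, ← Matrix.vecMul_vecMul]
        refine (Finset.sum_eq_single (⟨i, by omega⟩ : Fin N) (fun l _ hl => ?_)
          (fun h => absurd (Finset.mem_univ _) h)).trans ?_
        · exact hz l _ le_rfl (Or.inl fun h => hl (Fin.ext h))
        · rw [h2, one_mul]
          simp [cycMat, Fin.ext_iff]
  rw [Matrix.det_of_isLowerTriangular]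
  · exact Finset.prod_eq_one fun i _ => (key i.1 i.2).2
  · intro i j hij
    exact (key i.1 i.2).1 j hij

/-- Perturbing a polynomial by a constant makes it split with distinct roots. -/
lemma exists_add_const_splits {N : ℕ} (hN : 1 ≤ N) (p : Polynomial ℂ) (hp : p.Monic)
    (hd : p.natDegree = N) :
    ∃ (z : ℂ) (d : Fin N → ℂ), Function.Injective d ∧
      p = ∏ i, (Polynomial.X - Polynomial.C (d i)) - Polynomial.C z := by
  classical
  have hder : Polynomial.derivative p ≠ 0 := by
    intro h
    have := Polynomial.derivative_eq_zero.1 h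
    omega
  obtain ⟨z, hz⟩ := Infinite.exists_notMem_finset
    ((Polynomial.derivative p).roots.toFinset.image fun r => - p.eval r)
  set P := p + Polynomial.C z with hP
  have hdeg : (Polynomial.C z).degree < p.degree := by
    refine Polynomial.degree_C_le.trans_lt ?_
    rw [Polynomial.degree_eq_natDegree hp.ne_zero, hd]
    exact_mod_cast hN
  have hPm : P.Monic := hp.add_of_left hdeg
  have hPd : P.natDegree = N := by
    rw [hP, Polynomial.natDegree_add_C, hd]
  have hsep : P.Separable := by
    rw [Polynomial.separable_def]
    refine (Polynomial.isCoprime_iff_aeval_ne_zero_of_isAlgClosed ℂ ℂ _ _).2 fun r => ?_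
    by_contra! h
    refine hz (Finset.mem_image.2 ⟨r, ?_, ?_⟩)
    · rw [Multiset.mem_toFinset, Polynomial.mem_roots hder]
      have := h.2
      rw [hP, Polynomial.derivative_add, Polynomial.derivative_C, add_zero] at this
      simpa using this
    · have := h.1
      simp only [hP, map_add, Polynomial.coe_aeval_eq_eval, Polynomial.eval_C] at this
      linear_combination (-1 : ℂ) * this
  have hsplit := IsAlgClosed.splits P
  have hcard : P.roots.toFinset.card = N := by
    rw [Multiset.toFinset_card_of_nodup (Polynomial.nodup_roots hsep),
      ← hsplit.natDegree_eq_card_roots, hPd]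
  let e := (P.roots.toFinset.equivFinOfCardEq hcard).symm
  refine ⟨z, fun i => (e i).1, fun i j h => e.injective (Subtype.ext h), ?_⟩
  have h1 : P = (P.roots.map fun a => Polynomial.X - Polynomial.C a).prod := by
    have := hsplit.eq_prod_roots
    rwa [hPm.leadingCoeff, Polynomial.C_1, one_mul] at this
  have h2 : (P.roots.map fun a => Polynomial.X - Polynomial.C a).prod
      = ∏ a ∈ P.roots.toFinset, (Polynomial.X - Polynomial.C a) := by
    rw [Finset.prod, Multiset.toFinset_val, (Polynomial.nodup_roots hsep).dedup]
  rw [eq_sub_iff_add_eq, ← hP]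
  refine h1.trans (h2.trans ?_)
  rw [← Finset.prod_coe_sort]
  exact (Equiv.prod_comp e fun a => (Polynomial.X - Polynomial.C a.1)).symm

/-- The off-diagonal entries of a matrix, together with the values of its characteristic
polynomial at the points `d`. -/
def charMap {N : ℕ} (d : Fin N → ℂ) (v : Fin N × Fin N → ℂ) (p : Fin N × Fin N) : ℂ :=
  if p.1 = p.2 then (Matrix.of fun i j => v (i, j)).charpoly.eval (d p.1) else v p

lemma contDiff_charMap {N : ℕ} (d : Fin N → ℂ) : ContDiff ℂ 1 (charMap d) := by
  refine contDiff_pi.2 fun p => ?_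
  unfold charMap
  split_ifs
  · simp only [Matrix.eval_charpoly, Matrix.det_apply', Matrix.sub_apply, Matrix.of_apply]
    refine ContDiff.sum fun σ _ => ContDiff.mul contDiff_const (contDiff_prod fun i _ => ?_)
    exact ContDiff.sub contDiff_const (contDiff_apply ℂ ℂ _)
  · exact contDiff_apply ℂ ℂ p

/-- The vector of entries of `cycMat`. -/
def cycVec {N : ℕ} (a : Fin N → ℂ) (z : ℂ) (p : Fin N × Fin N) : ℂ := cycMat a 1 z p.1 p.2

lemma charMap_cycVec {N : ℕ} (hN : 2 ≤ N) (d a : Fin N → ℂ) (z : ℂ) (p : Fin N × Fin N) :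
    charMap d (cycVec a z) p = if p.1 = p.2 then ∏ i, (d p.1 - a i) - z else cycVec 0 z p := by
  unfold charMap
  split_ifs with h
  · exact eval_charpoly_cycMat hN a z _
  · simp [cycVec, cycMat, h]

lemma map_nhds_charMap {N : ℕ} (hN : 2 ≤ N) {d : Fin N → ℂ} (hd : Function.Injective d) (z : ℂ)
    (σ : Equiv.Perm (Fin N)) :
    Filter.map (charMap d) (nhds (cycVec (d ∘ σ) z)) = nhds (charMap d (cycVec (d ∘ σ) z)) := by
  classical
  set v := cycVec (d ∘ σ) z with hv
  have hs := (contDiff_charMap d).contDiffAt.hasStrictFDerivAt (x := v) one_ne_zero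
  refine hs.map_nhds_eq_of_surj ?_
  set L := fderiv ℂ (charMap d) v with hL
  have hF := hs.hasFDerivAt
  have hoff : ∀ (p : Fin N × Fin N) u, p.1 ≠ p.2 → L u p = u p := by
    intro p u hp
    have h1 := hasFDerivAt_pi'.1 hF p
    have h2 : (fun v : Fin N × Fin N → ℂ => charMap d v p)
        = ⇑(ContinuousLinearMap.proj (R := ℂ) (φ := fun _ : Fin N × Fin N => ℂ) p) := by
      funext v
      simp [charMap, hp]
    rw [h2] at h1
    have h3 := h1.unique (ContinuousLinearMap.hasFDerivAt _)
    exact congrArg (fun l : (Fin N × Fin N → ℂ) →L[ℂ] ℂ => l u) h3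
  have hdiag : ∀ l, L (Pi.single (l, l) 1)
      = (-∏ i ∈ Finset.univ.erase l, (d (σ l) - d (σ i))) • Pi.single (σ l, σ l) 1 := by
    intro l
    have hline : ∀ t : ℂ, charMap d (v + t • Pi.single (l, l) 1) = charMap d v +
        t • ((-∏ i ∈ Finset.univ.erase l, (d (σ l) - d (σ i))) •
          (Pi.single (σ l, σ l) 1 : Fin N × Fin N → ℂ)) := by
      intro t
      have h1 : v + t • Pi.single (l, l) 1 = cycVec (Function.update (d ∘ σ) l (d (σ l) + t)) z := by
        funext p
        obtain ⟨i, j⟩ := p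
        simp only [hv, cycVec, cycMat, Matrix.of_apply, Pi.add_apply, Pi.smul_apply, smul_eq_mul,
          Pi.single_apply, Prod.mk.injEq, Function.update_apply, Function.comp_apply]
        by_cases h : i = j
        · subst h
          by_cases h' : i = l <;> simp [h']
        · have : ¬ (i = l ∧ j = l) := fun h' => h (h'.1.trans h'.2.symm)
          simp [h, this]
      funext p
      rw [h1, Pi.add_apply, hv, charMap_cycVec hN, charMap_cycVec hN]
      obtain ⟨k, j⟩ := p
      simp only [Pi.smul_apply, Pi.single_apply, Prod.mk.injEq, smul_eq_mul]
      by_cases h : k = j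
      · subst h
        simp only [if_true, and_self]
        rw [← Finset.mul_prod_erase _ _ (Finset.mem_univ l),
          ← Finset.mul_prod_erase (a := l) _ (fun i => d k - (d ∘ σ) i) (Finset.mem_univ l)]
        have h2 : ∏ i ∈ Finset.univ.erase l, (d k - Function.update (d ∘ σ) l (d (σ l) + t) i)
            = ∏ i ∈ Finset.univ.erase l, (d k - (d ∘ σ) i) := by
          refine Finset.prod_congr rfl fun i hi => ?_
          rw [Function.update_of_ne (Finset.ne_of_mem_erase hi)]
        rw [h2, Function.update_self]
        by_cases h3 : k = σ l
        · subst h3; simp only [Function.comp_apply, if_true]; ring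
        · have h4 : ∏ i ∈ Finset.univ.erase l, (d k - (d ∘ σ) i) = 0 := by
            refine Finset.prod_eq_zero (i := σ⁻¹ k) (Finset.mem_erase.2 ⟨?_, Finset.mem_univ _⟩) ?_
            · rintro rfl
              simp at h3
            · simp
          rw [h4]; simp [h3]
      · have : ¬ (k = σ l ∧ j = σ l) := fun h' => h (h'.1.trans h'.2.symm)
        simp [h, this]
    have h1 := hF.hasLineDerivAt (Pi.single (l, l) 1)
    have h2 : HasDerivAt (fun t : ℂ => charMap d (v + t • Pi.single (l, l) 1)) _ 0 := h1
    refine h2.unique ?_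
    simp only [hline]
    have h3 := (hasDerivAt_id (0 : ℂ)).smul_const
      ((-∏ i ∈ Finset.univ.erase l, (d (σ l) - d (σ i))) •
          (Pi.single (σ l, σ l) 1 : Fin N × Fin N → ℂ))
    rw [one_smul] at h3
    exact h3.const_add _
  have hd1 : ∀ k, (Pi.single (k, k) 1 : Fin N × Fin N → ℂ) ∈ LinearMap.range L.toLinearMap := by
    intro k
    have hc : (-∏ i ∈ Finset.univ.erase (σ⁻¹ k), (d (σ (σ⁻¹ k)) - d (σ i))) ≠ 0 := by
      refine neg_ne_zero.2 (Finset.prod_ne_zero_iff.2 fun i hi => sub_ne_zero.2 fun h => ?_)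
      exact Finset.ne_of_mem_erase hi (σ.injective (hd h)).symm
    have h1 := hdiag (σ⁻¹ k)
    refine (Submodule.smul_mem_iff _ hc).1 ⟨Pi.single (σ⁻¹ k, σ⁻¹ k) 1, ?_⟩
    refine h1.trans ?_
    simp
  rw [eq_top_iff]
  rintro w -
  have hw : w = L w + ∑ k, (w - L w) (k, k) • (Pi.single (k, k) 1 : Fin N × Fin N → ℂ) := by
    funext p
    obtain ⟨i, j⟩ := p
    rw [Pi.add_apply, Finset.sum_apply]
    simp only [Pi.smul_apply, Pi.single_apply, Prod.mk.injEq, smul_eq_mul, Pi.sub_apply]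
    by_cases h : i = j
    · subst h
      simp
    · rw [hoff _ _ h, Finset.sum_eq_zero, add_zero]
      intro k _
      rw [if_neg, mul_zero]
      exact fun h' => h (h'.1.trans h'.2.symm)
  rw [hw]
  exact Submodule.add_mem _ ⟨w, rfl⟩ (Submodule.sum_mem _ fun k _ => Submodule.smul_mem _ _ (hd1 k))

/-- Near a suitable point there are `N!` matrices with given off-diagonal part and given
characteristic polynomial. -/
lemma exists_charpoly_solutions {N : ℕ} (hN : 2 ≤ N) (χ : Polynomial ℂ) (hχ : χ.Monic)
    (hd : χ.natDegree = N) :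
    ∃ (y : Fin N × Fin N → ℂ) (ε : ℝ), 0 < ε ∧ (∀ i, y (i, i) = 0) ∧
      ∀ w : Fin N × Fin N → ℂ, (∀ i, w (i, i) = 0) → dist w y < ε →
      ∃ Z : Equiv.Perm (Fin N) → Matrix (Fin N) (Fin N) ℂ, Function.Injective Z ∧
        ∀ σ, (∀ i j, i ≠ j → Z σ i j = w (i, j)) ∧ (Z σ).charpoly = χ ∧
          ∃ u, (krylov u (Z σ)).det ≠ 0 := by
  classical
  obtain ⟨z, d, hdi, hχd⟩ := exists_add_const_splits (by omega) χ hχ hd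
  have hval : ∀ k, χ.eval (d k) = - z := by
    intro k
    rw [hχd, Polynomial.eval_sub, Polynomial.eval_prod, Polynomial.eval_C,
      Finset.prod_eq_zero (Finset.mem_univ k) (by simp), zero_sub]
  let y' : Fin N × Fin N → ℂ := fun p => if p.1 = p.2 then -z else cycVec 0 z p
  have hy' : ∀ σ : Equiv.Perm (Fin N), charMap d (cycVec (d ∘ σ) z) = y' := by
    intro σ
    funext p
    rw [charMap_cycVec hN]
    simp only [y']
    split_ifs
    · rw [Finset.prod_eq_zero (Finset.mem_univ (σ⁻¹ p.1)) (by simp), zero_sub]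
    · rfl
  let v : Equiv.Perm (Fin N) → Fin N × Fin N → ℂ := fun σ => cycVec (d ∘ σ) z
  have hvi : Function.Injective v := by
    intro σ τ h
    ext1 i
    have := congrFun h (i, i)
    simp only [v, cycVec, cycMat, Matrix.of_apply, if_true] at this
    exact hdi this
  obtain ⟨U, hU, hdisj⟩ := (Set.finite_range v).t2_separation
  let u : Fin N → ℂ := Pi.single ⟨0, by omega⟩ 1
  let S : Equiv.Perm (Fin N) → Set (Fin N × Fin N → ℂ) := fun σ =>
    U (v σ) ∩ {w | (krylov u (Matrix.of fun i j => w (i, j))).det ≠ 0}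
  have hcont : Continuous fun w : Fin N × Fin N → ℂ =>
      (krylov u (Matrix.of fun i j => w (i, j))).det := by
    have h1 : Continuous fun w : Fin N × Fin N → ℂ => (Matrix.of fun i j => w (i, j) :
        Matrix (Fin N) (Fin N) ℂ) := continuous_matrix fun i j => continuous_apply (i, j)
    refine Continuous.matrix_det (continuous_matrix fun i j => ?_)
    have h2 : Continuous fun w : Fin N × Fin N → ℂ =>
        Matrix.vecMul u ((Matrix.of fun i j => w (i, j) : Matrix (Fin N) (Fin N) ℂ) ^ (i : ℕ)) :=
      Continuous.matrix_vecMul continuous_const (h1.pow _)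
    exact (continuous_apply j).comp h2
  have hS : ∀ σ, S σ ∈ nhds (v σ) := by
    intro σ
    refine Filter.inter_mem ((hU (v σ)).2.mem_nhds (hU (v σ)).1) ?_
    refine (isOpen_ne.preimage hcont).mem_nhds ?_
    have h1 : (Matrix.of fun i j => v σ (i, j) : Matrix (Fin N) (Fin N) ℂ) = cycMat (d ∘ σ) 1 z := rfl
    rw [Set.mem_preimage, h1, krylov_cycMat]
    exact one_ne_zero
  have hmem : (⋂ σ, charMap d '' S σ) ∈ nhds y' := by
    refine Filter.iInter_mem.2 fun σ => ?_
    rw [← hy' σ, ← map_nhds_charMap hN hdi z σ]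
    exact Filter.image_mem_map (hS σ)
  obtain ⟨ε, hε, hball⟩ := Metric.mem_nhds_iff.1 hmem
  refine ⟨fun p => if p.1 = p.2 then 0 else cycVec 0 z p, ε, hε, fun i => by simp, fun w hw hdist => ?_⟩
  let w' : Fin N × Fin N → ℂ := fun p => if p.1 = p.2 then -z else w p
  have hw' : w' ∈ Metric.ball y' ε := by
    refine lt_of_le_of_lt ((dist_pi_le_iff dist_nonneg).2 fun p => ?_) hdist
    refine le_trans ?_ (dist_le_pi_dist _ _ p)
    simp only [w', y']
    split_ifs with h
    · simp
    · exact le_rfl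
  have h1 := fun σ => Set.mem_iInter.1 (hball hw') σ
  choose Z hZ hZw using h1
  refine ⟨fun σ => Matrix.of fun i j => Z σ (i, j), ?_, fun σ => ⟨?_, ?_, ⟨u, (hZ σ).2⟩⟩⟩
  · intro σ τ h
    have h2 : Z σ = Z τ := by
      funext p
      exact congrArg (fun m : Matrix (Fin N) (Fin N) ℂ => m p.1 p.2) h
    by_contra hne
    have h3 := hdisj (Set.mem_range_self σ) (Set.mem_range_self τ) fun h' => hne (hvi h')
    exact Set.disjoint_left.1 h3 (hZ σ).1 (h2 ▸ (hZ τ).1)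
  · intro i j hij
    have := congrFun (hZw σ) (i, j)
    simp only [charMap, w', if_neg hij] at this
    exact this
  · set X : Matrix (Fin N) (Fin N) ℂ := Matrix.of fun i j => Z σ (i, j)
    refine Polynomial.eq_of_degree_sub_lt_of_eval_index_eq (s := Finset.univ) (v := d)
      hdi.injOn ?_ fun k _ => ?_
    · have h4 : X.charpoly.degree = χ.degree := by
        rw [Matrix.charpoly_degree_eq_dim, Fintype.card_fin,
          Polynomial.degree_eq_natDegree hχ.ne_zero, hd]
      refine (Polynomial.degree_sub_lt_left h4 (Matrix.charpoly_monic X).ne_zero ?_).trans_eq ?_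
      · rw [(Matrix.charpoly_monic X).leadingCoeff, hχ.leadingCoeff]
      · rw [Matrix.charpoly_degree_eq_dim, Finset.card_univ]
    · rw [hval]
      have := congrFun (hZw σ) (k, k)
      simp only [charMap, w', if_true] at this
      exact this

lemma map_tauCoinv {M B : Type} [Ring M] [Algebra ℂ M] [Ring B] [Algebra ℂ B] {N : ℕ} (q r : ℂ)
    (x : Fin N → Fin N → M) (φ : M →ₐ[ℂ] B) (k : ℕ) :
    φ (tauCoinv q r x k) = tauCoinv q r (fun i j => φ (x i j)) k := by
  simp only [tauCoinv, qMinor, map_sum, map_smul, map_list_prod, List.map_map]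
  rfl

lemma listProd_toMultiset {M : Type} [CommMonoid M] {N : ℕ} (x : Fin N → Fin N → M)
    (m : Fin N × Fin N →₀ ℕ) :
    listProd x (Finsupp.toMultiset m).toList = ∏ p, x p.1 p.2 ^ m p := by
  rw [listProd, ← Multiset.prod_coe, ← Multiset.map_coe, Multiset.coe_toList,
    ← Finsupp.prod_fintype m (fun p n => x p.1 p.2 ^ n) (fun _ => pow_zero _)]
  induction m using Finsupp.induction with
  | zero => simp
  | single_add a b f ha hb ih =>
    rw [map_add, Multiset.map_add, Multiset.prod_add, ih,
      Finsupp.prod_add_index' (fun _ => pow_zero _) (fun _ _ _ => pow_add _ _ _),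
      Finsupp.toMultiset_single, Finsupp.prod_single_index
        (h := fun (p : Fin N × Fin N) n => x p.1 p.2 ^ n) (pow_zero _), Multiset.map_nsmul,
      Multiset.prod_nsmul, Multiset.map_singleton, Multiset.prod_singleton]

lemma mem_span_listProd {M : Type} [Ring M] [Algebra ℂ M] {N : ℕ} (x : Fin N → Fin N → M)
    (h : Algebra.adjoin ℂ (Set.range fun p : Fin N × Fin N => x p.1 p.2) = ⊤) (y : M) :
    y ∈ Submodule.span ℂ (Set.range (listProd x)) := by
  have hy : y ∈ Subalgebra.toSubmodule (Algebra.adjoin ℂ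
    (Set.range fun p : Fin N × Fin N => x p.1 p.2)) := by rw [h]; trivial
  rw [Algebra.adjoin_eq_span] at hy
  refine Submodule.span_mono ?_ hy
  intro z hz
  induction hz using Submonoid.closure_induction with
  | mem z hz => obtain ⟨p, rfl⟩ := hz; exact ⟨[p], by simp [listProd]⟩
  | one => exact ⟨[], rfl⟩
  | mul a b _ _ ha hb =>
    obtain ⟨l, rfl⟩ := ha
    obtain ⟨l', rfl⟩ := hb
    exact ⟨l ++ l', by simp [listProd]⟩

/-- Functions separating the points of a finite set generate the algebra of functions. -/
lemma adjoin_eq_top_of_separates {P T : Type} [Fintype P] [DecidableEq P] (X : T → P → ℂ)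
    (h : ∀ σ τ : P, σ ≠ τ → ∃ t, X t σ ≠ X t τ) : Algebra.adjoin ℂ (Set.range X) = ⊤ := by
  rw [eq_top_iff]
  have hind : ∀ σ, (Pi.single σ 1 : P → ℂ) ∈ Algebra.adjoin ℂ (Set.range X) := by
    intro σ
    have h' : ∀ τ, ∃ u ∈ Algebra.adjoin ℂ (Set.range X), σ ≠ τ → u σ ≠ u τ := by
      intro τ
      by_cases hτ : σ = τ
      · exact ⟨1, Subalgebra.one_mem _, fun h => absurd hτ h⟩
      · obtain ⟨t, ht⟩ := h σ τ hτ
        exact ⟨X t, Algebra.subset_adjoin ⟨t, rfl⟩, fun _ => ht⟩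
    choose u hu ht using h'
    have : (Pi.single σ 1 : P → ℂ) = ∏ τ ∈ Finset.univ.erase σ, (u τ σ - u τ τ)⁻¹ •
        (u τ - algebraMap ℂ (P → ℂ) (u τ τ)) := by
      ext ρ
      rw [Finset.prod_apply]
      by_cases hρ : ρ = σ
      · subst hρ
        rw [Pi.single_eq_same, eq_comm]
        refine Finset.prod_eq_one fun τ hτ => ?_
        have := ht τ (Finset.ne_of_mem_erase hτ).symm
        simp [sub_ne_zero.2 this]
      · rw [Pi.single_eq_of_ne hρ, eq_comm]
        refine Finset.prod_eq_zero (Finset.mem_erase.2 ⟨hρ, Finset.mem_univ _⟩) ?_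
        simp
    rw [this]
    refine Subalgebra.prod_mem _ fun τ _ => Subalgebra.smul_mem _ (Subalgebra.sub_mem _ ?_ ?_) _
    · exact hu τ
    · exact Subalgebra.algebraMap_mem _ _
  intro y _
  rw [show y = ∑ σ, y σ • (Pi.single σ 1 : P → ℂ) by
    ext ρ; simp [Finset.sum_apply, Pi.single_apply]]
  exact Subalgebra.sum_mem _ fun σ _ => Subalgebra.smul_mem _ (hind σ) _

lemma isQMat_one_of_comm {M : Type} [CommRing M] [Algebra ℂ M] {N : ℕ} (x : Fin N → Fin N → M) :
    IsQMat (1 : ℂ) x := by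
  constructor
  · intros; simp [mul_comm]
  · intros; simp [mul_comm]
  · intros; simp [mul_comm]
  · intros; simp [mul_comm]

/-- The staircase monomials in the diagonal entries are linearly independent on a full fibre
of the characteristic polynomial map with prescribed off-diagonal entries. -/
lemma linearIndependent_staircase {N : ℕ} {χ : Polynomial ℂ}
    (Z : Equiv.Perm (Fin N) → Matrix (Fin N) (Fin N) ℂ)
    (hZ : Function.Injective Z) (w : Fin N × Fin N → ℂ)
    (hw : ∀ σ i j, i ≠ j → Z σ i j = w (i, j)) (hχ : ∀ σ, (Z σ).charpoly = χ) :
    LinearIndependent ℂ (fun (a : (i : Fin N) → Fin (i.1 + 1)) (σ : Equiv.Perm (Fin N)) =>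
      ∏ i, Z σ i i ^ (a i).1) := by
  classical
  set v := (fun (a : (i : Fin N) → Fin (i.1 + 1)) (σ : Equiv.Perm (Fin N)) =>
      ∏ i, Z σ i i ^ (a i).1) with hv
  refine linearIndependent_of_top_le_span_of_card_eq_finrank ?_ ?_
  swap
  · rw [Module.finrank_fintype_fun_eq_card, Fintype.card_perm, Fintype.card_pi, Fintype.card_fin]
    simp only [Fintype.card_fin]
    rw [Fin.prod_univ_eq_prod_range (fun i => i + 1), Finset.prod_range_add_one_eq_factorial]
  set X : Fin N → Fin N → Equiv.Perm (Fin N) → ℂ := fun i j σ => Z σ i j with hX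
  have hadj : Algebra.adjoin ℂ (Set.range fun p : Fin N × Fin N => X p.1 p.2) = ⊤ := by
    refine adjoin_eq_top_of_separates _ fun σ τ hst => ?_
    by_contra! hc
    exact hst (hZ (Matrix.ext fun i j => hc (i, j)))
  intro y _
  refine Submodule.span_le.2 ?_ (mem_span_listProd X hadj y)
  rintro _ ⟨l, rfl⟩
  have hs := (isQMat_one_of_comm X).straighten one_ne_zero
    (fun i => (-1) ^ (i.1 + 1) * χ.coeff (N - (i.1 + 1))) l
  refine (sup_le ?_ ?_ : _ ≤ Submodule.span ℂ (Set.range v)) hs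
  · rw [Submodule.span_le]
    rintro _ ⟨i, h, rfl⟩
    have : tauCoinv (1 : ℂ) (1 : ℂ)⁻¹ X (i.1 + 1) - algebraMap ℂ (Equiv.Perm (Fin N) → ℂ)
        ((-1) ^ (i.1 + 1) * χ.coeff (N - (i.1 + 1))) = 0 := by
      ext σ
      have h1 := map_tauCoinv 1 1⁻¹ X (Pi.evalAlgHom ℂ (fun _ : Equiv.Perm (Fin N) => ℂ) σ)
        (i.1 + 1)
      have h2 := tauCoinv_one (Z σ) (Nat.succ_le_iff.2 i.2)
      rw [hχ] at h2
      simp only [Pi.evalAlgHom_apply] at h1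
      simp only [Pi.sub_apply, Pi.zero_apply, Pi.algebraMap_apply, Algebra.algebraMap_self,
        RingHom.id_apply]
      rw [h1, sub_eq_zero]
      exact h2
    rw [this, zero_mul]
    exact Submodule.zero_mem _
  · rw [Submodule.span_le]
    rintro _ ⟨m, hm, rfl⟩
    have : listProd X (Finsupp.toMultiset m).toList
        = (∏ p : Fin N × Fin N, if p.1 = p.2 then 1 else w p ^ m p) •
          v (fun i => ⟨m (i, i), Nat.lt_succ_of_le (hm i)⟩) := by
      ext σ
      rw [listProd_toMultiset, Finset.prod_apply, Pi.smul_apply, smul_eq_mul, hv]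
      have : ∏ i, Z σ i i ^ m (i, i)
          = ∏ p : Fin N × Fin N, if p.1 = p.2 then Z σ p.1 p.2 ^ m p else 1 := by
        rw [Fintype.prod_prod_type]
        simp
      simp only [this, ← Finset.prod_mul_distrib]
      refine Finset.prod_congr rfl fun p _ => ?_
      obtain ⟨i, j⟩ := p
      by_cases hij : i = j
      · simp [hij, hX]
      · simp [hij, hX, hw σ i j hij]
    rw [this]
    exact Submodule.smul_mem _ _ (Submodule.subset_span ⟨_, rfl⟩)

lemma eq_zero_of_vanish_on_orbit {N : ℕ} (hN : 2 ≤ N) {ξ : Matrix (Fin N) (Fin N) ℂ}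
    {v : Fin N → ℂ} (hv : (krylov v ξ).det ≠ 0) (s : Finset (Fin N × Fin N →₀ ℕ))
    (hs : ∀ m ∈ s, ∀ i, m (i, i) ≤ i.1) (c : (Fin N × Fin N →₀ ℕ) → ℂ)
    (h : ∀ g : Matrix (Fin N) (Fin N) ℂ, g.det ≠ 0 →
      ∑ m ∈ s, c m * ∏ p : Fin N × Fin N, (g⁻¹ * ξ * g) p.1 p.2 ^ m p = 0) :
    ∀ m ∈ s, c m = 0 := by
  classical
  obtain ⟨y, ε, hε, hy, hsol⟩ := exists_charpoly_solutions hN ξ.charpoly ξ.charpoly_monic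
    (by simp [Matrix.charpoly_natDegree_eq_dim])
  set dg : (Fin N × Fin N →₀ ℕ) → (i : Fin N) → Fin (i.1 + 1) :=
    fun m i => ⟨min (m (i, i)) i.1, by omega⟩ with hdg
  set off : (Fin N × Fin N →₀ ℕ) → (Fin N × Fin N →₀ ℕ) :=
    fun m => m.filter (fun p => p.1 ≠ p.2) with hoff
  have hev : ∀ (w : Fin N × Fin N → ℂ) m, (off m).prod (fun p k => w p ^ k)
      = ∏ p : Fin N × Fin N, if p.1 = p.2 then 1 else w p ^ m p := by
    intro w m
    rw [Finsupp.prod_fintype _ _ (fun _ => pow_zero _)]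
    refine Finset.prod_congr rfl fun p _ => ?_
    by_cases hp : p.1 = p.2 <;> simp [hoff, hp]
  have key : ∀ a, (∑ m ∈ s.filter (fun m => dg m = a), MvPolynomial.monomial (off m) (c m)) = 0 := by
    intro a
    refine MvPolynomial.funext_set (fun p => Metric.ball (y p) ε) (fun p => ?_) fun w' hw' => ?_
    · exact Set.Infinite.mono (fun _ h => h) (infinite_of_mem_nhds _ (Metric.ball_mem_nhds _ hε))
    set w : Fin N × Fin N → ℂ := fun p => if p.1 = p.2 then 0 else w' p with hw
    have hwd : dist w y < ε := by
      rw [dist_pi_lt_iff hε]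
      intro p
      by_cases hp : p.1 = p.2
      · obtain ⟨i, j⟩ := p
        simp only at hp
        subst hp
        simpa [hw, hy] using hε
      · simpa [hw, hp] using hw' p (Set.mem_univ _)
    obtain ⟨Z, hZi, hZ⟩ := hsol w (fun i => by simp [hw]) hwd
    have hli := linearIndependent_staircase Z hZi w (fun σ => (hZ σ).1) (fun σ => (hZ σ).2.1)
    rw [Fintype.linearIndependent_iff] at hli
    have h0 := hli (fun a => ∑ m ∈ s.filter (fun m => dg m = a),
      c m * (off m).prod (fun p k => w p ^ k)) ?_ a
    · rw [map_zero, map_sum, ← h0]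
      refine Finset.sum_congr rfl fun m _ => ?_
      rw [MvPolynomial.eval_monomial, hev, hev]
      congr 1
      refine Finset.prod_congr rfl fun p _ => ?_
      by_cases hp : p.1 = p.2 <;> simp [hw, hp]
    · ext σ
      obtain ⟨h1, h2, u, hu⟩ := hZ σ
      obtain ⟨g, hg, hZg⟩ := exists_conj_of_krylov hv hu h2.symm
      have h3 := h g hg
      rw [← hZg] at h3
      rw [Finset.sum_apply, Pi.zero_apply, ← h3]
      simp only [Pi.smul_apply, smul_eq_mul, Finset.sum_mul]
      rw [Finset.sum_sigma', ← Finset.sum_fiberwise s dg, Finset.sum_sigma']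
      refine Finset.sum_congr rfl ?_
      rintro ⟨b, m⟩ hm
      simp only [Finset.mem_sigma, Finset.mem_univ, true_and, Finset.mem_filter] at hm
      obtain ⟨hm, rfl⟩ := hm
      simp only
      rw [hev, mul_assoc]
      congr 1
      have : ∏ i, Z σ i i ^ (dg m i).1
          = ∏ p : Fin N × Fin N, if p.1 = p.2 then Z σ p.1 p.2 ^ m p else 1 := by
        rw [Fintype.prod_prod_type]
        refine Finset.prod_congr rfl fun i _ => ?_
        rw [Finset.prod_eq_single i]
        · simp [hdg, min_eq_left (hs m hm i)]
        · intro j _ hj; simp [hj.symm]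
        · simp
      rw [this, ← Finset.prod_mul_distrib]
      refine Finset.prod_congr rfl fun p _ => ?_
      obtain ⟨i, j⟩ := p
      by_cases hij : i = j
      · simp [hij]
      · simp [hij, h1 i j hij]
  intro m hm
  have h1 := congrArg (MvPolynomial.coeff (off m)) (key (dg m))
  rw [MvPolynomial.coeff_sum, MvPolynomial.coeff_zero, Finset.sum_eq_single m] at h1
  · simpa [MvPolynomial.coeff_monomial] using h1
  · intro m' hm' hne
    rw [MvPolynomial.coeff_monomial, if_neg]
    intro ho
    apply hne
    rw [Finset.mem_filter] at hm'
    ext ⟨i, j⟩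
    by_cases hij : i = j
    · subst hij
      have := congrArg Fin.val (congrFun hm'.2 i)
      simpa [hdg, min_eq_left (hs m hm i), min_eq_left (hs m' hm'.1 i)] using this
    · have := DFunLike.congr_fun ho (i, j)
      simpa [hoff, Finsupp.filter_apply, hij] using this
  · intro hm'
    exact (hm' (Finset.mem_filter.2 ⟨hm, rfl⟩)).elim

lemma krylov_map {R S : Type*} [CommRing R] [CommRing S] (φ : R →+* S) {N : ℕ} (v : Fin N → R)
    (x : Matrix (Fin N) (Fin N) R) : krylov (φ ∘ v) (x.map φ) = (krylov v x).map φ := by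
  ext i j
  rw [krylov, Matrix.map_apply, krylov, Matrix.of_apply, Matrix.of_apply, ← Matrix.map_pow,
    RingHom.map_vecMul]

lemma conj_eq_adjugate {F : Type*} [Field F] {N : ℕ} {g : Matrix (Fin N) (Fin N) F}
    (hg : g.det ≠ 0) (ξ : Matrix (Fin N) (Fin N) F) :
    g.adjugate * ξ * g = g.det • (g⁻¹ * ξ * g) := by
  rw [Matrix.inv_def, Ring.inverse_eq_inv', Matrix.smul_mul, Matrix.smul_mul, smul_smul,
    mul_inv_cancel₀ hg, one_smul]

/-- The polynomial in the entries of a matrix `g` clearing denominators in a polynomial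
in the entries of `g⁻¹ ξ g`. -/
def conjPoly {K : Type*} [Field K] {N : ℕ} (ξ : Matrix (Fin N) (Fin N) K)
    (s : Finset (Fin N × Fin N →₀ ℕ)) (c : (Fin N × Fin N →₀ ℕ) → K) (d : ℕ) :
    MvPolynomial (Fin N × Fin N) K :=
  let X := Matrix.mvPolynomialX (Fin N) (Fin N) K
  X.det * ∑ m ∈ s, MvPolynomial.C (c m) * (X.det ^ (d - ∑ p, m p) *
    ∏ p : Fin N × Fin N, (X.adjugate * ξ.map (MvPolynomial.C (σ := Fin N × Fin N)) * X) p.1 p.2 ^ m p)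

lemma eval₂_conjPoly {K F : Type*} [Field K] [Field F] (φ : K →+* F) {N : ℕ}
    (ξ : Matrix (Fin N) (Fin N) K)
    (s : Finset (Fin N × Fin N →₀ ℕ)) (c : (Fin N × Fin N →₀ ℕ) → K) {d : ℕ}
    (hd : ∀ m ∈ s, ∑ p, m p ≤ d) (g : Matrix (Fin N) (Fin N) F) :
    MvPolynomial.eval₂Hom φ (fun p => g p.1 p.2) (conjPoly ξ s c d)
      = g.det ^ (d + 1) * ∑ m ∈ s, φ (c m) *
        ∏ p : Fin N × Fin N, (g⁻¹ * ξ.map φ * g) p.1 p.2 ^ m p := by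
  set Ψ := MvPolynomial.eval₂Hom φ (fun p : Fin N × Fin N => g p.1 p.2) with hΨ
  set X := Matrix.mvPolynomialX (Fin N) (Fin N) K with hX
  have hXg : X.map Ψ = g := by
    ext i j
    simp [hX, hΨ, Matrix.mvPolynomialX_apply]
  have hdet : Ψ X.det = g.det := by
    rw [RingHom.map_det, RingHom.mapMatrix_apply, hXg]
  have hξ : (ξ.map MvPolynomial.C).map Ψ = ξ.map φ := by
    ext i j
    simp [hΨ]
  have hY : (X.adjugate * ξ.map MvPolynomial.C * X).map Ψ = g.adjugate * ξ.map φ * g := by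
    rw [Matrix.map_mul, Matrix.map_mul, hξ, hXg]
    congr 2
    have := RingHom.map_adjugate Ψ X
    rw [RingHom.mapMatrix_apply, RingHom.mapMatrix_apply, hXg] at this
    exact this
  rw [conjPoly, map_mul, map_sum, hdet]
  by_cases hg : g.det = 0
  · rw [hg, zero_mul, zero_pow (Nat.succ_ne_zero _), zero_mul]
  rw [pow_succ', mul_assoc g.det]
  congr 1
  rw [Finset.mul_sum]
  refine Finset.sum_congr rfl fun m hm => ?_
  have hp : ∀ p : Fin N × Fin N,
      Ψ ((X.adjugate * ξ.map (MvPolynomial.C (σ := Fin N × Fin N)) * X) p.1 p.2)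
      = g.det * (g⁻¹ * ξ.map φ * g) p.1 p.2 := by
    intro p
    have := congrFun (congrFun hY p.1) p.2
    rw [conj_eq_adjugate hg] at this
    exact this
  rw [map_mul, map_mul, map_pow, map_prod, ← hX, hdet]
  simp only [map_pow, hp, mul_pow, Finset.prod_mul_distrib]
  rw [Finset.prod_pow_eq_pow_sum, ← mul_assoc (g.det ^ (d - _)), ← pow_add,
    Nat.sub_add_cancel (hd m hm), mul_left_comm]
  congr 2
  simp [hΨ]

lemma vanish_on_orbit_extend {K F : Type*} [Field K] [Infinite K] [Field F] (φ : K →+* F) {N : ℕ}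
    (ξ : Matrix (Fin N) (Fin N) K)
    (s : Finset (Fin N × Fin N →₀ ℕ)) (c : (Fin N × Fin N →₀ ℕ) → K)
    (h : ∀ g : Matrix (Fin N) (Fin N) K, g.det ≠ 0 →
      ∑ m ∈ s, c m * ∏ p : Fin N × Fin N, (g⁻¹ * ξ * g) p.1 p.2 ^ m p = 0)
    (g : Matrix (Fin N) (Fin N) F) (hg : g.det ≠ 0) :
    ∑ m ∈ s, φ (c m) * ∏ p : Fin N × Fin N, (g⁻¹ * ξ.map φ * g) p.1 p.2 ^ m p = 0 := by
  have hd : ∀ m ∈ s, ∑ p, m p ≤ s.sup (fun m => ∑ p, m p) := fun m hm =>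
    Finset.le_sup (f := fun m : Fin N × Fin N →₀ ℕ => ∑ p, m p) hm
  have h0 : conjPoly ξ s c (s.sup (fun m => ∑ p, m p)) = 0 := by
    refine MvPolynomial.funext fun w => ?_
    have h1 := eval₂_conjPoly (RingHom.id K) ξ s c hd (Matrix.of fun i j => w (i, j))
    rw [map_zero]
    refine Eq.trans h1 ?_
    by_cases hw : (Matrix.of fun i j => w (i, j)).det = 0
    · rw [hw, zero_pow (Nat.succ_ne_zero _), zero_mul]
    · have := h _ hw
      simp only [RingHom.id_apply]
      rw [show ξ.map (RingHom.id K) = ξ from rfl, this, mul_zero]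
  have h1 := eval₂_conjPoly φ ξ s c hd g
  rw [h0, map_zero, eq_comm] at h1
  exact (mul_eq_zero.1 h1).resolve_left (pow_ne_zero _ hg)

/-- A polynomial with staircase support over an extension of `K` which vanishes on the
`K`-orbit of a cyclic matrix is zero. -/
theorem eq_zero_of_vanish_on_cyclic_orbit {K : Subfield ℂ} {k : Type*} [Field k] (φ : K →+* k)
    {N : ℕ} {ξ : Matrix (Fin N) (Fin N) K} {v : Fin N → K} (hv : (krylov v ξ).det ≠ 0)
    (s : Finset (Fin N × Fin N →₀ ℕ)) (hs : ∀ m ∈ s, ∀ i, m (i, i) ≤ i.1)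
    (a : (Fin N × Fin N →₀ ℕ) → k)
    (h : ∀ g : Matrix (Fin N) (Fin N) K, g.det ≠ 0 →
      ∑ m ∈ s, a m * ∏ p : Fin N × Fin N, φ ((g⁻¹ * ξ * g) p.1 p.2) ^ m p = 0) :
    ∀ m ∈ s, a m = 0 := by
  intro m hm
  rcases lt_or_ge N 2 with hN | hN
  · have h0 : ∀ m ∈ s, m = 0 := by
      intro m hm
      ext ⟨i, j⟩
      obtain rfl : i = j := Fin.ext (by omega)
      have := hs m hm i
      simp only [Finsupp.coe_zero, Pi.zero_apply]
      omega
    have hs0 : s = {0} := by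
      refine Finset.eq_singleton_iff_unique_mem.2 ⟨?_, h0⟩
      have := h0 m hm
      rwa [this] at hm
    have h1 := h 1 (by simp)
    rw [hs0, Finset.sum_singleton] at h1
    rw [h0 m hm]
    simpa using h1
  let _ : Algebra K k := φ.toAlgebra
  rw [← Module.forall_dual_apply_eq_zero_iff K]
  intro l
  have h1 := vanish_on_orbit_extend K.subtype ξ s (fun m => l (a m)) (fun g hg => by
    rw [← map_zero l, ← h g hg, map_sum]
    refine Finset.sum_congr rfl fun m _ => ?_
    have : a m * ∏ p : Fin N × Fin N, φ ((g⁻¹ * ξ * g) p.1 p.2) ^ m p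
        = (∏ p : Fin N × Fin N, (g⁻¹ * ξ * g) p.1 p.2 ^ m p) • a m := by
      rw [Algebra.smul_def, mul_comm, RingHom.algebraMap_toAlgebra, map_prod]
      simp only [map_pow]
    rw [this, map_smul, smul_eq_mul, mul_comm])
  have hv' : (krylov (K.subtype ∘ v) (ξ.map K.subtype)).det ≠ 0 := by
    rw [krylov_map, ← RingHom.mapMatrix_apply, ← RingHom.map_det]
    exact (map_ne_zero _).2 hv
  have h2 := eq_zero_of_vanish_on_orbit hN hv' s hs _ h1 m hm
  exact (map_eq_zero K.subtype).1 h2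

section

open Polynomial in
/-- An endomorphism whose centralizer has the least possible dimension is cyclic. -/
lemma exists_cyclic_of_finrank_centralizer {K V : Type} [Field K] [AddCommGroup V] [Module K V]
    [FiniteDimensional K V] (f : Module.End K V)
    (h : ∀ C : Submodule K (Module.End K V), (∀ φ, φ ∈ C ↔ φ * f = f * φ) →
      Module.finrank K C ≤ Module.finrank K V) :
    ∃ x : V, ∀ y, ∃ p : K[X], p.degree < (minpoly K f).natDegree ∧ aeval f p x = y := by
  classical
  rcases subsingleton_or_nontrivial V with hV | hV
  · exact ⟨0, fun y => ⟨0, by simp [bot_lt_iff_ne_bot], Subsingleton.elim _ _⟩⟩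
  have hint : IsIntegral K f := Algebra.IsIntegral.isIntegral f
  obtain ⟨x, hx⟩ : ∃ x : V, ∀ p : K[X], aeval f p x = 0 → aeval f p = 0 := by
    obtain ⟨x, hx⟩ := Module.exists_ker_toSpanSingleton_eq_annihilator (R := K[X])
      (M := Module.AEval' f)
    refine ⟨(Module.AEval'.of f).symm x, fun p hp => ?_⟩
    have h1 : p ∈ LinearMap.ker (LinearMap.toSpanSingleton K[X] (Module.AEval' f) x) := by
      rw [LinearMap.mem_ker, LinearMap.toSpanSingleton_apply]
      have := Module.AEval.of_aeval_smul (R := K) (a := f) p ((Module.AEval'.of f).symm x)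
      rw [LinearEquiv.apply_symm_apply] at this
      rw [← this]
      have h2 : (aeval f p) • (Module.AEval'.of f).symm x = 0 := hp
      rw [h2, map_zero]
    rw [hx, Module.mem_annihilator] at h1
    ext v
    have h2 := h1 (Module.AEval'.of f v)
    have h3 := Module.AEval.of_aeval_smul (R := K) (a := f) p v
    rw [← h3] at h2
    exact (Module.AEval'.of f).map_eq_zero_iff.1 h2
  set d := (minpoly K f).natDegree with hd
  have hd0 : 0 < d := minpoly.natDegree_pos hint
  have hred : ∀ p : K[X], ∃ r : K[X], r.natDegree < d ∧ aeval f r = aeval f p := by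
    intro p
    refine ⟨p %ₘ minpoly K f, ?_,
      aeval_modByMonic_eq_self_of_root (minpoly.aeval K f)⟩
    exact natDegree_modByMonic_lt _ (minpoly.monic hint) (minpoly.ne_one K f)
  have hzero : ∀ p : K[X], p.natDegree < d → aeval f p = 0 → p = 0 := by
    intro p hp h0
    by_contra hne
    exact absurd (natDegree_le_of_dvd (minpoly.dvd K f h0) hne) (by omega)
  have hli : LinearIndependent K (fun i : Fin d => (f ^ i.1) x) := by
    rw [Fintype.linearIndependent_iff]
    intro c hc i
    set p : K[X] := ∑ i : Fin d, C (c i) * X ^ i.1 with hp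
    have hpx : aeval f p x = 0 := by
      rw [← hc, hp, map_sum, LinearMap.sum_apply]
      refine Finset.sum_congr rfl fun i _ => ?_
      simp [Module.algebraMap_end_apply]
    have hpd : p.natDegree < d := by
      by_cases hp0 : p = 0
      · rw [hp0, natDegree_zero]
        exact hd0
      · exact (natDegree_lt_iff_degree_lt hp0).2 (degree_sum_fin_lt c)
    have h1 := congrArg (fun r : K[X] => r.coeff i.1) (hzero p hpd (hx p hpx))
    simp only [hp, finsetSum_coeff, coeff_C_mul, coeff_X_pow, coeff_zero] at h1
    rw [Finset.sum_eq_single i] at h1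
    · simpa using h1
    · intro j _ hj
      have : i.1 ≠ j.1 := fun h => hj (Fin.ext h.symm)
      simp [this]
    · simp
  obtain ⟨g, hg⟩ := LinearMap.exists_leftInverse_of_injective _ (LinearMap.ker_eq_bot.2 hli)
  set l : V →ₗ[K] K := Finsupp.lapply ⟨d - 1, by omega⟩ ∘ₗ g with hl
  have hlx : ∀ i, i < d → l ((f ^ i) x) = if i = d - 1 then 1 else 0 := by
    intro i hi
    have h1 := LinearMap.congr_fun hg (Finsupp.single ⟨i, hi⟩ 1)
    rw [LinearMap.comp_apply, Finsupp.linearCombination_single, one_smul] at h1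
    simp only [hl, LinearMap.comp_apply, h1, LinearMap.id_apply, Finsupp.lapply_apply,
      Finsupp.single_apply, Fin.mk.injEq]
  have hnd : ∀ p : K[X], (∀ r : K[X], l (aeval f r (aeval f p x)) = 0) → aeval f p = 0 := by
    intro p hp
    obtain ⟨r, hr, hrp⟩ := hred p
    rw [← hrp] at hp ⊢
    by_cases hr0 : r = 0
    · rw [hr0, map_zero]
    exfalso
    have h1 := hp (X ^ (d - 1 - r.natDegree))
    rw [← Module.End.mul_apply, ← map_mul, aeval_eq_sum_range' (n := d), LinearMap.sum_apply,
      map_sum, Finset.sum_eq_single (d - 1)] at h1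
    · rw [LinearMap.smul_apply, map_smul, hlx _ (by omega), if_pos rfl, smul_eq_mul, mul_one,
        coeff_X_pow_mul', if_pos (by omega)] at h1
      rw [show d - 1 - (d - 1 - r.natDegree) = r.natDegree by omega] at h1
      exact hr0 (leadingCoeff_eq_zero.1 h1)
    · intro j hj hne
      rw [LinearMap.smul_apply, map_smul, hlx _ (Finset.mem_range.1 hj), if_neg hne, smul_zero]
    · intro hj
      exact absurd (Finset.mem_range.2 (by omega)) hj
    · refine lt_of_le_of_lt natDegree_mul_le ?_
      rw [natDegree_X_pow]
      omega
  let E := Algebra.adjoin K {f}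
  have hE : ∀ b : E, ∃ p : K[X], aeval f p = b := by
    intro b
    have : (b : Module.End K V) ∈ Algebra.adjoin K {f} := b.2
    rw [Algebra.adjoin_singleton_eq_range_aeval] at this
    exact this
  have hEp : ∀ p : K[X], aeval f p ∈ E := fun p => aeval_mem_adjoin_singleton K f
  have hcomm : ∀ a b : E, (a : Module.End K V) * b = b * a := by
    intro a b
    obtain ⟨p, hp⟩ := hE a
    obtain ⟨r, hr⟩ := hE b
    rw [← hp, ← hr, ← map_mul, mul_comm, map_mul]
  let fE : E := ⟨f, Algebra.self_mem_adjoin_singleton K f⟩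
  let Φ : V → E →ₗ[K] V := fun y => (LinearMap.applyₗ y) ∘ₗ E.val.toLinearMap
  have hΦ : ∀ y (a : E), Φ y a = (a : Module.End K V) y := fun _ _ => rfl
  let T : V →ₗ[K] Module.Dual K E :=
    { toFun := fun v => l ∘ₗ Φ v
      map_add' := fun v w => by ext a; simp [hΦ]
      map_smul' := fun c v => by ext a; simp [hΦ] }
  have hT : ∀ v (a : E), T v a = l ((a : Module.End K V) v) := fun _ _ => rfl
  have hinj : Function.Injective (T ∘ₗ Φ x) := by
    rw [← LinearMap.ker_eq_bot, LinearMap.ker_eq_bot']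
    intro b hb
    obtain ⟨p, hp⟩ := hE b
    apply Subtype.ext
    rw [← hp]
    refine hnd p fun r => ?_
    have := LinearMap.congr_fun hb ⟨aeval f r, hEp r⟩
    rw [LinearMap.comp_apply, hT, hΦ, ← hp] at this
    exact this
  have hbij : Function.Bijective (T ∘ₗ Φ x) :=
    ⟨hinj, (LinearMap.injective_iff_surjective_of_finrank_eq_finrank
      (Subspace.dual_finrank_eq (K := K) (V := E)).symm).1 hinj⟩
  let A := LinearEquiv.ofBijective _ hbij
  have hA : ∀ u, T (Φ x (A.symm u)) = u := fun u => A.apply_symm_apply u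
  have hA' : ∀ b, A.symm (T (Φ x b)) = b := fun b => A.symm_apply_apply b
  let P : V → Module.End K V := fun y => Φ y ∘ₗ A.symm.toLinearMap ∘ₗ T
  have hP : ∀ y v, P y v = (A.symm (T v) : Module.End K V) y := fun _ _ => rfl
  have hPf : ∀ y, P y * f = f * P y := by
    intro y
    ext v
    rw [Module.End.mul_apply, Module.End.mul_apply, hP, hP]
    have : A.symm (T (f v)) = fE * A.symm (T v) := by
      rw [LinearEquiv.symm_apply_eq]
      ext a
      change T (f v) a = T (Φ x (fE * A.symm (T v))) a
      rw [hT, hT, hΦ]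
      have h1 := LinearMap.congr_fun (hA (T v)) (a * fE)
      rw [hT, hT, hΦ] at h1
      exact h1.symm
    rw [this]
    rfl
  have hPx : ∀ y, P y x = y := by
    intro y
    have h1 := hA' 1
    rw [hΦ, Subalgebra.coe_one, Module.End.one_apply] at h1
    rw [hP, h1, Subalgebra.coe_one, Module.End.one_apply]
  refine ⟨x, fun y => ?_⟩
  let C : Submodule K (Module.End K V) :=
    LinearMap.ker (LinearMap.mulRight K f - LinearMap.mulLeft K f)
  have hC : ∀ φ, φ ∈ C ↔ φ * f = f * φ := by
    intro φ
    rw [LinearMap.mem_ker, LinearMap.sub_apply, LinearMap.mulRight_apply, LinearMap.mulLeft_apply,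
      sub_eq_zero]
  let ev : C →ₗ[K] V := LinearMap.applyₗ x ∘ₗ C.subtype
  have hsurj : Function.Surjective ev := fun y => ⟨⟨P y, (hC _).2 (hPf y)⟩, hPx y⟩
  have hevinj : Function.Injective ev := by
    have h1 := LinearMap.finrank_range_add_finrank_ker ev
    rw [LinearMap.range_eq_top.2 hsurj, finrank_top] at h1
    have h2 := h C hC
    rw [← LinearMap.ker_eq_bot, ← Submodule.finrank_eq_zero (R := K)]
    omega
  have h1 : (⟨P x, (hC _).2 (hPf x)⟩ : C) = ⟨1, (hC _).2 (by rw [one_mul, mul_one])⟩ :=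
    hevinj (hPx x)
  have h2 := LinearMap.congr_fun (congrArg Subtype.val h1) y
  simp only [Module.End.one_apply] at h2
  obtain ⟨p, hp⟩ := hE (A.symm (T y))
  obtain ⟨r, hr, hrp⟩ := hred p
  exact ⟨r, lt_of_le_of_lt degree_le_natDegree (by exact_mod_cast hr), by rw [hrp, hp, ← hP, h2]⟩

lemma exists_krylov_det_ne_zero {K : Type} [Field K] {N : ℕ} (ξ : Matrix (Fin N) (Fin N) K)
    (h : Module.finrank K (LinearMap.ker (LinearMap.mulLeft K ξ - LinearMap.mulRight K ξ)) = N) :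
    ∃ v, (krylov v ξ).det ≠ 0 := by
  classical
  set f : Module.End K (Fin N → K) := Matrix.toLin' ξ.transpose with hf
  have hfp : ∀ i v, (f ^ i) v = Matrix.vecMul v (ξ ^ i) := by
    intro i
    induction i with
    | zero => intro v; simp
    | succ i ih =>
      intro v
      rw [pow_succ', Module.End.mul_apply, ih, pow_succ, ← Matrix.vecMul_vecMul, hf,
        Matrix.toLin'_apply, Matrix.mulVec_transpose]
  obtain ⟨x, hx⟩ := exists_cyclic_of_finrank_centralizer f (fun C hC => by
    rw [Module.finrank_fin_fun]
    refine le_trans ?_ h.le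
    set L : Module.End K (Fin N → K) →ₗ[K] Matrix (Fin N) (Fin N) K :=
      (Matrix.transposeLinearEquiv (Fin N) (Fin N) K K).toLinearMap ∘ₗ
        LinearMap.toMatrix'.toLinearMap with hL
    have hLi : Function.Injective L :=
      (Matrix.transposeLinearEquiv (Fin N) (Fin N) K K).injective.comp LinearMap.toMatrix'.injective
    refine LinearMap.finrank_le_finrank_of_injective (f := L.restrict (p := C) ?_) ?_
    · intro φ hφ
      rw [hC] at hφ
      rw [LinearMap.mem_ker, LinearMap.sub_apply, LinearMap.mulLeft_apply,
        LinearMap.mulRight_apply, sub_eq_zero]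
      have h1 := congrArg (fun ψ => (LinearMap.toMatrix' ψ).transpose) hφ
      simp only [LinearMap.toMatrix'_mul, hf, LinearMap.toMatrix'_toLin', Matrix.transpose_mul,
        Matrix.transpose_transpose] at h1
      exact h1
    · intro φ ψ hφ
      exact Subtype.ext (hLi (congrArg Subtype.val hφ)))
  refine ⟨x, ?_⟩
  rw [← isUnit_iff_ne_zero, ← Matrix.isUnit_iff_isUnit_det, ← Matrix.vecMul_surjective_iff_isUnit]
  intro y
  obtain ⟨p, hp, hpy⟩ := hx y
  have hd : (minpoly K f).natDegree ≤ N := by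
    have h1 := Polynomial.natDegree_le_of_dvd (LinearMap.minpoly_dvd_charpoly f)
      f.charpoly_monic.ne_zero
    rwa [LinearMap.charpoly_natDegree, Module.finrank_fin_fun] at h1
  refine ⟨fun i => p.coeff i, ?_⟩
  by_cases hp0 : p = 0
  · subst hp0
    rw [← hpy, map_zero]
    simp only [Polynomial.coeff_zero]
    exact Matrix.zero_vecMul _
  have hpN := ((Polynomial.natDegree_lt_iff_degree_lt hp0).2 hp).trans_le hd
  change Matrix.vecMul _ _ = _
  rw [← hpy, Polynomial.aeval_eq_sum_range' hpN, Finset.sum_range,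
    LinearMap.sum_apply, Matrix.vecMul_eq_sum]
  refine Finset.sum_congr rfl fun i _ => ?_
  rw [LinearMap.smul_apply, hfp]
  rfl

end

section

variable {M G : Type} [Ring M] [Algebra ℂ M] [Ring G] [Algebra ℂ G] {N : ℕ} {q : ℂ}
  {x : Fin N → Fin N → M} {ι : M →ₐ[ℂ] G} {dInv : G} {ΔM : M →ₐ[ℂ] M ⊗[ℂ] M}
  {ΔG : G →ₐ[ℂ] G ⊗[ℂ] G} {εG : G →ₐ[ℂ] ℂ} {St : G →ₗ[ℂ] G} {O : ValuationSubring ℂ}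
  {K : Subfield ℂ} {e : M →ₐ[ℂ] ℂ}

/-- The images of the co-orbits of words reduce to the entries of the conjugates of `ξ`. -/
lemma IsQGL.coorbit_listProd_reduction (hK : ∀ a ∈ K, a ∈ O)
    (H : IsQGL q x ι dInv ΔM ΔG εG St) (ξ : Matrix (Fin N) (Fin N) K)
    (he : ∀ i j, e (x i j) = ξ i j) {g : Matrix (Fin N) (Fin N) (IsLocalRing.ResidueField O)}
    {ρ : G →ₐ[ℂ] Module.End ℂ (MvPolynomial ℕ ℂ)}
    (h1 : ∀ i j, (ρ (ι (x i j)), g i j) ∈ opPair O)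
    (h2 : ∀ i j, (ρ (St (ι (x i j))), g⁻¹ i j) ∈ opPair O) (l : List (Fin N × Fin N)) :
    (ρ (coorbit e (adjBeta ΔM ι St) (listProd x l)),
      listProd (fun i j => (g⁻¹ * ξ.map (resHom hK) * g) i j) l) ∈ opPair O := by
  have he' : ∀ i j, e (x i j) = (fun i j => (ξ i j : ℂ)) i j := he
  induction l using List.reverseRecOn with
  | nil =>
    simp only [listProd, List.map_nil, List.prod_nil]
    rw [H.coorbit_one he', map_one]
    exact (opPair O).one_mem
  | append_singleton l p ih =>
    have hl : ∀ {A : Type} [Monoid A] (y : Fin N → Fin N → A),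
        listProd y (l ++ [p]) = listProd y l * y p.1 p.2 := by
      intro A _ y; simp [listProd]
    rw [hl, hl, H.coorbit_mul_gen he']
    simp only [map_sum, map_smul, map_mul]
    generalize listProd (fun i j => (g⁻¹ * ξ.map (resHom hK) * g) i j) l = y at ih ⊢
    have : y * (g⁻¹ * ξ.map (resHom hK) * g) p.1 p.2
        = ∑ k, ∑ l', resHom hK (ξ k l') * (g⁻¹ p.1 k * y * g l' p.2) := by
      rw [Matrix.mul_apply, Finset.sum_comm, Finset.mul_sum]
      refine Finset.sum_congr rfl fun j _ => ?_
      rw [Matrix.mul_apply, Finset.sum_mul, Finset.mul_sum]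
      refine Finset.sum_congr rfl fun k _ => ?_
      rw [Matrix.map_apply]
      ring
    rw [this]
    refine opPair_sum fun k _ => opPair_sum fun l' _ => opPair_smul (resHom_mem hK _) ?_
    exact opPair_mul (opPair_mul (h2 _ _) ih) (h1 _ _)

/-- The kernel of the co-orbit map of a cyclic point is generated by the `τ_i - τ_i(ξ)`. -/
theorem IsQGL.ker_coorbit_le (hq : Transcendental K q)
    (H : IsQGL q x ι dInv ΔM ΔG εG St) (E : ExtProp q x ι) (ξ : Matrix (Fin N) (Fin N) K)
    (he : ∀ i j, e (x i j) = ξ i j) {v : Fin N → K} (hv : (krylov v ξ).det ≠ 0) :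
    LinearMap.ker (coorbit e (adjBeta ΔM ι St))
      ≤ Submodule.span ℂ {y : M | ∃ (i : Fin N) (h : M),
          y = (tauCoinv q q⁻¹ x (i.1 + 1)
            - algebraMap ℂ M (e (tauCoinv q q⁻¹ x (i.1 + 1)))) * h} := by
  classical
  intro w hw
  set I := Submodule.span ℂ {y : M | ∃ (i : Fin N) (h : M),
          y = (tauCoinv q q⁻¹ x (i.1 + 1)
            - algebraMap ℂ M (e (tauCoinv q q⁻¹ x (i.1 + 1)))) * h} with hI
  have hmem : w ∈ I ⊔ Submodule.span ℂ {y : M | ∃ m : Fin N × Fin N →₀ ℕ, (∀ i, m (i, i) ≤ i) ∧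
          y = listProd x (Finsupp.toMultiset m).toList} := by
    refine (Submodule.span_le.2 ?_) (mem_span_listProd x H.gen w)
    rintro _ ⟨l, rfl⟩
    exact H.rel.straighten H.q_ne (fun i => e (tauCoinv q q⁻¹ x (i.1 + 1))) l
  obtain ⟨u, hu, z, hz, rfl⟩ := Submodule.mem_sup.1 hmem
  have he' : ∀ i j, e (x i j) = (fun i j => (ξ i j : ℂ)) i j := he
  have hu0 := H.span_le_ker he' hu
  have hz0 : coorbit e (adjBeta ΔM ι St) z = 0 := by
    rw [LinearMap.mem_ker] at hw hu0
    rwa [map_add, hu0, zero_add] at hw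
  suffices z = 0 by rw [this, add_zero]; exact hu
  have hset : {y : M | ∃ m : Fin N × Fin N →₀ ℕ, (∀ i, m (i, i) ≤ i) ∧
      y = listProd x (Finsupp.toMultiset m).toList}
      = (fun m : Fin N × Fin N →₀ ℕ => listProd x (Finsupp.toMultiset m).toList) ''
        {m | ∀ i : Fin N, m (i, i) ≤ i.1} := by
    ext y; simp [eq_comm]
  rw [hset, Finsupp.mem_span_image_iff_linearCombination] at hz
  obtain ⟨c, hc, rfl⟩ := hz
  rw [Finsupp.linearCombination_apply, Finsupp.sum] at hz0 ⊢
  by_cases hc0 : c = 0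
  · simp [hc0]
  exfalso
  obtain ⟨t₀, ht₀⟩ := Finsupp.support_nonempty_iff.2 hc0
  obtain ⟨O, hqO, hKO, hres⟩ := exists_place K hq
  have hq1 : (q, (1 : IsLocalRing.ResidueField O)) ∈ redPair O := by
    rw [← hres]; exact redPair_coe (O := O) ⟨q, hqO⟩
  obtain ⟨μ, a, ha, t, ht, hat⟩ := exists_scale_redPair (O := O) c.support c ht₀
    (Finsupp.mem_support_iff.1 ht₀)
  refine hat (eq_zero_of_vanish_on_cyclic_orbit (resHom hKO) hv c.support
    (fun m hm i => hc hm i) a ?_ t ht)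
  intro g hg
  obtain ⟨n, ρ, h1, h2, -⟩ := HasRep.exists hKO H E hq1 g hg
  have hginv : (g.map (resHom hKO))⁻¹ = g⁻¹.map (resHom hKO) := by
    refine Matrix.inv_eq_right_inv ?_
    rw [← Matrix.map_mul, Matrix.mul_nonsing_inv _ (isUnit_iff_ne_zero.2 hg)]
    simp
  refine opPair_zero (O := O) ?_
  have hsum := opPair_sum (O := O) (s := c.support) fun m hm => opPair_smul (ha m hm)
    (H.coorbit_listProd_reduction hKO ξ he h1 h2 (Finsupp.toMultiset m).toList)
  convert hsum using 2
  · have := congrArg (fun y => μ • ρ y) hz0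
    simpa only [map_sum, map_smul, Finset.smul_sum, smul_smul, map_zero, smul_zero] using this.symm
  · refine Finset.sum_congr rfl fun m _ => ?_
    rw [listProd_toMultiset]
    simp only [hginv, ← Matrix.map_mul, Matrix.map_apply]

end

namespace IsQGL

variable {M G : Type} [Ring M] [Algebra ℂ M] [Ring G] [Algebra ℂ G] {N : ℕ} {q : ℂ}
  {x : Fin N → Fin N → M} {ι : M →ₐ[ℂ] G} {dInv : G} {ΔM : M →ₐ[ℂ] M ⊗[ℂ] M}
  {ΔG : G →ₐ[ℂ] G ⊗[ℂ] G} {εG : G →ₐ[ℂ] ℂ} {St : G →ₗ[ℂ] G}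

/-- The inverse of the quantum determinant is a combination of antipodes of words. -/
lemma dInv_mem (H : IsQGL q x ι dInv ΔM ΔG εG St) :
    dInv ∈ Submodule.span ℂ {y : G | ∃ i k : Fin N → Fin N, y = St (ι (wordProd x i k))} := by
  set J : Fin N ↪o Fin N := Finset.univ.orderEmbOfFin (Finset.card_fin N) with hJdef
  have hJ : ∀ I : Fin N ↪o Fin N, I = J := fun I =>
    Finset.orderEmbOfFin_unique' _ fun _ => Finset.mem_univ _
  have hdet : qdet q x = genMinor q (Matrix.of (wordProd x)) J J := by
    rw [qdet, qMinor_eq_genMinor q x Finset.univ (Finset.card_fin N)]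
  have h1 : ∀ i, ∑ l, altVec q J l • ι (wordProd x i l) = altVec q J i • ι (qdet q x) := by
    intro i
    have := (H.rel.commBraid H.q_ne N).sum_altVec_right H.q_ne H.q_add J i
    rw [Fintype.sum_eq_single J fun I hI => absurd (hJ I) hI] at this
    have h := congrArg ι this
    simpa [hdet] using h
  have h2 : altVec q J J = 1 := by
    have h : invCount (1 : Equiv.Perm (Fin N)) = 0 := by
      rw [invCount, Finset.card_eq_zero, Finset.filter_eq_empty_iff]
      rintro p - ⟨h, h'⟩
      exact lt_asymm h h'
    have := altVec_comp_perm q J 1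
    rwa [h, pow_zero] at this
  have h3 : ∑ l, altVec q J l • St (ι (wordProd x J l)) = dInv := by
    calc ∑ l, altVec q J l • St (ι (wordProd x J l))
        = (∑ k, St (ι (wordProd x J k)) * ∑ l, altVec q J l • ι (wordProd x k l)) * dInv := by
          rw [Finset.sum_mul]
          refine Finset.sum_congr rfl fun k _ => ?_
          rw [h1, mul_smul_comm, smul_mul_assoc, mul_assoc, H.det_mul, mul_one]
      _ = dInv := by
          simp only [Finset.mul_sum, mul_smul_comm]
          rw [Finset.sum_comm]
          simp only [← Finset.smul_sum, H.sum_s_t]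
          simp [h2]
  rw [← h3]
  exact Submodule.sum_mem _ fun l _ => Submodule.smul_mem _ _ (Submodule.subset_span ⟨_, _, rfl⟩)

/-- The span of the products of antipodes of words and words. -/
def straightSpan (x : Fin N → Fin N → M) (ι : M →ₐ[ℂ] G) (St : G →ₗ[ℂ] G) : Submodule ℂ G :=
  Submodule.span ℂ {y : G | ∃ (m n : ℕ) (i k : Fin m → Fin N) (l j : Fin n → Fin N),
    y = St (ι (wordProd x i k)) * ι (wordProd x l j)}

/-- Straightening a product of a generator and an antipode. -/
lemma gen_mul_antipode (H : IsQGL q x ι dInv ΔM ΔG εG St) (b e g h : Fin N) :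
    ι (x b e) * St (ι (x g h)) ∈ Submodule.span ℂ {y : G | ∃ a b c d : Fin N,
      y = St (ι (x a b)) * ι (x c d)} := by
  set V := Submodule.span ℂ {y : G | ∃ a b c d : Fin N, y = St (ι (x a b)) * ι (x c d)} with hV
  have hmem : ∀ a b c d, St (ι (x a b)) * ι (x c d) ∈ V := fun a b c d =>
    Submodule.subset_span ⟨a, b, c, d, rfl⟩
  have hL : ∀ g h b e, (if e = g then q else 1) • (ι (x b e) * St (ι (x g h)))
      + (if g = e then ∑ d, (if e < d then q - q⁻¹ else 0) • (ι (x b d) * St (ι (x d h)))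
          else 0) ∈ V := by
    intro g h b e
    rw [← H.cross_exchange]
    refine V.add_mem (V.smul_mem _ (hmem _ _ _ _)) ?_
    split_ifs
    · exact V.sum_mem fun a _ => V.smul_mem _ (hmem _ _ _ _)
    · exact V.zero_mem
  by_cases hge : g = e
  · subst hge
    have key : ∀ (r : ℕ) (g : Fin N), N - g.1 ≤ r → ι (x b g) * St (ι (x g h)) ∈ V := by
      intro r
      induction r with
      | zero => intro g hg; omega
      | succ r ih =>
        intro g hg
        have h1 := hL g h b g
        simp only [if_true] at h1
        have h2 : ∑ d, (if g < d then q - q⁻¹ else 0) • (ι (x b d) * St (ι (x d h))) ∈ V := by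
          refine V.sum_mem fun d _ => ?_
          split_ifs with hd
          · exact V.smul_mem _ (ih d (by have := d.2; rw [Fin.lt_def] at hd; omega))
          · rw [zero_smul]; exact V.zero_mem
        have h3 := V.smul_mem q⁻¹ ((V.add_mem_iff_left h2).1 h1)
        rwa [smul_smul, inv_mul_cancel₀ H.q_ne, one_smul] at h3
    exact key _ g le_rfl
  · have := hL g h b e
    rwa [if_neg (Ne.symm hge), if_neg hge, one_smul, add_zero] at this

lemma word_mul_antipode (H : IsQGL q x ι dInv ΔM ΔG εG St) {n : ℕ} (l j : Fin n → Fin N)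
    (g h : Fin N) :
    ι (wordProd x l j) * St (ι (x g h)) ∈ Submodule.span ℂ {y : G | ∃ (a b : Fin N)
      (c d : Fin n → Fin N), y = St (ι (x a b)) * ι (wordProd x c d)} := by
  induction n generalizing g h with
  | zero =>
    refine Submodule.subset_span ⟨g, h, l, j, ?_⟩
    simp [wordProd_zero]
  | succ n ih =>
    set W := Submodule.span ℂ {y : G | ∃ (a b : Fin N) (c d : Fin (n + 1) → Fin N),
      y = St (ι (x a b)) * ι (wordProd x c d)} with hW
    rw [wordProd_succ, map_mul, mul_assoc]
    refine (Submodule.span_le (p := W.comap (LinearMap.mulLeft ℂ (ι (x (l 0) (j 0)))))).2 ?_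
      (ih (Fin.tail l) (Fin.tail j) g h)
    rintro _ ⟨a, b, c, d, rfl⟩
    change ι (x (l 0) (j 0)) * (St (ι (x a b)) * ι (wordProd x c d)) ∈ W
    rw [← mul_assoc]
    refine (Submodule.span_le (p := W.comap (LinearMap.mulRight ℂ (ι (wordProd x c d))))).2 ?_
      (H.gen_mul_antipode (l 0) (j 0) a b)
    rintro _ ⟨a, b, c', d', rfl⟩
    refine Submodule.subset_span ⟨a, b, Fin.cons c' c, Fin.cons d' d, ?_⟩
    rw [LinearMap.mulRight_apply, wordProd_cons, map_mul, mul_assoc]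

lemma straightSpan_eq_top (H : IsQGL q x ι dInv ΔM ΔG εG St) : straightSpan x ι St = ⊤ := by
  set V := straightSpan x ι St with hV
  have hmem : ∀ {m n : ℕ} (i k : Fin m → Fin N) (l j : Fin n → Fin N),
      St (ι (wordProd x i k)) * ι (wordProd x l j) ∈ V := fun i k l j =>
    Submodule.subset_span ⟨_, _, i, k, l, j, rfl⟩
  have h1 : (1 : G) ∈ V := by
    have := hmem (m := 0) (n := 0) default default default default
    simpa [wordProd_zero, H.st_one] using this
  have hgen : ∀ y ∈ V, ∀ a b, y * ι (x a b) ∈ V := by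
    intro y hy a b
    induction hy using Submodule.span_induction with
    | mem y hy =>
      obtain ⟨m, n, i, k, l, j, rfl⟩ := hy
      rw [mul_assoc, ← map_mul, ← wordProd_snoc]
      exact hmem _ _ _ _
    | zero => rw [zero_mul]; exact V.zero_mem
    | add f g _ _ hf hg => rw [add_mul]; exact V.add_mem hf hg
    | smul c f _ hf => rw [smul_mul_assoc]; exact V.smul_mem _ hf
  have hanti : ∀ y ∈ V, ∀ a b, y * St (ι (x a b)) ∈ V := by
    intro y hy a b
    induction hy using Submodule.span_induction with
    | mem y hy =>
      obtain ⟨m, n, i, k, l, j, rfl⟩ := hy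
      rw [mul_assoc]
      refine (Submodule.span_le (p := V.comap (LinearMap.mulLeft ℂ _))).2 ?_
        (H.word_mul_antipode l j a b)
      rintro _ ⟨a, b, c, d, rfl⟩
      rw [SetLike.mem_coe, Submodule.mem_comap, LinearMap.mulLeft_apply, ← mul_assoc, ← H.st_cons]
      exact hmem _ _ _ _
    | zero => rw [zero_mul]; exact V.zero_mem
    | add f g _ _ hf hg => rw [add_mul]; exact V.add_mem hf hg
    | smul c f _ hf => rw [smul_mul_assoc]; exact V.smul_mem _ hf
  have hantiW : ∀ (n : ℕ) (i k : Fin n → Fin N), ∀ y ∈ V, y * St (ι (wordProd x i k)) ∈ V := by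
    intro n
    induction n with
    | zero => intro i k y hy; rwa [wordProd_zero, map_one, H.st_one, mul_one]
    | succ n ih =>
      intro i k y hy
      rw [← Fin.cons_self_tail i, ← Fin.cons_self_tail k, H.st_cons, ← mul_assoc]
      exact hanti _ (ih _ _ y hy) _ _
  have hd : ∀ y ∈ V, y * dInv ∈ V := by
    intro y hy
    refine (Submodule.span_le (p := V.comap (LinearMap.mulLeft ℂ y))).2 ?_ H.dInv_mem
    rintro _ ⟨i, k, rfl⟩
    exact hantiW _ _ _ y hy
  have hall : ∀ z : G, ∀ y ∈ V, y * z ∈ V := by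
    intro z
    have hz : z ∈ Algebra.adjoin ℂ
      (Set.range (fun p : Fin N × Fin N => ι (x p.1 p.2)) ∪ {dInv}) := by rw [H.genG]; trivial
    induction hz using Algebra.adjoin_induction with
    | mem z hz =>
      rcases hz with ⟨p, rfl⟩ | rfl
      · exact fun y hy => hgen y hy _ _
      · exact hd
    | algebraMap c => intro y hy; rw [← Algebra.commutes, ← Algebra.smul_def]; exact V.smul_mem _ hy
    | add a b _ _ ha hb => intro y hy; rw [mul_add]; exact V.add_mem (ha y hy) (hb y hy)
    | mul a b _ _ ha hb => intro y hy; rw [← mul_assoc]; exact hb _ (ha y hy)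
  rw [eq_top_iff]
  intro z _
  simpa using hall z 1 h1

end IsQGL

/-- The weight of a word: the number of occurrences of each letter. -/
def wordWt {N n : ℕ} (k : Fin n → Fin N) : Fin N → ℤ := ∑ c, Pi.single (k c) 1

section wordWt

variable {N n : ℕ}

lemma wordWt_cons (a : Fin N) (k : Fin n → Fin N) :
    wordWt (Fin.cons a k : Fin (n + 1) → Fin N) = Pi.single a 1 + wordWt k := by
  simp [wordWt, Fin.sum_univ_succ]

lemma wordWt_snoc (a : Fin N) (k : Fin n → Fin N) :
    wordWt (Fin.snoc k a : Fin (n + 1) → Fin N) = wordWt k + Pi.single a 1 := by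
  simp [wordWt, Fin.sum_univ_castSucc]

lemma wordWt_comp_perm (k : Fin n → Fin N) (σ : Equiv.Perm (Fin n)) :
    wordWt (k ∘ σ) = wordWt k :=
  Equiv.sum_comp σ fun c => (Pi.single (k c) 1 : Fin N → ℤ)

lemma wordWt_apply (k : Fin n → Fin N) (a : Fin N) :
    wordWt k a = Fintype.card {c // k c = a} := by
  rw [wordWt, Finset.sum_apply, Fintype.card_subtype, Finset.card_filter]
  push_cast
  refine Finset.sum_congr rfl fun c _ => ?_
  simp [Pi.single_apply, eq_comm]

lemma exists_perm_of_wordWt_eq {k l : Fin n → Fin N} (h : wordWt k = wordWt l) :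
    ∃ σ : Equiv.Perm (Fin n), l = k ∘ σ := by
  have h' : ∀ a, Nonempty ({c // l c = a} ≃ {c // k c = a}) := fun a => by
    rw [← Fintype.card_eq]
    have := congrFun h a
    rw [wordWt_apply, wordWt_apply] at this
    exact_mod_cast this.symm
  let e := fun a => Classical.choice (h' a)
  refine ⟨((Equiv.sigmaFiberEquiv l).symm.trans (Equiv.sigmaCongrRight e)).trans
    (Equiv.sigmaFiberEquiv k), funext fun c => ?_⟩
  exact ((e (l c)) ⟨c, rfl⟩).2.symm

lemma length_eq_of_wordWt_eq {m : ℕ} {k : Fin n → Fin N} {l : Fin m → Fin N}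
    (h : wordWt k = wordWt l) : n = m := by
  have hs : ∀ {n : ℕ} (k : Fin n → Fin N), ∑ a, wordWt k a = n := by
    intro n k
    simp only [wordWt, Finset.sum_apply]
    rw [Finset.sum_comm]
    simp
  have := hs k
  rw [h, hs l] at this
  exact_mod_cast this.symm

end wordWt

namespace IsQGL

variable {M G : Type} [Ring M] [Algebra ℂ M] [Ring G] [Algebra ℂ G] {N : ℕ} {q : ℂ}
  {x : Fin N → Fin N → M} {ι : M →ₐ[ℂ] G} {dInv : G} {ΔM : M →ₐ[ℂ] M ⊗[ℂ] M}
  {ΔG : G →ₐ[ℂ] G ⊗[ℂ] G} {εG : G →ₐ[ℂ] ℂ} {St : G →ₗ[ℂ] G}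
  {D : Type} [CommRing D] [Algebra ℂ D] {t : Fin N → Dˣ} {πD : G →ₐ[ℂ] D}

/-- The span of the products of antipodes of words and words which have weight zero. -/
def weightZero (x : Fin N → Fin N → M) (ι : M →ₐ[ℂ] G) (St : G →ₗ[ℂ] G) : Submodule ℂ G :=
  Submodule.span ℂ {y : G | ∃ (n : ℕ) (i k l j : Fin n → Fin N), wordWt k = wordWt l ∧
    y = St (ι (wordProd x i k)) * ι (wordProd x l j)}

lemma leftCoact_apply (πD : G →ₐ[ℂ] D) (ΔG : G →ₐ[ℂ] G ⊗[ℂ] G) (f : G) :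
    leftCoact πD ΔG f
      = ((Algebra.TensorProduct.map πD (AlgHom.id ℂ G)).comp ΔG) f := rfl

lemma leftCoact_gen (H : IsQGL q x ι dInv ΔM ΔG εG St)
    (hπ : ∀ i j, πD (ι (x i j)) = if i = j then (t i : D) else 0) (i j : Fin N) :
    ((Algebra.TensorProduct.map πD (AlgHom.id ℂ G)).comp ΔG) (ι (x i j))
      = (t i : D) ⊗ₜ[ℂ] ι (x i j) := by
  simp [H.comulG, H.comulM, hπ, TensorProduct.ite_tmul]

lemma leftCoact_antipode_gen (H : IsQGL q x ι dInv ΔM ΔG εG St)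
    (hπ : ∀ i j, πD (ι (x i j)) = if i = j then (t i : D) else 0) (i j : Fin N) :
    ((Algebra.TensorProduct.map πD (AlgHom.id ℂ G)).comp ΔG) (St (ι (x i j)))
      = (↑(t j)⁻¹ : D) ⊗ₜ[ℂ] St (ι (x i j)) := by
  refine H.map_sMat _ (Matrix.of fun i j => (↑(t j)⁻¹ : D) ⊗ₜ[ℂ] St (ι (x i j))) ?_ i j
  ext i j
  simp only [Matrix.mul_apply, Matrix.of_apply, H.leftCoact_gen hπ,
    Algebra.TensorProduct.tmul_mul_tmul, Units.inv_mul, ← TensorProduct.tmul_sum, H.sum_s_t_one,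
    Matrix.one_apply]
  split_ifs <;> simp [Algebra.TensorProduct.one_def]

/-- The torus coaction on straightened words. -/
lemma leftCoact_word (H : IsQGL q x ι dInv ΔM ΔG εG St)
    (hπ : ∀ i j, πD (ι (x i j)) = if i = j then (t i : D) else 0) {m n : ℕ}
    (i k : Fin m → Fin N) (l j : Fin n → Fin N) :
    leftCoact πD ΔG (St (ι (wordProd x i k)) * ι (wordProd x l j))
      = (↑((∏ c, t (k c))⁻¹ * ∏ c, t (l c)) : D) ⊗ₜ[ℂ]
        (St (ι (wordProd x i k)) * ι (wordProd x l j)) := by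
  rw [leftCoact_apply, map_mul]
  set Λ := (Algebra.TensorProduct.map πD (AlgHom.id ℂ G)).comp ΔG with hΛ
  have h1 : ∀ (n : ℕ) (l j : Fin n → Fin N), Λ (ι (wordProd x l j))
      = (↑(∏ c, t (l c)) : D) ⊗ₜ[ℂ] ι (wordProd x l j) := by
    intro n
    induction n with
    | zero => intro l j; simp [wordProd_zero, Algebra.TensorProduct.one_def]
    | succ n ih =>
      intro l j
      rw [wordProd_succ, map_mul, map_mul, ih, H.leftCoact_gen hπ,
        Algebra.TensorProduct.tmul_mul_tmul, Fin.prod_univ_succ, Units.val_mul]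
      rfl
  have h2 : ∀ (n : ℕ) (i k : Fin n → Fin N), Λ (St (ι (wordProd x i k)))
      = (↑(∏ c, t (k c))⁻¹ : D) ⊗ₜ[ℂ] St (ι (wordProd x i k)) := by
    intro n
    induction n with
    | zero => intro i k; simp [wordProd_zero, H.st_one, Algebra.TensorProduct.one_def]
    | succ n ih =>
      intro i k
      obtain ⟨a, i, rfl⟩ : ∃ a i', i = Fin.cons a i' := ⟨i 0, Fin.tail i, by simp⟩
      obtain ⟨b, k, rfl⟩ : ∃ a i', k = Fin.cons a i' := ⟨k 0, Fin.tail k, by simp⟩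
      rw [H.st_cons, map_mul, ih, H.leftCoact_antipode_gen hπ,
        Algebra.TensorProduct.tmul_mul_tmul, Fin.prod_univ_succ, mul_inv_rev, Units.val_mul]
      simp
  rw [h1, h2, Algebra.TensorProduct.tmul_mul_tmul, Units.val_mul]

end IsQGL

/-- The coefficient functional of weight zero on the torus. -/
lemma exists_weightZero_functional {N : ℕ} {D : Type} [CommRing D] [Algebra ℂ D] (t : Fin N → Dˣ)
    (hfreeD : ∀ (B : Type) [CommRing B] [Algebra ℂ B] (u : Fin N → Bˣ),
      ∃! φ : D →ₐ[ℂ] B, ∀ i, φ (t i : D) = (u i : B)) :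
    ∃ ζ : D →ₗ[ℂ] ℂ, ∀ (m n : ℕ) (k : Fin m → Fin N) (l : Fin n → Fin N),
      ζ (↑((∏ c, t (k c))⁻¹ * ∏ c, t (l c)) : D) = if wordWt k = wordWt l then 1 else 0 := by
  let u : Multiplicative (Fin N → ℤ) →* (AddMonoidAlgebra ℂ (Fin N → ℤ)) :=
    AddMonoidAlgebra.of ℂ (Fin N → ℤ)
  let v : Multiplicative (Fin N → ℤ) →* (AddMonoidAlgebra ℂ (Fin N → ℤ))ˣ := u.toHomUnits
  obtain ⟨φ, hφ, -⟩ := hfreeD (AddMonoidAlgebra ℂ (Fin N → ℤ))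
    fun i => v (Multiplicative.ofAdd (Pi.single i 1))
  have h1 : ∀ i, Units.map (φ : D →* _) (t i) = v (Multiplicative.ofAdd (Pi.single i 1)) :=
    fun i => Units.ext (hφ i)
  have h2 : ∀ (m n : ℕ) (k : Fin m → Fin N) (l : Fin n → Fin N),
      φ (↑((∏ c, t (k c))⁻¹ * ∏ c, t (l c)) : D)
        = AddMonoidAlgebra.single (-wordWt k + wordWt l) 1 := by
    intro m n k l
    have : Units.map (φ : D →* _) ((∏ c, t (k c))⁻¹ * ∏ c, t (l c))
        = v (Multiplicative.ofAdd (-wordWt k + wordWt l)) := by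
      simp only [map_mul, map_inv, map_prod, h1, wordWt, ofAdd_add, ofAdd_neg, ofAdd_sum]
    exact congrArg Units.val this
  refine ⟨(Finsupp.lapply 0) ∘ₗ (AddMonoidAlgebra.coeffLinearEquiv ℂ).toLinearMap ∘ₗ φ.toLinearMap, ?_⟩
  intro m n k l
  simp only [LinearMap.comp_apply, AlgHom.toLinearMap_apply, h2]
  simp [AddMonoidAlgebra.coeff_single, Finsupp.single_apply, neg_add_eq_zero]

namespace IsQGL

variable {M G : Type} [Ring M] [Algebra ℂ M] [Ring G] [Algebra ℂ G] {N : ℕ} {q : ℂ}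
  {x : Fin N → Fin N → M} {ι : M →ₐ[ℂ] G} {dInv : G} {ΔM : M →ₐ[ℂ] M ⊗[ℂ] M}
  {ΔG : G →ₐ[ℂ] G ⊗[ℂ] G} {εG : G →ₐ[ℂ] ℂ} {St : G →ₗ[ℂ] G}
  {D : Type} [CommRing D] [Algebra ℂ D] {t : Fin N → Dˣ} {πD : G →ₐ[ℂ] D}

/-- Coinvariants lie in the weight zero part. -/
lemma mem_weightZero_of_mem_dCoinv (H : IsQGL q x ι dInv ΔM ΔG εG St)
    (hπ : ∀ i j, πD (ι (x i j)) = if i = j then (t i : D) else 0)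
    (hfreeD : ∀ (B : Type) [CommRing B] [Algebra ℂ B] (u : Fin N → Bˣ),
      ∃! φ : D →ₐ[ℂ] B, ∀ i, φ (t i : D) = (u i : B))
    {f : G} (hf : f ∈ dCoinv πD ΔG) : f ∈ weightZero x ι St := by
  obtain ⟨ζ, hζ⟩ := exists_weightZero_functional t hfreeD
  have hζ1 : ζ 1 = 1 := by
    simpa using hζ 0 0 Fin.elim0 Fin.elim0
  let Pr : G →ₗ[ℂ] G := (TensorProduct.lid ℂ G).toLinearMap ∘ₗ
    TensorProduct.map ζ LinearMap.id ∘ₗ leftCoact πD ΔG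
  have hPr : ∀ y, Pr y ∈ weightZero x ι St := by
    intro y
    have hle : straightSpan x ι St ≤ (weightZero x ι St).comap Pr := by
      refine Submodule.span_le.2 ?_
      rintro _ ⟨m, n, i, k, l, j, rfl⟩
      simp only [SetLike.mem_coe, Submodule.mem_comap, Pr, LinearMap.comp_apply,
        H.leftCoact_word hπ, TensorProduct.map_tmul, hζ, LinearMap.id_apply,
        LinearEquiv.coe_coe, TensorProduct.lid_tmul]
      split_ifs with h
      · obtain rfl := length_eq_of_wordWt_eq h
        rw [one_smul]
        exact Submodule.subset_span ⟨m, i, k, l, j, h, rfl⟩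
      · rw [zero_smul]
        exact zero_mem _
    exact hle (H.straightSpan_eq_top ▸ Submodule.mem_top)
  have hPf : Pr f = f := by
    have hf' : leftCoact πD ΔG f = (1 : D) ⊗ₜ[ℂ] f := hf
    simp [Pr, hf', hζ1]
  exact hPf ▸ hPr f

/-- The co-orbit map of a diagonal point takes values in the coinvariants. -/
lemma coorbit_mem_dCoinv (H : IsQGL q x ι dInv ΔM ΔG εG St)
    (hπ : ∀ i j, πD (ι (x i j)) = if i = j then (t i : D) else 0)
    {e : M →ₐ[ℂ] ℂ} {ξ : Fin N → Fin N → ℂ} (he : ∀ i j, e (x i j) = ξ i j)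
    (hξ : ∀ i j, i ≠ j → ξ i j = 0) (f : M) :
    coorbit e (adjBeta ΔM ι St) f ∈ dCoinv πD ΔG := by
  let V : Submodule ℂ G := LinearMap.ker (leftCoact πD ΔG - TensorProduct.mk ℂ D G 1)
  have hV : ∀ y, y ∈ V ↔ y ∈ dCoinv πD ΔG := fun y => by
    simp [V, dCoinv, sub_eq_zero]
  rw [← hV]
  have hle : (⊤ : Submodule ℂ M) ≤ V.comap (coorbit e (adjBeta ΔM ι St)) := by
    rw [← H.span_word, Submodule.span_le]
    rintro _ ⟨n, i, j, rfl⟩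
    rw [SetLike.mem_coe, Submodule.mem_comap, H.coorbit_word he]
    refine Submodule.sum_mem _ fun k _ => Submodule.sum_mem _ fun l _ => ?_
    by_cases hkl : k = l
    · subst hkl
      refine Submodule.smul_mem _ _ ?_
      rw [hV]
      show leftCoact πD ΔG _ = _
      rw [H.leftCoact_word hπ]
      simp
    · have : wordProd ξ k l = 0 := by
        obtain ⟨c, hc⟩ := Function.ne_iff.1 hkl
        rw [wordProd]
        refine List.prod_eq_zero ?_
        rw [List.mem_ofFn]
        exact ⟨c, hξ _ _ hc⟩
      rw [this, zero_smul]
      exact zero_mem _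
  exact hle Submodule.mem_top

end IsQGL

/-- The matrix `X ⊗ ξ`. -/
def snocMat {R : Type*} [Mul R] {N n : ℕ} (ξ : Fin N → Fin N → R)
    (X : Matrix (Fin n → Fin N) (Fin n → Fin N) R) :
    Matrix (Fin (n + 1) → Fin N) (Fin (n + 1) → Fin N) R :=
  Matrix.of fun k l => X (Fin.init k) (Fin.init l) * ξ (k (Fin.last n)) (l (Fin.last n))

/-- The matrix `1 ⊗ X`. -/
def oneConsMat {R : Type*} [Zero R] {N n : ℕ} (X : Matrix (Fin n → Fin N) (Fin n → Fin N) R) :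
    Matrix (Fin (n + 1) → Fin N) (Fin (n + 1) → Fin N) R :=
  Matrix.of fun k l => if k 0 = l 0 then X (Fin.tail k) (Fin.tail l) else 0

/-- The weighted partial trace of `X` in the first tensor factor. -/
def traceMat {R : Type*} [NonUnitalNonAssocSemiring R] {N n : ℕ} (w : Fin N → R)
    (X : Matrix (Fin (n + 1) → Fin N) (Fin (n + 1) → Fin N) R) :
    Matrix (Fin n → Fin N) (Fin n → Fin N) R :=
  Matrix.of fun k l => ∑ a, w a * X (Fin.cons a k) (Fin.cons a l)

namespace IsQGL

variable {M G : Type} [Ring M] [Algebra ℂ M] [Ring G] [Algebra ℂ G] {N n : ℕ} {q : ℂ}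
  {x : Fin N → Fin N → M} {ι : M →ₐ[ℂ] G} {dInv : G} {ΔM : M →ₐ[ℂ] M ⊗[ℂ] M}
  {ΔG : G →ₐ[ℂ] G ⊗[ℂ] G} {εG : G →ₐ[ℂ] ℂ} {St : G →ₗ[ℂ] G}

/-- The matrix `X` conjugated by the generic matrix. -/
def conjMat (x : Fin N → Fin N → M) (ι : M →ₐ[ℂ] G) (St : G →ₗ[ℂ] G)
    (X : Matrix (Fin n → Fin N) (Fin n → Fin N) ℂ) :
    Matrix (Fin n → Fin N) (Fin n → Fin N) G :=
  sMat x ι St n * X.map (algebraMap ℂ G) * tMat x ι n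

lemma conjMat_apply (X : Matrix (Fin n → Fin N) (Fin n → Fin N) ℂ) (i j : Fin n → Fin N) :
    conjMat x ι St X i j
      = ∑ k, ∑ l, X k l • (St (ι (wordProd x i k)) * ι (wordProd x l j)) := by
  simp only [conjMat, Matrix.mul_apply, Finset.sum_mul, Matrix.map_apply, sMat, tMat,
    Matrix.of_apply]
  rw [Finset.sum_comm]
  refine Finset.sum_congr rfl fun k _ => Finset.sum_congr rfl fun l _ => ?_
  rw [← Algebra.commutes, Algebra.smul_def, mul_assoc]

lemma conjMat_snocMat (H : IsQGL q x ι dInv ΔM ΔG εG St) (ξ : Fin N → Fin N → ℂ)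
    (X : Matrix (Fin n → Fin N) (Fin n → Fin N) ℂ) (a b : Fin N) (i j : Fin n → Fin N) :
    conjMat x ι St (snocMat ξ X) (Fin.snoc i a) (Fin.snoc j b)
      = ∑ c, ∑ d, ξ c d • (St (ι (x a c)) * conjMat x ι St X i j * ι (x d b)) := by
  simp only [conjMat_apply, sum_fin_snoc, H.st_snoc]
  simp only [wordProd_snoc, map_mul, snocMat,
    Matrix.of_apply, Fin.init_snoc, Fin.snoc_last, Finset.mul_sum, Finset.sum_mul, Finset.smul_sum]
  refine Finset.sum_congr rfl fun c _ => ?_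
  rw [Finset.sum_comm]
  refine Finset.sum_congr rfl fun d _ => Finset.sum_congr rfl fun k _ =>
    Finset.sum_congr rfl fun l _ => ?_
  rw [mul_comm, mul_smul, mul_smul_comm, smul_mul_assoc]
  simp only [mul_assoc]

lemma conjMat_oneConsMat (H : IsQGL q x ι dInv ΔM ΔG εG St)
    (X : Matrix (Fin n → Fin N) (Fin n → Fin N) ℂ) (a b : Fin N) (i j : Fin n → Fin N) :
    conjMat x ι St (oneConsMat X) (Fin.cons a i) (Fin.cons b j)
      = if a = b then conjMat x ι St X i j else 0 := by
  simp only [conjMat_apply, sum_fin_cons, H.st_cons]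
  simp only [wordProd_cons, map_mul, oneConsMat,
    Matrix.of_apply, Fin.cons_zero, Fin.tail_cons, ite_smul, zero_smul]
  calc _ = ∑ k, ∑ l, X k l • (St (ι (wordProd x i k)) *
        (∑ c, St (ι (x a c)) * ι (x c b)) * ι (wordProd x l j)) := by
        rw [Finset.sum_comm]
        refine Finset.sum_congr rfl fun k _ => ?_
        simp only [Finset.mul_sum, Finset.sum_mul, Finset.smul_sum]
        rw [Finset.sum_comm (s := Finset.univ (α := Fin n → Fin N))]
        refine Finset.sum_congr rfl fun c _ => ?_
        rw [Finset.sum_comm]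
        refine Finset.sum_congr rfl fun l _ => ?_
        simp only [mul_assoc, Finset.sum_ite_eq, Finset.mem_univ, if_true]
    _ = _ := by
        rw [H.sum_s_t_one]
        split_ifs <;> simp

lemma conjMat_traceMat (H : IsQGL q x ι dInv ΔM ΔG εG St)
    (X : Matrix (Fin (n + 1) → Fin N) (Fin (n + 1) → Fin N) ℂ) (i j : Fin n → Fin N) :
    conjMat x ι St (traceMat (dW q) X) i j
      = ∑ b, dW q b • conjMat x ι St X (Fin.cons b i) (Fin.cons b j) := by
  symm
  simp only [conjMat_apply, sum_fin_cons, H.st_cons]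
  simp only [wordProd_cons, map_mul, traceMat,
    Matrix.of_apply]
  calc _ = ∑ c, ∑ k, ∑ d, ∑ l, X (Fin.cons c k) (Fin.cons d l) • (St (ι (wordProd x i k)) *
        (∑ b, dW q b • (St (ι (x b c)) * ι (x d b))) * ι (wordProd x l j)) := by
        simp only [Finset.mul_sum, Finset.sum_mul, Finset.smul_sum]
        rw [Finset.sum_comm]
        refine Finset.sum_congr rfl fun c _ => ?_
        rw [Finset.sum_comm]
        refine Finset.sum_congr rfl fun k _ => ?_
        rw [Finset.sum_comm]
        refine Finset.sum_congr rfl fun d _ => ?_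
        rw [Finset.sum_comm]
        refine Finset.sum_congr rfl fun l _ => Finset.sum_congr rfl fun b _ => ?_
        rw [smul_comm, mul_smul_comm, smul_mul_assoc]
        simp only [mul_assoc]
    _ = ∑ c, ∑ k, ∑ l, X (Fin.cons c k) (Fin.cons c l) • (St (ι (wordProd x i k)) *
        algebraMap ℂ G (dW q c) * ι (wordProd x l j)) := by
        refine Finset.sum_congr rfl fun c _ => Finset.sum_congr rfl fun k _ => ?_
        rw [Fintype.sum_eq_single c]
        · simp only [H.sum_dW, if_true]
        · intro d hd
          simp only [H.sum_dW, if_neg hd.symm]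
          simp
    _ = _ := by
        rw [Finset.sum_comm]
        refine Finset.sum_congr rfl fun k _ => ?_
        rw [Finset.sum_comm]
        refine Finset.sum_congr rfl fun l _ => ?_
        rw [Finset.sum_smul]
        refine Finset.sum_congr rfl fun c _ => ?_
        rw [← Algebra.commutes, mul_assoc, ← Algebra.smul_def, smul_smul, mul_comm]

/-- The matrices of weight zero whose conjugates by the generic matrix have entries in `V`. -/
def orbMat (x : Fin N → Fin N → M) (ι : M →ₐ[ℂ] G) (St : G →ₗ[ℂ] G) (V : Submodule ℂ G) (n : ℕ) :
    Submodule ℂ (Matrix (Fin n → Fin N) (Fin n → Fin N) ℂ) where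
  carrier := {X | (∀ k l, wordWt k ≠ wordWt l → X k l = 0) ∧ ∀ i j, conjMat x ι St X i j ∈ V}
  zero_mem' := ⟨fun _ _ _ => rfl, fun i j => by simp [conjMat_apply]⟩
  add_mem' := fun {X Y} hX hY => ⟨fun k l h => by simp [hX.1 k l h, hY.1 k l h], fun i j => by
    have : conjMat x ι St (X + Y) i j = conjMat x ι St X i j + conjMat x ι St Y i j := by
      simp [conjMat_apply, add_smul, Finset.sum_add_distrib]
    exact this ▸ V.add_mem (hX.2 i j) (hY.2 i j)⟩
  smul_mem' := fun c X hX => ⟨fun k l h => by simp [hX.1 k l h], fun i j => by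
    have : conjMat x ι St (c • X) i j = c • conjMat x ι St X i j := by
      simp [conjMat_apply, mul_smul, Finset.smul_sum]
    exact this ▸ V.smul_mem c (hX.2 i j)⟩

variable {V : Submodule ℂ G}

lemma snocMat_mem_orbMat (H : IsQGL q x ι dInv ΔM ΔG εG St) {ξ : Fin N → Fin N → ℂ}
    (hξ : ∀ i j, i ≠ j → ξ i j = 0)
    (hV : ∀ f ∈ V, ∀ i j, ∑ k, ∑ l, ξ k l • (St (ι (x i k)) * f * ι (x l j)) ∈ V)
    {X : Matrix (Fin n → Fin N) (Fin n → Fin N) ℂ} (hX : X ∈ orbMat x ι St V n) :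
    snocMat ξ X ∈ orbMat x ι St V (n + 1) := by
  refine ⟨fun k l h => ?_, fun i j => ?_⟩
  · rw [← Fin.snoc_init_self k, ← Fin.snoc_init_self l, wordWt_snoc, wordWt_snoc] at h
    rw [snocMat, Matrix.of_apply]
    by_cases h1 : k (Fin.last n) = l (Fin.last n)
    · rw [hX.1 _ _ fun h2 => h (by rw [h1, h2]), zero_mul]
    · rw [hξ _ _ h1, mul_zero]
  · rw [← Fin.snoc_init_self i, ← Fin.snoc_init_self j, H.conjMat_snocMat]
    exact hV _ (hX.2 _ _) _ _

lemma oneConsMat_mem_orbMat (H : IsQGL q x ι dInv ΔM ΔG εG St)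
    {X : Matrix (Fin n → Fin N) (Fin n → Fin N) ℂ} (hX : X ∈ orbMat x ι St V n) :
    oneConsMat X ∈ orbMat x ι St V (n + 1) := by
  refine ⟨fun k l h => ?_, fun i j => ?_⟩
  · rw [← Fin.cons_self_tail k, ← Fin.cons_self_tail l, wordWt_cons, wordWt_cons] at h
    rw [oneConsMat, Matrix.of_apply]
    split_ifs with h1
    · exact hX.1 _ _ fun h2 => h (by rw [h1, h2])
    · rfl
  · rw [← Fin.cons_self_tail i, ← Fin.cons_self_tail j, H.conjMat_oneConsMat]
    split_ifs
    · exact hX.2 _ _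
    · exact zero_mem _

lemma traceMat_mem_orbMat (H : IsQGL q x ι dInv ΔM ΔG εG St)
    {X : Matrix (Fin (n + 1) → Fin N) (Fin (n + 1) → Fin N) ℂ} (hX : X ∈ orbMat x ι St V (n + 1)) :
    traceMat (dW q) X ∈ orbMat x ι St V n := by
  refine ⟨fun k l h => ?_, fun i j => ?_⟩
  · rw [traceMat, Matrix.of_apply]
    refine Finset.sum_eq_zero fun a _ => ?_
    rw [hX.1 _ _ (by rw [wordWt_cons, wordWt_cons]; exact fun h' => h (add_left_cancel h')),
      mul_zero]
  · rw [H.conjMat_traceMat]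
    exact V.sum_mem fun b _ => V.smul_mem _ (hX.2 _ _)

lemma braidMat_eq_zero (a b : Fin n) (k l : Fin n → Fin N) (h : wordWt k ≠ wordWt l) :
    braidMat q a b k l = 0 := by
  rw [braidMat, Matrix.of_apply, if_neg, if_neg, add_zero]
  · rintro rfl; exact h rfl
  · rintro rfl; exact h (wordWt_comp_perm _ _).symm

lemma commBraid_tMat (H : IsQGL q x ι dInv ΔM ΔG εG St) (n : ℕ) : CommBraid q (tMat x ι n) := by
  refine commBraid_iff.2 fun a b hab l j => ?_
  have := congrArg ι (H.rel.word_exchange H.q_ne a b hab l j)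
  simpa [tMat] using this

lemma braidMat_mul_mem_orbMat (H : IsQGL q x ι dInv ΔM ΔG εG St) {a b : Fin n}
    (hab : a.1 + 1 = b.1) {X : Matrix (Fin n → Fin N) (Fin n → Fin N) ℂ}
    (hX : X ∈ orbMat x ι St V n) : braidMat q a b * X ∈ orbMat x ι St V n := by
  have hS := H.commBraid_tMat n |>.inverse (H.tMat_mul_sMat n) (H.sMat_mul_tMat n)
  refine ⟨fun k l h => ?_, fun i j => ?_⟩
  · rw [Matrix.mul_apply]
    refine Finset.sum_eq_zero fun m _ => ?_
    by_cases h1 : wordWt k = wordWt m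
    · rw [hX.1 m l (h1 ▸ h), mul_zero]
    · rw [braidMat_eq_zero a b k m h1, zero_mul]
  · have : conjMat x ι St (braidMat q a b * X)
        = (braidMat q a b).map (algebraMap ℂ G) * conjMat x ι St X := by
      rw [conjMat, conjMat, Matrix.map_mul, ← mul_assoc, ← (hS a b hab).eq]
      simp only [mul_assoc]
    rw [this, Matrix.mul_apply]
    refine V.sum_mem fun m _ => ?_
    rw [Matrix.map_apply, ← Algebra.smul_def]
    exact V.smul_mem _ (hX.2 _ _)

lemma mul_braidMat_mem_orbMat (H : IsQGL q x ι dInv ΔM ΔG εG St) {a b : Fin n}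
    (hab : a.1 + 1 = b.1) {X : Matrix (Fin n → Fin N) (Fin n → Fin N) ℂ}
    (hX : X ∈ orbMat x ι St V n) : X * braidMat q a b ∈ orbMat x ι St V n := by
  refine ⟨fun k l h => ?_, fun i j => ?_⟩
  · rw [Matrix.mul_apply]
    refine Finset.sum_eq_zero fun m _ => ?_
    by_cases h1 : wordWt k = wordWt m
    · rw [braidMat_eq_zero a b m l (h1 ▸ h), mul_zero]
    · rw [hX.1 k m h1, zero_mul]
  · have : conjMat x ι St (X * braidMat q a b)
        = conjMat x ι St X * (braidMat q a b).map (algebraMap ℂ G) := by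
      rw [conjMat, conjMat, Matrix.map_mul, mul_assoc, mul_assoc, (H.commBraid_tMat n a b hab).eq]
      simp only [mul_assoc]
    rw [this, Matrix.mul_apply]
    refine V.sum_mem fun m _ => ?_
    rw [Matrix.map_apply, ← Algebra.commutes, ← Algebra.smul_def]
    exact V.smul_mem _ (hX.2 _ _)

end IsQGL

namespace IsQGL

variable {M G : Type} [Ring M] [Algebra ℂ M] [Ring G] [Algebra ℂ G] {N n : ℕ} {q : ℂ}
  {x : Fin N → Fin N → M} {ι : M →ₐ[ℂ] G} {dInv : G} {ΔM : M →ₐ[ℂ] M ⊗[ℂ] M}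
  {ΔG : G →ₐ[ℂ] G ⊗[ℂ] G} {εG : G →ₐ[ℂ] ℂ} {St : G →ₗ[ℂ] G}

/-- The reductions of the integral matrices in `orbMat`. -/
def redMat (O : ValuationSubring ℂ) (x : Fin N → Fin N → M) (ι : M →ₐ[ℂ] G) (St : G →ₗ[ℂ] G)
    (V : Submodule ℂ G) (n : ℕ) :
    Submodule (IsLocalRing.ResidueField O)
      (Matrix (Fin n → Fin N) (Fin n → Fin N) (IsLocalRing.ResidueField O)) where
  carrier := {Y | ∃ X ∈ orbMat x ι St V n, ∀ k l, (X k l, Y k l) ∈ redPair O}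
  zero_mem' := ⟨0, zero_mem _, fun _ _ => redPair.zero⟩
  add_mem' := fun ⟨X, hX, h⟩ ⟨X', hX', h'⟩ =>
    ⟨X + X', add_mem hX hX', fun k l => redPair.add (h k l) (h' k l)⟩
  smul_mem' := fun c _ ⟨X, hX, h⟩ => by
    obtain ⟨c, rfl⟩ := IsLocalRing.residue_surjective c
    exact ⟨(c : ℂ) • X, Submodule.smul_mem _ _ hX,
      fun k l => redPair.mul (redPair_coe c) (h k l)⟩

variable {V : Submodule ℂ G} {O : ValuationSubring ℂ}

lemma snocMat_mem_redMat (H : IsQGL q x ι dInv ΔM ΔG εG St) {ξ : Fin N → Fin N → ℂ}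
    (hξ : ∀ i j, i ≠ j → ξ i j = 0) {η : Fin N → Fin N → IsLocalRing.ResidueField O}
    (hη : ∀ i j, (ξ i j, η i j) ∈ redPair O)
    (hV : ∀ f ∈ V, ∀ i j, ∑ k, ∑ l, ξ k l • (St (ι (x i k)) * f * ι (x l j)) ∈ V)
    {Y : Matrix (Fin n → Fin N) (Fin n → Fin N) (IsLocalRing.ResidueField O)}
    (hY : Y ∈ redMat O x ι St V n) : snocMat η Y ∈ redMat O x ι St V (n + 1) := by
  obtain ⟨X, hX, h⟩ := hY
  exact ⟨_, H.snocMat_mem_orbMat hξ hV hX, fun k l => redPair.mul (h _ _) (hη _ _)⟩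

lemma oneConsMat_mem_redMat (H : IsQGL q x ι dInv ΔM ΔG εG St)
    {Y : Matrix (Fin n → Fin N) (Fin n → Fin N) (IsLocalRing.ResidueField O)}
    (hY : Y ∈ redMat O x ι St V n) : oneConsMat Y ∈ redMat O x ι St V (n + 1) := by
  obtain ⟨X, hX, h⟩ := hY
  refine ⟨_, H.oneConsMat_mem_orbMat hX, fun k l => ?_⟩
  rw [oneConsMat, oneConsMat, Matrix.of_apply, Matrix.of_apply]
  split_ifs
  · exact h _ _
  · exact redPair.zero

lemma traceMat_mem_redMat (H : IsQGL q x ι dInv ΔM ΔG εG St)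
    (hq1 : (q, (1 : IsLocalRing.ResidueField O)) ∈ redPair O)
    {Y : Matrix (Fin (n + 1) → Fin N) (Fin (n + 1) → Fin N) (IsLocalRing.ResidueField O)}
    (hY : Y ∈ redMat O x ι St V (n + 1)) : traceMat 1 Y ∈ redMat O x ι St V n := by
  obtain ⟨X, hX, h⟩ := hY
  refine ⟨_, H.traceMat_mem_orbMat hX, fun k l => ?_⟩
  rw [traceMat, traceMat, Matrix.of_apply, Matrix.of_apply]
  refine redPair.sum fun a _ => redPair.mul ?_ (h _ _)
  simpa [dW] using redPair.pow (redPair.inv hq1 one_ne_zero) (2 * (a.1 + 1))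

lemma braidC_redPair (hq1 : (q, (1 : IsLocalRing.ResidueField O)) ∈ redPair O) (a b : Fin n)
    (l : Fin n → Fin N) : (braidC q a b l, (1 : IsLocalRing.ResidueField O)) ∈ redPair O := by
  rw [braidC]
  split_ifs
  · exact hq1
  · exact redPair.one

lemma braidH_redPair (hq1 : (q, (1 : IsLocalRing.ResidueField O)) ∈ redPair O) (a b : Fin n)
    (l : Fin n → Fin N) : (braidH q a b l, (0 : IsLocalRing.ResidueField O)) ∈ redPair O := by
  rw [braidH]
  split_ifs
  · have := redPair.add hq1 (redPair.neg (redPair.inv hq1 one_ne_zero))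
    simpa [sub_eq_add_neg] using this
  · exact redPair.zero

/-- A set of permutations closed under composition which contains the adjacent transpositions. -/
lemma perm_induction {P : Equiv.Perm (Fin n) → Prop} (h1 : P 1)
    (hmul : ∀ σ τ, P σ → P τ → P (σ * τ))
    (hswap : ∀ a b : Fin n, a.1 + 1 = b.1 → P (Equiv.swap a b)) (σ : Equiv.Perm (Fin n)) : P σ := by
  cases n with
  | zero => rwa [Subsingleton.elim σ 1]
  | succ n =>
    have hσ : σ ∈ Submonoid.closure
        (Set.range fun i : Fin n => Equiv.swap i.castSucc i.succ) := by
      rw [Equiv.Perm.mclosure_swap_castSucc_succ]; trivial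
    induction hσ using Submonoid.closure_induction with
    | mem τ h =>
      obtain ⟨i, rfl⟩ := h
      exact hswap _ _ (by simp)
    | one => exact h1
    | mul σ τ _ _ h h' => exact hmul σ τ h h'

lemma submatrix_row_mem_redMat (H : IsQGL q x ι dInv ΔM ΔG εG St)
    (hq1 : (q, (1 : IsLocalRing.ResidueField O)) ∈ redPair O) (σ : Equiv.Perm (Fin n)) :
    ∀ Y ∈ redMat O x ι St V n, Y.submatrix (fun k => k ∘ σ) id ∈ redMat O x ι St V n := by
  refine perm_induction (P := fun σ => ∀ Y ∈ redMat O x ι St V n,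
    Y.submatrix (fun k => k ∘ σ) id ∈ redMat O x ι St V n) (fun Y hY => hY) (fun σ τ hσ hτ Y hY => hσ _ (hτ _ hY)) ?_ σ
  rintro a b hab Y ⟨X, hX, h⟩
  refine ⟨_, H.braidMat_mul_mem_orbMat hab hX, fun k l => ?_⟩
  have := sum_braidMat_smul q a b k (fun m => X m l)
  simp only [smul_eq_mul] at this
  rw [Matrix.mul_apply, this]
  have := redPair.add (redPair.mul (braidC_redPair hq1 a b k) (h (k ∘ Equiv.swap a b) l))
    (redPair.mul (braidH_redPair hq1 a b k) (h k l))
  simpa using this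

lemma submatrix_col_mem_redMat (H : IsQGL q x ι dInv ΔM ΔG εG St)
    (hq1 : (q, (1 : IsLocalRing.ResidueField O)) ∈ redPair O) (σ : Equiv.Perm (Fin n)) :
    ∀ Y ∈ redMat O x ι St V n, Y.submatrix id (fun k => k ∘ σ) ∈ redMat O x ι St V n := by
  refine perm_induction (P := fun σ => ∀ Y ∈ redMat O x ι St V n,
    Y.submatrix id (fun k => k ∘ σ) ∈ redMat O x ι St V n) (fun Y hY => hY) (fun σ τ hσ hτ Y hY => hσ _ (hτ _ hY)) ?_ σ
  rintro a b hab Y ⟨X, hX, h⟩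
  refine ⟨_, H.mul_braidMat_mem_orbMat hab hX, fun k l => ?_⟩
  have := sum_braidMat_smul q a b l (fun m => X k m)
  simp only [smul_eq_mul] at this
  have h2 : (X * braidMat q a b : Matrix (Fin n → Fin N) (Fin n → Fin N) ℂ) k l
      = braidC q a b l * X k (l ∘ Equiv.swap a b) + braidH q a b l * X k l := by
    rw [Matrix.mul_apply, ← this]
    exact Finset.sum_congr rfl fun m _ => by rw [mul_comm, braidMat_symm]
  rw [h2]
  have := redPair.add (redPair.mul (braidC_redPair hq1 a b l) (h k (l ∘ Equiv.swap a b)))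
    (redPair.mul (braidH_redPair hq1 a b l) (h k l))
  simpa using this

/-- Multiplying the rows by the eigenvalue of the first letter. -/
lemma eigen_mul_mem_redMat (H : IsQGL q x ι dInv ΔM ΔG εG St)
    (hq1 : (q, (1 : IsLocalRing.ResidueField O)) ∈ redPair O) {ξ : Fin N → Fin N → ℂ}
    (hξ : ∀ i j, i ≠ j → ξ i j = 0) {η : Fin N → Fin N → IsLocalRing.ResidueField O}
    (hη : ∀ i j, (ξ i j, η i j) ∈ redPair O)
    (hV : ∀ f ∈ V, ∀ i j, ∑ k, ∑ l, ξ k l • (St (ι (x i k)) * f * ι (x l j)) ∈ V)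
    {Y : Matrix (Fin (n + 1) → Fin N) (Fin (n + 1) → Fin N) (IsLocalRing.ResidueField O)}
    (hY : Y ∈ redMat O x ι St V (n + 1)) :
    (Matrix.of fun m l => η (m 0) (m 0) * Y m l) ∈ redMat O x ι St V (n + 1) := by
  have hη0 : ∀ i j, i ≠ j → η i j = 0 := fun i j hij =>
    redPair.fun (hη i j) (by rw [hξ i j hij]; exact redPair.zero)
  have h1 := H.submatrix_col_mem_redMat hq1 (finRotate (n + 2)) _
    (H.submatrix_row_mem_redMat hq1 (Equiv.swap 0 1 * finRotate (n + 2)) _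
      (H.snocMat_mem_redMat hξ hη hV hY))
  convert H.traceMat_mem_redMat hq1 h1 using 1
  ext m l
  have h2 : ∀ c, (Fin.cons c l : Fin (n + 2) → Fin N) ∘ finRotate (n + 2) = Fin.snoc l c :=
    fun c => (Fin.snoc_eq_cons_rotate l c).symm
  have h3 : ∀ c, (Fin.cons c m : Fin (n + 2) → Fin N) ∘ ⇑(Equiv.swap (0 : Fin (n + 2)) 1 * finRotate (n + 2))
      = Fin.snoc (Fin.cons c (Fin.tail m) : Fin (n + 1) → Fin N) (m 0) := by
    intro c
    have h4 : (Fin.cons c m : Fin (n + 2) → Fin N) ∘ Equiv.swap (0 : Fin (n + 2)) 1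
        = Fin.cons (m 0) (Fin.cons c (Fin.tail m) : Fin (n + 1) → Fin N) := by
      funext i
      refine Fin.cases ?_ (fun i => ?_) i
      · rw [Function.comp, Equiv.swap_apply_left]; rfl
      · refine Fin.cases ?_ (fun i => ?_) i
        · show (Fin.cons c m : Fin (n + 2) → Fin N) (Equiv.swap (0 : Fin (n + 2)) 1 1) = _
          rw [Equiv.swap_apply_right]; rfl
        · rw [Function.comp, Equiv.swap_apply_of_ne_of_ne (by simp)
            (by rw [← Fin.succ_zero_eq_one, Ne, Fin.succ_inj]; simp)]
          rfl
    rw [Equiv.Perm.coe_mul, ← Function.comp_assoc, h4]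
    exact (Fin.snoc_eq_cons_rotate _ _).symm
  simp only [traceMat, Matrix.of_apply, Matrix.submatrix_apply, id, h2, h3, snocMat, Fin.init_snoc,
    Fin.snoc_last, Pi.one_apply, one_mul]
  rw [Fintype.sum_eq_single (m 0)]
  · rw [Fin.cons_self_tail, mul_comm]
  · intro c hc
    rw [hη0 _ _ hc.symm, mul_zero]

lemma prod_eigen_mul_mem_redMat (H : IsQGL q x ι dInv ΔM ΔG εG St)
    (hq1 : (q, (1 : IsLocalRing.ResidueField O)) ∈ redPair O) {ξ : Fin N → Fin N → ℂ}
    (hξ : ∀ i j, i ≠ j → ξ i j = 0) {η : Fin N → Fin N → IsLocalRing.ResidueField O}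
    (hη : ∀ i j, (ξ i j, η i j) ∈ redPair O)
    (hV : ∀ f ∈ V, ∀ i j, ∑ k, ∑ l, ξ k l • (St (ι (x i k)) * f * ι (x l j)) ∈ V)
    {Y : Matrix (Fin (n + 1) → Fin N) (Fin (n + 1) → Fin N) (IsLocalRing.ResidueField O)}
    (hY : Y ∈ redMat O x ι St V (n + 1)) (s : Finset (Fin N)) :
    (Matrix.of fun m l => (∏ c ∈ s, (η (m 0) (m 0) - η c c)) * Y m l)
      ∈ redMat O x ι St V (n + 1) := by
  classical
  induction s using Finset.induction_on with
  | empty => convert hY using 1; ext m l; simp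
  | insert a s ha ih =>
    have := sub_mem (H.eigen_mul_mem_redMat hq1 hξ hη hV ih) (Submodule.smul_mem _ (η a a) ih)
    convert this using 1
    ext m l
    simp [Finset.prod_insert ha, sub_mul, mul_assoc]

lemma single_mem_redMat (H : IsQGL q x ι dInv ΔM ΔG εG St)
    (hq1 : (q, (1 : IsLocalRing.ResidueField O)) ∈ redPair O) {ξ : Fin N → Fin N → ℂ}
    (hξ : ∀ i j, i ≠ j → ξ i j = 0) {η : Fin N → Fin N → IsLocalRing.ResidueField O}
    (hη : ∀ i j, (ξ i j, η i j) ∈ redPair O) (hinj : Function.Injective fun i => η i i)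
    (hV : ∀ f ∈ V, ∀ i j, ∑ k, ∑ l, ξ k l • (St (ι (x i k)) * f * ι (x l j)) ∈ V) (hV1 : 1 ∈ V)
    (k : Fin n → Fin N) : Matrix.single k k 1 ∈ redMat O x ι St V n := by
  induction n with
  | zero =>
    refine ⟨1, ⟨fun k l h => (h (by rw [Subsingleton.elim k l])).elim, fun i j => ?_⟩, fun i j => ?_⟩
    · simpa [conjMat_apply, wordProd_zero, H.st_one, Subsingleton.elim _ (default : Fin 0 → Fin N)]
        using hV1
    · have h1 : k = i := Subsingleton.elim _ _
      have h2 : i = j := Subsingleton.elim _ _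
      subst h1 h2
      simpa using redPair.one
  | succ n ih =>
    have h1 := H.prod_eigen_mul_mem_redMat hq1 hξ hη hV (H.oneConsMat_mem_redMat (ih (Fin.tail k)))
      (Finset.univ.erase (k 0))
    set c := ∏ c ∈ Finset.univ.erase (k 0), (η (k 0) (k 0) - η c c) with hc
    have hc0 : c ≠ 0 := Finset.prod_ne_zero_iff.2 fun a ha =>
      sub_ne_zero.2 fun h => Finset.ne_of_mem_erase ha (hinj h).symm
    convert Submodule.smul_mem _ c⁻¹ h1 using 1
    ext m l
    rw [Matrix.smul_apply, Matrix.of_apply]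
    by_cases h0 : m 0 = k 0
    · rw [h0, ← hc, smul_eq_mul, inv_mul_cancel_left₀ hc0, oneConsMat, Matrix.of_apply, h0]
      have hm : k = m ↔ Fin.tail k = Fin.tail m := by
        rw [← Fin.cons_self_tail k, ← Fin.cons_self_tail m, fin_cons_inj_iff]
        simp [h0]
      have hl : k = l ↔ k 0 = l 0 ∧ Fin.tail k = Fin.tail l := by
        conv_lhs => rw [← Fin.cons_self_tail k, ← Fin.cons_self_tail l]
        rw [fin_cons_inj_iff]
      simp only [Matrix.single_apply, hm, hl]
      grind
    · rw [Finset.prod_eq_zero (i := m 0) (by simpa using h0) (sub_self _), zero_mul, smul_zero,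
        Matrix.single_apply_of_row_ne (fun h => h0 (by rw [h]))]

lemma single_mem_redMat_of_wordWt_eq (H : IsQGL q x ι dInv ΔM ΔG εG St)
    (hq1 : (q, (1 : IsLocalRing.ResidueField O)) ∈ redPair O) {ξ : Fin N → Fin N → ℂ}
    (hξ : ∀ i j, i ≠ j → ξ i j = 0) {η : Fin N → Fin N → IsLocalRing.ResidueField O}
    (hη : ∀ i j, (ξ i j, η i j) ∈ redPair O) (hinj : Function.Injective fun i => η i i)
    (hV : ∀ f ∈ V, ∀ i j, ∑ k, ∑ l, ξ k l • (St (ι (x i k)) * f * ι (x l j)) ∈ V) (hV1 : 1 ∈ V)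
    {k l : Fin n → Fin N} (h : wordWt k = wordWt l) :
    Matrix.single k l 1 ∈ redMat O x ι St V n := by
  obtain ⟨σ, rfl⟩ := exists_perm_of_wordWt_eq h
  convert H.submatrix_col_mem_redMat hq1 σ⁻¹ _
    (H.single_mem_redMat hq1 hξ hη hinj hV hV1 k) using 1
  ext m l
  have : k ∘ σ = l ↔ k = l ∘ ⇑σ⁻¹ := by
    constructor
    · rintro rfl; funext c; simp
    · rintro rfl; funext c; simp
  simp [Matrix.single_apply, this]

lemma single_mem_orbMat (H : IsQGL q x ι dInv ΔM ΔG εG St)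
    (hq1 : (q, (1 : IsLocalRing.ResidueField O)) ∈ redPair O) {ξ : Fin N → Fin N → ℂ}
    (hξ : ∀ i j, i ≠ j → ξ i j = 0) {η : Fin N → Fin N → IsLocalRing.ResidueField O}
    (hη : ∀ i j, (ξ i j, η i j) ∈ redPair O) (hinj : Function.Injective fun i => η i i)
    (hV : ∀ f ∈ V, ∀ i j, ∑ k, ∑ l, ξ k l • (St (ι (x i k)) * f * ι (x l j)) ∈ V) (hV1 : 1 ∈ V)
    {k l : Fin n → Fin N} (h : wordWt k = wordWt l) :
    Matrix.single k l 1 ∈ orbMat x ι St V n := by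
  classical
  let P := {p : (Fin n → Fin N) × (Fin n → Fin N) // wordWt p.1 = wordWt p.2}
  have hF : ∀ p : P, ∃ X ∈ orbMat x ι St V n, ∀ k l,
      (X k l, (Matrix.single p.1.1 p.1.2 1 : Matrix _ _ (IsLocalRing.ResidueField O)) k l)
        ∈ redPair O :=
    fun p => H.single_mem_redMat_of_wordWt_eq hq1 hξ hη hinj hV hV1 p.2
  choose F hF1 hF2 using hF
  have hu : ∀ p r : P, ∃ u : O, (u : ℂ) = F p r.1.1 r.1.2 ∧
      IsLocalRing.residue O u = if p = r then 1 else 0 := by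
    intro p r
    obtain ⟨u, hu⟩ := hF2 p r.1.1 r.1.2
    have h1 := Prod.ext_iff.1 hu
    refine ⟨u, h1.1, h1.2.trans ?_⟩
    rw [Matrix.single_apply]
    exact if_congr (by rw [← Prod.ext_iff, ← Subtype.ext_iff]) rfl rfl
  choose u hu1 hu2 using hu
  let A : Matrix P P O := Matrix.of u
  have hA : A.det ≠ 0 := by
    intro h0
    have h1 := (IsLocalRing.residue O).map_det A
    rw [h0, map_zero] at h1
    have h2 : (IsLocalRing.residue O).mapMatrix A = 1 := by
      ext p r
      simp [A, hu2, Matrix.one_apply]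
    rw [h2, Matrix.det_one] at h1
    exact zero_ne_one h1
  let B : Matrix P P ℂ := O.subtype.mapMatrix A
  have hB : IsUnit B.det := by
    rw [isUnit_iff_ne_zero, ← RingHom.map_det]
    simpa using hA
  have hsum : Matrix.single k l 1 = ∑ p, B⁻¹ ⟨(k, l), h⟩ p • F p := by
    ext m r
    rw [Matrix.sum_apply]
    by_cases hmr : wordWt m = wordWt r
    · have h1 := congrFun (congrFun (Matrix.nonsing_inv_mul B hB) ⟨(k, l), h⟩) ⟨(m, r), hmr⟩
      rw [Matrix.mul_apply] at h1
      rw [Matrix.single_apply]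
      simp only [Matrix.smul_apply, smul_eq_mul]
      have h2 : ∀ p, B p ⟨(m, r), hmr⟩ = F p m r := fun p => hu1 p ⟨(m, r), hmr⟩
      simp only [h2] at h1
      rw [h1, Matrix.one_apply]
      exact if_congr (by rw [Subtype.ext_iff, Prod.ext_iff]) rfl rfl
    · rw [Matrix.single_apply, if_neg, Finset.sum_eq_zero]
      · intro p _
        rw [Matrix.smul_apply, (hF1 p).1 m r hmr, smul_zero]
      · rintro ⟨rfl, rfl⟩
        exact hmr h
  rw [hsum]
  exact sum_mem fun p _ => Submodule.smul_mem _ _ (hF1 p)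

/-- The weight zero part is contained in the image of the co-orbit map. -/
lemma weightZero_le (H : IsQGL q x ι dInv ΔM ΔG εG St)
    (hq1 : (q, (1 : IsLocalRing.ResidueField O)) ∈ redPair O) {ξ : Fin N → Fin N → ℂ}
    (hξ : ∀ i j, i ≠ j → ξ i j = 0) {η : Fin N → Fin N → IsLocalRing.ResidueField O}
    (hη : ∀ i j, (ξ i j, η i j) ∈ redPair O) (hinj : Function.Injective fun i => η i i)
    (hV : ∀ f ∈ V, ∀ i j, ∑ k, ∑ l, ξ k l • (St (ι (x i k)) * f * ι (x l j)) ∈ V) (hV1 : 1 ∈ V) :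
    weightZero x ι St ≤ V := by
  refine Submodule.span_le.2 ?_
  rintro _ ⟨n, i, k, l, j, h, rfl⟩
  have h1 := (H.single_mem_orbMat hq1 hξ hη hinj hV hV1 h).2 i j
  rw [conjMat_apply, Fintype.sum_eq_single k, Fintype.sum_eq_single l] at h1
  · simpa using h1
  · intro r hr
    rw [Matrix.single_apply, if_neg fun h => hr h.2.symm, zero_smul]
  · intro r hr
    refine Finset.sum_eq_zero fun l _ => ?_
    rw [Matrix.single_apply, if_neg fun h => hr h.1.symm, zero_smul]

end IsQGL

lemma krylov_diagonal {R : Type*} [CommRing R] {N : ℕ} (v d : Fin N → R) :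
    krylov v (Matrix.diagonal d) = (Matrix.vandermonde d).transpose * Matrix.diagonal v := by
  ext i j
  rw [krylov, Matrix.of_apply, Matrix.diagonal_pow, Matrix.vecMul_diagonal,
    Matrix.mul_diagonal, Matrix.transpose_apply, Matrix.vandermonde_apply, mul_comm, Pi.pow_apply]

lemma injective_of_krylov_diagonal {R : Type*} [CommRing R] [IsDomain R] {N : ℕ} {v d : Fin N → R}
    (h : (krylov v (Matrix.diagonal d)).det ≠ 0) : Function.Injective d := by
  rw [krylov_diagonal, Matrix.det_mul, Matrix.det_transpose] at h
  exact Matrix.det_vandermonde_ne_zero_iff.1 (left_ne_zero_of_mul h)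

lemma map_qdet {M B : Type} [Ring M] [Algebra ℂ M] [Ring B] [Algebra ℂ B] {N : ℕ} (q : ℂ)
    (φ : M →ₐ[ℂ] B) (x : Fin N → Fin N → M) :
    φ (qdet q x) = qdet q fun i j => φ (x i j) := by
  simp [qdet, qMinor, map_list_prod, List.map_map, Function.comp_def]

namespace IsQGL

variable {M G : Type} [Ring M] [Algebra ℂ M] [Ring G] [Algebra ℂ G] {N : ℕ} {q : ℂ}
  {x : Fin N → Fin N → M} {ι : M →ₐ[ℂ] G} {dInv : G} {ΔM : M →ₐ[ℂ] M ⊗[ℂ] M}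
  {ΔG : G →ₐ[ℂ] G ⊗[ℂ] G} {εG : G →ₐ[ℂ] ℂ} {St : G →ₗ[ℂ] G}
  {D : Type} [CommRing D] [Algebra ℂ D] {t : Fin N → Dˣ} {πD : G →ₐ[ℂ] D}

/-- The image of the co-orbit map of a regular diagonal point. -/
theorem range_coorbit {K : Subfield ℂ} (hq : Transcendental K q)
    (H : IsQGL q x ι dInv ΔM ΔG εG St)
    (hπ : ∀ i j, πD (ι (x i j)) = if i = j then (t i : D) else 0)
    (hfreeD : ∀ (B : Type) [CommRing B] [Algebra ℂ B] (u : Fin N → Bˣ),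
      ∃! φ : D →ₐ[ℂ] B, ∀ i, φ (t i : D) = (u i : B))
    {e : M →ₐ[ℂ] ℂ} {d : Fin N → K} (hd : Function.Injective d)
    (he : ∀ i j, e (x i j) = if i = j then (d i : ℂ) else 0) :
    Set.range ⇑(coorbit e (adjBeta ΔM ι St)) = dCoinv πD ΔG := by
  obtain ⟨O, hqO, hKO, hres⟩ := exists_place K hq
  have hq1 : (q, (1 : IsLocalRing.ResidueField O)) ∈ redPair O := by
    rw [← hres]; exact redPair_coe (O := O) ⟨q, hqO⟩
  have hξ : ∀ i j, i ≠ j → (fun i j : Fin N => if i = j then (d i : ℂ) else 0) i j = 0 :=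
    fun i j h => if_neg h
  refine Set.Subset.antisymm ?_ fun f hf => ?_
  · rintro _ ⟨f, rfl⟩
    exact H.coorbit_mem_dCoinv hπ he hξ f
  · refine H.weightZero_le (V := LinearMap.range (coorbit e (adjBeta ΔM ι St))) hq1 hξ
      (η := fun i j => if i = j then resHom hKO (d i) else 0) (fun i j => ?_) ?_ ?_
      ⟨1, H.coorbit_one he⟩ (H.mem_weightZero_of_mem_dCoinv hπ hfreeD hf)
    · split_ifs
      · exact resHom_mem hKO _
      · exact redPair.zero
    · intro i j hij
      exact hd ((resHom hKO).injective (by simpa using hij))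
    · rintro _ ⟨f, rfl⟩ i j
      exact ⟨f * x i j, H.coorbit_mul_gen he f i j⟩

end IsQGL

/-- If `q` is transcendental over the subfield `K` generated by the entries of `ξ` and
the centralizer of `ξ` in `M(N,K)` has dimension `N`, then the kernel of `β^ξ` is the
right ideal generated by the `τᵢ - τᵢ(ξ)`; if moreover `ξ` is diagonal, the image of
`β^ξ` is `O(D\GL_q)`. -/
theorem coorbit_generic_complex
    {N : ℕ} (q : ℂ) (hq : q ≠ 0)
    (M G : Type) [Ring M] [Algebra ℂ M] [Ring G] [Algebra ℂ G]
    (x : Fin N → Fin N → M)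
    (hrow : ∀ i j l : Fin N, j < l → x i j * x i l = (q) • (x i l * x i j))
    (hcol : ∀ i k j : Fin N, i < k → x i j * x k j = (q) • (x k j * x i j))
    (hanti : ∀ i k j l : Fin N, i < k → j < l → x i l * x k j = x k j * x i l)
    (hdiag : ∀ i k j l : Fin N, i < k → j < l →
      x i j * x k l - x k l * x i j = ((q) - (q⁻¹)) • (x i l * x k j))
    (hgen : Algebra.adjoin ℂ (Set.range fun p : Fin N × Fin N => x p.1 p.2) = ⊤)
    (hfree : ∀ (B : Type) [Ring B] [Algebra ℂ B] (y : Fin N → Fin N → B),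
      (∀ i j l : Fin N, j < l → y i j * y i l = (q) • (y i l * y i j)) →
      (∀ i k j : Fin N, i < k → y i j * y k j = (q) • (y k j * y i j)) →
      (∀ i k j l : Fin N, i < k → j < l → y i l * y k j = y k j * y i l) →
      (∀ i k j l : Fin N, i < k → j < l →
        y i j * y k l - y k l * y i j = ((q) - (q⁻¹)) • (y i l * y k j)) →
      ∃! φ : M →ₐ[ℂ] B, ∀ i j, φ (x i j) = y i j)
    (ι : M →ₐ[ℂ] G) (dInv : G)
    (hd1 : ι (qdet (q) x) * dInv = 1)
    (hd2 : dInv * ι (qdet (q) x) = 1)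
    (hgenG : Algebra.adjoin ℂ
      (Set.range (fun p : Fin N × Fin N => ι (x p.1 p.2)) ∪ {dInv}) = ⊤)
    (hfreeG : ∀ (B : Type) [Ring B] [Algebra ℂ B] (φ : M →ₐ[ℂ] B) (u : B),
      φ (qdet (q) x) * u = 1 → u * φ (qdet (q) x) = 1 →
      ∃! ψ : G →ₐ[ℂ] B, ψ.comp ι = φ)
    (ΔM : M →ₐ[ℂ] M ⊗[ℂ] M)
    (hΔM : ∀ i j, ΔM (x i j) = ∑ k, x i k ⊗ₜ[ℂ] x k j)
    (ΔG : G →ₐ[ℂ] G ⊗[ℂ] G)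
    (hΔG : ∀ m, ΔG (ι m) = Algebra.TensorProduct.map ι ι (ΔM m))
    (εG : G →ₐ[ℂ] ℂ)
    (hεG : ∀ i j, εG (ι (x i j)) = if i = j then 1 else 0)
    (St : G →ₗ[ℂ] G)
    (hS1 : LinearMap.mul' ℂ G ∘ₗ TensorProduct.map St LinearMap.id ∘ₗ ΔG.toLinearMap
      = Algebra.linearMap ℂ G ∘ₗ εG.toLinearMap)
    (hS2 : LinearMap.mul' ℂ G ∘ₗ TensorProduct.map LinearMap.id St ∘ₗ ΔG.toLinearMap
      = Algebra.linearMap ℂ G ∘ₗ εG.toLinearMap)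
    (D : Type) [CommRing D] [Algebra ℂ D]
    (t : Fin N → (D)ˣ)
    (πD : G →ₐ[ℂ] D)
    (hπD : ∀ i j, πD (ι (x i j)) = if i = j then (t i : D) else 0)
    (hfreeD : ∀ (B : Type) [CommRing B] [Algebra ℂ B] (u : Fin N → Bˣ),
      ∃! φ : D →ₐ[ℂ] B, ∀ i, φ (t i : D) = (u i : B))
    (ξ : Matrix (Fin N) (Fin N) ℂ)
    (e : M →ₐ[ℂ] ℂ) (he : ∀ i j, e (x i j) = ξ i j)
    (htrans : Transcendental ↥(entriesSubfield ξ) q)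
    (hcent : Module.finrank ↥(entriesSubfield ξ)
      ↥(LinearMap.ker (LinearMap.mulLeft ↥(entriesSubfield ξ) (liftEntries ξ)
          - LinearMap.mulRight ↥(entriesSubfield ξ) (liftEntries ξ))) = N) :
    LinearMap.ker (coorbit e (adjBeta ΔM ι St))
      = Submodule.span ℂ {y : M | ∃ (i : Fin N) (h : M),
          y = (tauCoinv q q⁻¹ x (i.1 + 1) - algebraMap ℂ M (e (tauCoinv q q⁻¹ x (i.1 + 1)))) * h}
    ∧ ((∀ i j, i ≠ j → ξ i j = 0) →
        Set.range ⇑(coorbit e (adjBeta ΔM ι St)) = dCoinv πD ΔG) := by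
  have hrel : IsQMat q x := ⟨hrow, hcol, hanti, hdiag⟩
  obtain ⟨O, hqO, hKO, hres⟩ := exists_place _ htrans
  have hq1 : (q, (1 : IsLocalRing.ResidueField O)) ∈ redPair O := by
    rw [← hres]; exact redPair_coe (O := O) ⟨q, hqO⟩
  have H : IsQGL q x ι dInv ΔM ΔG εG St :=
    ⟨hq, add_inv_ne_zero hKO hq1, qFact_ne_zero hKO hq1, hrel, hgen, hd1, hd2, hgenG, hΔM, hΔG,
      hεG, hS1, hS2⟩
  have E : ExtProp q x ι := by
    intro B _ _ y hy hdet
    obtain ⟨φ, hφ, -⟩ := hfree B y hy.row hy.col hy.anti hy.diag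
    obtain ⟨u, hu⟩ := hdet
    have hφd : φ (qdet q x) = u := by
      rw [map_qdet, hu]
      simp only [hφ]
    obtain ⟨ψ, hψ, -⟩ := hfreeG B φ ↑u⁻¹ (by rw [hφd, Units.mul_inv]) (by rw [hφd, Units.inv_mul])
    exact ⟨ψ, fun i j => (AlgHom.congr_fun hψ (x i j)).trans (hφ i j)⟩
  obtain ⟨v, hv⟩ := exists_krylov_det_ne_zero _ hcent
  refine ⟨le_antisymm (H.ker_coorbit_le htrans E (liftEntries ξ) he hv) (H.span_le_ker he),
    fun hξ => ?_⟩
  have hlift : liftEntries ξ = Matrix.diagonal fun i => liftEntries ξ i i := by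
    ext i j
    rw [Matrix.diagonal_apply]
    split_ifs with h
    · rw [h]
    · exact hξ i j h
  rw [hlift] at hv
  refine H.range_coorbit htrans hπD hfreeD (injective_of_krylov_diagonal hv) fun i j => ?_
  rw [he]
  split_ifs with h
  · rw [h]; rfl
  · exact hξ i j h
end
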